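/- arXiv:math/0212394 — 6 statements merged into one kernel-verified Lean document; each statement's English description precedes it below -/
import Mathlib

section
/- Let λ = (λ₁, λ₂, λ₃) ∈ ℝ³ satisfy σ₂(λ) = λ₁λ₂ + λ₁λ₃ + λ₂λ₃ > 0. Then σ₁(λ) = λ₁ + λ₂ + λ₃ ≠ 0; moreover if σ₁(λ) > 0 then λᵢ + λⱼ > 0 for all i ≠ j, and if σ₁(λ) < 0 then λᵢ + λⱼ < 0 for all i ≠ j. (This is the pointwise algebraic content of Proposition 4.1(i): on a 3-manifold with σ₂(A_g) > 0, where A_g = Ric − (R/4)g is the Weyl–Schouten tensor with eigenvalues λᵢ and the sectional curvatures are R_{ijij} = λᵢ + λⱼ, either R > 0 and the sectional curvature is positive, or R < 0 and the sectional curvature is negative.) -/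
/-- `(a + b) σ₁ = σ₂ + a² + ab + b² > 0`. -/
lemma pair_mul_sigma1_pos (a b c : ℝ) (h : a * b + a * c + b * c > 0) :
    0 < (a + b) * (a + b + c) := by
  nlinarith [sq_nonneg (a + b), sq_nonneg a, sq_nonneg b]

/-- Pointwise algebraic content of Proposition 4.1(i) (dimension 3):
if `σ₂(λ) > 0` then `σ₁(λ) ≠ 0`; if `σ₁(λ) > 0` then all pairwise sums
`λᵢ + λⱼ` (`i ≠ j`) are positive, and if `σ₁(λ) < 0` they are all negative. -/
theorem sigma2_pos_dim3 (l : Fin 3 → ℝ)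
    (h2 : l 0 * l 1 + l 0 * l 2 + l 1 * l 2 > 0) :
    (l 0 + l 1 + l 2 ≠ 0) ∧
    (l 0 + l 1 + l 2 > 0 → ∀ i j : Fin 3, i ≠ j → l i + l j > 0) ∧
    (l 0 + l 1 + l 2 < 0 → ∀ i j : Fin 3, i ≠ j → l i + l j < 0) := by
  have key : ∀ i j : Fin 3, i ≠ j → 0 < (l i + l j) * (l 0 + l 1 + l 2) := by
    have h01 := pair_mul_sigma1_pos (l 0) (l 1) (l 2) h2
    have h02 := pair_mul_sigma1_pos (l 0) (l 2) (l 1) (by linarith)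
    have h12 := pair_mul_sigma1_pos (l 1) (l 2) (l 0) (by linarith)
    intro i j hij
    fin_cases i <;> fin_cases j <;> simp at hij ⊢ <;> linarith
  refine ⟨fun h => ?_, fun h i j hij => ?_, fun h i j hij => ?_⟩
  · have := key 0 1 (by decide)
    rw [h, mul_zero] at this
    exact lt_irrefl _ this
  · exact (pos_iff_pos_of_mul_pos (key i j hij)).2 h
  · by_contra hn
    have := key i j hij
    nlinarith
end

section
/- Let λ = (λ₁, λ₂, λ₃, λ₄) ∈ ℝ⁴ satisfy σ₂(λ) = Σ_{i<j} λᵢλⱼ > 0. Then σ₁(λ) = λ₁ + λ₂ + λ₃ + λ₄ ≠ 0; moreover if σ₁(λ) > 0 then λᵢ + σ₁(λ)/2 > 0 for all i = 1, …, 4, and if σ₁(λ) < 0 then λᵢ + σ₁(λ)/2 < 0 for all i. (This is the pointwise algebraic content of Proposition 4.1(ii): in dimension 4 the eigenvalues of the Ricci tensor are λᵢ + σ₁(λ)/2 where λᵢ are the eigenvalues of the Weyl–Schouten tensor A_g = Ric − (R/6)g, so σ₂(A_g) > 0 implies either R > 0 and Ric > 0, or R < 0 and Ric < 0.) -/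
theorem sigma2_key (a b c d : ℝ)
    (h : a * b + a * c + a * d + b * c + b * d + c * d > 0) :
    0 < ((a + b + c + d) - a) * ((a + b + c + d) + 2 * a) := by
  nlinarith [sq_nonneg (b - c), sq_nonneg (b - d), sq_nonneg (c - d)]

theorem sigma2_sign_pos (s a : ℝ) (h : 0 < (s - a) * (s + 2 * a)) (hs : s > 0) :
    a + s / 2 > 0 := by
  by_contra hc
  have h1 : s + 2 * a ≤ 0 := by linarith
  have h2 : 0 ≤ s - a := by linarith
  exact absurd h (not_lt.mpr (mul_nonpos_of_nonneg_of_nonpos h2 h1))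

theorem sigma2_sign_neg (s a : ℝ) (h : 0 < (s - a) * (s + 2 * a)) (hs : s < 0) :
    a + s / 2 < 0 := by
  have := sigma2_sign_pos (-s) (-a) (by linarith) (by linarith)
  linarith

/-- Pointwise algebraic content of Proposition 4.1(ii) (dimension 4):
if `σ₂(λ) > 0` then `σ₁(λ) ≠ 0`; if `σ₁(λ) > 0` then `λᵢ + σ₁(λ)/2 > 0`
for all `i`, and if `σ₁(λ) < 0` then `λᵢ + σ₁(λ)/2 < 0` for all `i`. -/
theorem sigma2_pos_dim4 (l : Fin 4 → ℝ)
    (h2 : l 0 * l 1 + l 0 * l 2 + l 0 * l 3 + l 1 * l 2 + l 1 * l 3 + l 2 * l 3 > 0) :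
    ((∑ i, l i) ≠ 0) ∧
    ((∑ i, l i) > 0 → ∀ i : Fin 4, l i + (∑ j, l j) / 2 > 0) ∧
    ((∑ i, l i) < 0 → ∀ i : Fin 4, l i + (∑ j, l j) / 2 < 0) := by
  have key : ∀ i : Fin 4, 0 < ((∑ j, l j) - l i) * ((∑ j, l j) + 2 * l i) := by
    have k0 := sigma2_key (l 0) (l 1) (l 2) (l 3) (by linarith)
    have k1 := sigma2_key (l 1) (l 0) (l 2) (l 3) (by linarith)
    have k2 := sigma2_key (l 2) (l 0) (l 1) (l 3) (by linarith)
    have k3 := sigma2_key (l 3) (l 0) (l 1) (l 2) (by linarith)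
    rw [Fin.sum_univ_four]
    intro i
    fin_cases i
    · show 0 < (l 0 + l 1 + l 2 + l 3 - l 0) * (l 0 + l 1 + l 2 + l 3 + 2 * l 0)
      linarith
    · show 0 < (l 0 + l 1 + l 2 + l 3 - l 1) * (l 0 + l 1 + l 2 + l 3 + 2 * l 1)
      linarith
    · show 0 < (l 0 + l 1 + l 2 + l 3 - l 2) * (l 0 + l 1 + l 2 + l 3 + 2 * l 2)
      linarith
    · show 0 < (l 0 + l 1 + l 2 + l 3 - l 3) * (l 0 + l 1 + l 2 + l 3 + 2 * l 3)
      linarith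
  refine ⟨?_, fun hs i => sigma2_sign_pos _ _ (key i) hs,
    fun hs i => sigma2_sign_neg _ _ (key i) hs⟩
  intro h0
  have := key 0
  rw [h0] at this
  nlinarith [sq_nonneg (l 0)]
end

section
/- Let n ≥ 3, let k be an integer with k ≥ n/2, and let λ = (λ₁, …, λ_n) ∈ ℝⁿ satisfy σ_j(λ) > 0 for every j = 1, …, k (i.e. λ lies in the Garding cone Γ_k⁺). Then λᵢ + σ₁(λ)/(n−2) > 0 for every i = 1, …, n. (This is the pointwise algebraic content of Proposition 4.1(iii): the eigenvalues of the Ricci tensor are λᵢ + σ₁(λ)/(n−2) where λᵢ are the eigenvalues of the Weyl–Schouten tensor A_g = Ric − (R/(2(n−1)))g, so A_g ∈ Γ_k⁺ with k ≥ n/2 implies Ric > 0.) -/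
/-- The `k`-th elementary symmetric polynomial of `λ₁, …, λ_n`. -/
noncomputable def esymm {n : ℕ} (k : ℕ) (l : Fin n → ℝ) : ℝ :=
  ∑ s ∈ Finset.univ.powersetCard k, ∏ i ∈ s, l i

open Polynomial in
lemma newton_base (t : Multiset ℝ) :
    2 * (t.card : ℝ) * ((t.map (fun x => X - C x)).prod.coeff 0 *
      (t.map (fun x => X - C x)).prod.coeff 2) ≤
      ((t.card : ℝ) - 1) * (t.map (fun x => X - C x)).prod.coeff 1 ^ 2 := by
  induction t using Multiset.induction_on with
  | empty => simp [coeff_one]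
  | cons c t ih =>
    have hz : t.card = 0 → t = 0 := Multiset.card_eq_zero.mp
    simp only [Multiset.map_cons, Multiset.prod_cons, Multiset.card_cons]
    set P := (t.map (fun x => X - C x)).prod with hP
    have e0 : ((X - C c) * P).coeff 0 = - c * P.coeff 0 := by
      simp [sub_mul]
    have e1 : ((X - C c) * P).coeff 1 = P.coeff 0 - c * P.coeff 1 := by
      simp [sub_mul, coeff_X_mul]
    have e2 : ((X - C c) * P).coeff 2 = P.coeff 1 - c * P.coeff 2 := by
      simp [sub_mul, coeff_X_mul]
    rw [e0, e1, e2]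
    rcases Nat.eq_zero_or_pos t.card with h0 | h0
    · have : t = 0 := hz h0
      subst this
      simp [hP, coeff_one]
    · have hm : (0 : ℝ) < (t.card : ℝ) := by exact_mod_cast h0
      push_cast
      generalize (t.card : ℝ) = m at *
      generalize P.coeff 0 = a at *
      generalize P.coeff 1 = b at *
      generalize P.coeff 2 = d at *
      have h1 : 0 ≤ (m + 1) * c ^ 2 * ((m - 1) * b ^ 2 - 2 * m * (a * d)) :=
        mul_nonneg (by positivity) (by linarith)
      have h2 := sq_nonneg (m * a + c * b)
      have : 0 ≤ m * ((m + 1 - 1) * (a - c * b) ^ 2 -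
          2 * (m + 1) * (-c * a * (b - c * d))) := by nlinarith
      have := nonneg_of_mul_nonneg_right this hm
      linarith

open Polynomial in
lemma splits_deriv {P : ℝ[X]} (h : P.Splits) : (derivative P).Splits := by
  rw [splits_iff_card_roots] at h ⊢
  have h1 := card_roots_le_derivative P
  have h2 := natDegree_derivative_le P
  have h3 := card_roots' (derivative P)
  omega

open Polynomial in
lemma newton_coeff (r : ℕ) : ∀ P : ℝ[X], P.Splits →
    ((P.natDegree : ℝ) - r) * (r + 2) * (P.coeff r * P.coeff (r + 2)) ≤
      ((P.natDegree : ℝ) - r - 1) * (r + 1) * P.coeff (r + 1) ^ 2 := by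
  induction r with
  | zero =>
    intro P hP
    have hb := newton_base P.roots
    have hd : P.roots.card = P.natDegree := splits_iff_card_roots.mp hP
    have he := hP.eq_prod_roots
    rw [hd] at hb
    have hc : ∀ i, P.coeff i = P.leadingCoeff *
        (P.roots.map (fun x => X - C x)).prod.coeff i := by
      intro i
      conv_lhs => rw [he]
      rw [coeff_C_mul]
    rw [hc 0, hc (0 + 2), hc (0 + 1)]
    have := mul_le_mul_of_nonneg_left hb (sq_nonneg P.leadingCoeff)
    simp only [Nat.cast_zero, zero_add]
    nlinarith
  | succ r ih =>
    intro P hP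
    rcases Nat.eq_zero_or_pos P.natDegree with h0 | h0
    · have h1 : P.coeff (r + 1) = 0 := coeff_eq_zero_of_natDegree_lt (by omega)
      have h2 : P.coeff (r + 1 + 1) = 0 := coeff_eq_zero_of_natDegree_lt (by omega)
      rw [h1, h2]; simp
    · have := ih _ (splits_deriv hP)
      have hd : ((derivative P).natDegree : ℝ) = P.natDegree - 1 := by
        rw [natDegree_derivative]
        rw [Nat.cast_sub h0]; simp
      rw [hd] at this
      simp only [coeff_derivative] at this
      push_cast at this ⊢
      rw [show r + 1 + 2 = r + 2 + 1 by ring]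
      generalize (P.natDegree : ℝ) = m at *
      have hp : (0 : ℝ) < ((r : ℝ) + 1) * (r + 2) := by positivity
      refine le_of_mul_le_mul_left ?_ hp
      nlinarith

open Polynomial in
lemma newton_esymm (t : Multiset ℝ) (j : ℕ) (hj : j + 2 ≤ t.card) :
    ((j : ℝ) + 2) * (t.card - j) * (t.esymm (j + 2) * t.esymm j) ≤
      ((j : ℝ) + 1) * (t.card - (j + 1)) * t.esymm (j + 1) ^ 2 := by
  have hs : ((t.map (fun r => X + C r)).prod).Splits := by
    apply Splits.multisetProd
    intro f hf
    obtain ⟨r, -, rfl⟩ := Multiset.mem_map.mp hf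
    exact Splits.X_add_C r
  have hd : ((t.map (fun r => X + C r)).prod).natDegree = t.card := by
    rw [natDegree_multiset_prod_of_monic]
    · simp
    · intro f hf
      obtain ⟨r, -, rfl⟩ := Multiset.mem_map.mp hf
      exact monic_X_add_C r
  have h := newton_coeff (t.card - (j + 2)) _ hs
  rw [hd, Multiset.prod_X_add_C_coeff t (by omega), Multiset.prod_X_add_C_coeff t (by omega),
    Multiset.prod_X_add_C_coeff t (by omega)] at h
  rw [show t.card - (t.card - (j + 2)) = j + 2 by omega,
    show t.card - (t.card - (j + 2) + 2) = j by omega,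
    show t.card - (t.card - (j + 2) + 1) = j + 1 by omega, Nat.cast_sub hj] at h
  push_cast at h
  nlinarith

lemma maclaurin_ratio (t : Multiset ℝ) (j : ℕ) (hj : j + 1 ≤ t.card)
    (hpos : ∀ i ≤ j, 0 < t.esymm i) :
    t.esymm (j + 1) * (t.card * (j + 1)) ≤ (t.card - j) * (t.esymm 1 * t.esymm j) := by
  induction j with
  | zero => simp [Multiset.esymm, mul_comm]
  | succ j ih =>
    have h1 := ih (by omega) (fun i hi => hpos i (by omega))
    have h2 := newton_esymm t j hj
    have p0 := hpos j (by omega)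
    have p1 := hpos (j + 1) le_rfl
    have hc : (j : ℝ) + 2 ≤ t.card := by exact_mod_cast hj
    rw [show j + 1 + 1 = j + 2 by ring]
    push_cast
    generalize (t.card : ℝ) = m at *
    generalize t.esymm (j + 2) = c at *
    generalize t.esymm (j + 1) = b at *
    generalize t.esymm j = a at *
    generalize t.esymm 1 = s at *
    have hjn : (0 : ℝ) ≤ j := Nat.cast_nonneg j
    have hq : 0 < (m - j) * a := mul_pos (by linarith) p0
    refine le_of_mul_le_mul_left ?_ hq
    have h3 := mul_le_mul_of_nonneg_left h1
      (mul_nonneg (by linarith : 0 ≤ m - (j + 1)) p1.le)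
    have h4 := mul_le_mul_of_nonneg_left h2 (by linarith : 0 ≤ m)
    nlinarith

lemma mesymm_cons (a : ℝ) (t : Multiset ℝ) (j : ℕ) :
    (a ::ₘ t).esymm (j + 1) = t.esymm (j + 1) + a * t.esymm j := by
  simp [Multiset.esymm, Multiset.powersetCard_cons, Multiset.sum_map_mul_left]

theorem garding_cone_ricci_pos (n k : ℕ) (hn : 3 ≤ n) (hk : n ≤ 2 * k)
    (l : Fin n → ℝ)
    (h : ∀ j : ℕ, 1 ≤ j → j ≤ k → 0 < esymm j l) :
    ∀ i : Fin n, 0 < l i + (∑ j, l j) / ((n : ℝ) - 2) := by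
  intro i
  have hn' : (3 : ℝ) ≤ n := by exact_mod_cast hn
  have hn2 : (0 : ℝ) < (n : ℝ) - 2 := by linarith
  have hσ : ∑ j, l j = esymm 1 l := by
    simp [esymm, Finset.powersetCard_one]
  have hσp : 0 < ∑ j, l j := by rw [hσ]; exact h 1 le_rfl (by omega)
  rcases le_or_gt 0 (l i) with hi | hi
  · have := div_pos hσp hn2
    linarith
  obtain ⟨t, ht⟩ : ∃ t, t = (Finset.univ.erase i).val.map l := ⟨_, rfl⟩
  have hcons : Finset.univ.val.map l = l i ::ₘ t := by
    rw [ht, ← Multiset.map_cons, Finset.erase_val, Multiset.cons_erase (Finset.mem_univ i)]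
  have hcard : t.card + 1 = n := by
    have := congrArg Multiset.card hcons
    simp at this
    exact this.symm
  have hes : ∀ j, esymm (j + 1) l = t.esymm (j + 1) + l i * t.esymm j := by
    intro j
    rw [← mesymm_cons, ← hcons, Finset.esymm_map_val]
    rfl
  have h0 : t.esymm 0 = 1 := by simp [Multiset.esymm]
  have hpos : ∀ j ≤ k, 0 < t.esymm j := by
    intro j
    induction j with
    | zero => intro _; rw [h0]; exact one_pos
    | succ j ih =>
      intro hj
      have h1 := ih (by omega)
      have h2 := h (j + 1) (by omega) hj
      rw [hes] at h2
      nlinarith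
  -- choose a suitable index
  obtain ⟨q, hq1, hq2, hq3⟩ : ∃ q, q + 1 ≤ k ∧ n ≤ 2 * (q + 1) ∧ q + 1 ≤ t.card :=
    ⟨(n + 1) / 2 - 1, by omega, by omega, by omega⟩
  have hm := maclaurin_ratio t q hq3 (fun i hi => hpos i (by omega))
  have hk1 := h (q + 1) (by omega) hq1
  rw [hes] at hk1
  have pq := hpos q (by omega)
  have p1 := hpos 1 (by omega)
  have hs : ∑ j, l j = t.esymm 1 + l i := by
    rw [hσ, hes 0, h0, mul_one]
  rw [hs]
  have hnc : (n : ℝ) = t.card + 1 := by exact_mod_cast hcard.symm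
  have hq2' : (n : ℝ) ≤ 2 * (q + 1) := by exact_mod_cast hq2
  rw [hnc] at hn2 hq2' ⊢
  generalize (t.card : ℝ) = m at *
  generalize t.esymm (q + 1) = c at *
  generalize t.esymm q = b at *
  generalize t.esymm 1 = s at *
  generalize l i = a at *
  have hqn : (0 : ℝ) ≤ q := Nat.cast_nonneg q
  have hmq : 0 < m * ((q : ℝ) + 1) := mul_pos (by linarith) (by linarith)
  have h5 : b * (-a * (m * (q + 1))) < b * ((m - q) * s) := by
    have := mul_lt_mul_of_pos_right (show -a * b < c by linarith) hmq
    nlinarith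
  have h6 := lt_of_mul_lt_mul_left h5 pq.le
  have h7 : (m - q) * s ≤ (q + 1) * s := mul_le_mul_of_nonneg_right (by linarith) p1.le
  have h8 : 0 < s + m * a := by
    have : 0 < ((q : ℝ) + 1) * (s + m * a) := by nlinarith
    exact (mul_pos_iff_of_pos_left (by linarith)).mp this
  have : a + (s + a) / (m + 1 - 2) = (s + m * a) / (m + 1 - 2) := by
    field_simp
    ring
  rw [this]
  exact div_pos h8 hn2
end

section
/- (Moser's sharp inequality in ℝⁿ.) Fix an integer n ≥ 2 and set ω_{n−1} = the surface measure of the unit sphere Sⁿ⁻¹ ⊂ ℝⁿ (equivalently ω_{n−1} = n · vol(unit ball)), and α_n = n · ω_{n−1}^{1/(n−1)}. There exists a constant C = C(n) > 0 such that for every bounded open set Ω ⊂ ℝⁿ and every smooth function u : ℝⁿ → ℝ with compact support contained in Ω satisfying ∫_Ω |∇u|ⁿ dx ≤ 1, one has ∫_Ω exp( α_n |u|^{n/(n−1)} ) dx ≤ C · vol(Ω). -/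
noncomputable section

open MeasureTheory Real

/-- `ω_{n−1}`: the surface measure of the unit sphere in `ℝⁿ`,
equal to `n` times the Lebesgue measure of the unit ball. -/
def sphereArea (n : ℕ) : ℝ :=
  n * (volume (Metric.ball (0 : EuclideanSpace ℝ (Fin n)) 1)).toReal

/-- `α_n = n · ω_{n−1}^{1/(n−1)}`, the sharp Moser constant. -/
def moserConst (n : ℕ) : ℝ :=
  n * sphereArea n ^ ((1 : ℝ) / (n - 1))

section
open MeasureTheory Set
open scoped ENNReal Pointwise

lemma bm_one {A B C : Set ℝ} (hA : MeasurableSet A) (hB : MeasurableSet B)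
    (hAn : A.Nonempty) (hBn : B.Nonempty) (h : ∀ x ∈ A, ∀ y ∈ B, x + y ∈ C) :
    volume A + volume B ≤ volume C := by
  have key : ∀ K L : Set ℝ, IsCompact K → IsCompact L → K.Nonempty → L.Nonempty →
      K ⊆ A → L ⊆ B → volume K + volume L ≤ volume C := by
    intro K L hK hL hKn hLn hKA hLB
    obtain ⟨k, hk, hk'⟩ := hK.exists_isGreatest hKn
    obtain ⟨l, hl, hl'⟩ := hL.exists_isLeast hLn
    have e1 : volume K = volume ((fun x => l + x) '' K) := by
      rw [image_add_left, measure_preimage_add]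
    have e2 : volume L = volume ((fun x => k + x) '' L) := by
      rw [image_add_left, measure_preimage_add]
    rw [e1, e2]
    have hm : MeasurableSet ((fun x => k + x) '' L) :=
      (hL.image (by fun_prop)).measurableSet
    have hInteg : volume (((fun x => l + x) '' K) ∩ ((fun x => k + x) '' L)) = 0 := by
      have : (((fun x => l + x) '' K) ∩ ((fun x => k + x) '' L)) ⊆ {k + l} := by
        rintro z ⟨⟨x, hx, rfl⟩, ⟨y, hy, hxy⟩⟩
        have h1 := hk' hx
        have h2 := hl' hy
        simp only [mem_singleton_iff] at *
        linarith
      exact measure_mono_null this (by simp)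
    rw [← measure_union_add_inter _ hm, hInteg, add_zero]
    apply measure_mono
    rintro z (⟨x, hx, rfl⟩ | ⟨x, hx, rfl⟩)
    · have := h x (hKA hx) l (hLB hl)
      simpa [add_comm] using this
    · exact h k (hKA hk) x (hLB hx)
  obtain ⟨a0, ha0⟩ := hAn
  obtain ⟨b0, hb0⟩ := hBn
  have key2 : ∀ K L : Set ℝ, IsCompact K → IsCompact L → 
      K ⊆ A → L ⊆ B → volume K + volume L ≤ volume C := by
    intro K L hK hL hKA hLB
    refine le_trans ?_ (key (insert a0 K) (insert b0 L) (hK.insert _) (hL.insert _)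
      (insert_nonempty _ _) (insert_nonempty _ _) (insert_subset ha0 hKA) (insert_subset hb0 hLB))
    gcongr <;> exact subset_insert _ _
  rw [hA.measure_eq_iSup_isCompact, hB.measure_eq_iSup_isCompact]
  simp_rw [iSup_and']
  exact ENNReal.biSup_add_biSup_le' ⟨∅, empty_subset _, isCompact_empty⟩
    ⟨∅, empty_subset _, isCompact_empty⟩ fun K hK L hL => key2 K L hK.2 hL.2 hK.1 hL.1

lemma layer_one (f : ℝ → ℝ≥0∞) (hf : Measurable f) :
    ∫⁻ x, min (f x) 1 = ∫⁻ t in Ioo (0:ℝ) 1, volume {x | ENNReal.ofReal t < f x} := by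
  have h1 : ∀ x, min (f x) 1 = ENNReal.ofReal (min (f x) 1).toReal := fun x =>
    (ENNReal.ofReal_toReal (by simp)).symm
  rw [lintegral_congr h1]
  rw [lintegral_eq_lintegral_meas_lt _ (ae_of_all _ fun x => ENNReal.toReal_nonneg)
    (by fun_prop)]
  rw [← lintegral_indicator measurableSet_Ioi, ← lintegral_indicator measurableSet_Ioo]
  refine lintegral_congr fun t => ?_
  by_cases h0 : 0 < t
  · by_cases h2 : t < 1
    · rw [indicator_of_mem (by simpa using h0), indicator_of_mem (by simp [h0, h2])]
      congr 1
      ext x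
      simp only [mem_ofPred_eq]
      rw [← ENNReal.ofReal_lt_iff_lt_toReal h0.le (by simp), lt_min_iff]
      simp [h2]
    · rw [indicator_of_mem (by simpa using h0), indicator_of_notMem (by simp [h2])]
      have : {a | t < (min (f a) 1).toReal} = ∅ := by
        ext x
        simp only [mem_ofPred_eq, mem_empty_iff_false, iff_false, not_lt]
        refine le_trans ?_ (not_lt.1 h2)
        exact ENNReal.toReal_le_of_le_ofReal zero_le_one (by simp)
      simp [this]
  · rw [indicator_of_notMem (by simpa using h0), indicator_of_notMem (by simp [h0])]

lemma ennreal_amgm {a b : ℝ} (ha : 0 < a) (hb : 0 < b) (hab : a + b = 1) (x y : ℝ≥0∞) :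
    x ^ a * y ^ b ≤ ENNReal.ofReal a * x + ENNReal.ofReal b * y := by
  by_cases hx : x = ∞
  · simp [hx, ha]
  by_cases hy : y = ∞
  · simp [hy, hb]
  lift x to NNReal using hx
  lift y to NNReal using hy
  rw [← ENNReal.coe_rpow_of_nonneg _ ha.le, ← ENNReal.coe_rpow_of_nonneg _ hb.le, ENNReal.ofReal,
    ENNReal.ofReal]
  norm_cast
  have := NNReal.geom_mean_le_arith_mean2_weighted a.toNNReal b.toNNReal x y (by
    rw [← NNReal.coe_inj]
    simp [ha.le, hb.le, hab])
  simpa [ha.le, hb.le] using this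

/-- Prékopa–Leindler, normalised one-dimensional case. -/
lemma pl_one_norm {a b : ℝ} (ha : 0 < a) (hb : 0 < b) (hab : a + b = 1)
    {f g h : ℝ → ℝ≥0∞} (hf : Measurable f) (hg : Measurable g)
    (hf1 : (⨆ x, f x) = 1) (hg1 : (⨆ x, g x) = 1)
    (H : ∀ x y, f x ^ a * g y ^ b ≤ h (a * x + b * y)) (hh : Measurable h) :
    ENNReal.ofReal a * (∫⁻ x, f x) + ENNReal.ofReal b * (∫⁻ x, g x) ≤ ∫⁻ x, h x := by
  have ef : ∫⁻ x, f x = ∫⁻ x, min (f x) 1 :=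
    lintegral_congr fun x => (min_eq_left (hf1 ▸ le_iSup f x)).symm
  have eg : ∫⁻ x, g x = ∫⁻ x, min (g x) 1 :=
    lintegral_congr fun x => (min_eq_left (hg1 ▸ le_iSup g x)).symm
  have eh : ∫⁻ x, min (h x) 1 ≤ ∫⁻ x, h x := lintegral_mono fun x => min_le_left _ _
  refine le_trans ?_ eh
  rw [ef, eg, layer_one f hf, layer_one g hg, layer_one h hh]
  have mm : ∀ k : ℝ → ℝ≥0∞, Measurable fun t : ℝ => volume {x | ENNReal.ofReal t < k x} := by
    intro k
    apply Antitone.measurable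
    intro s t hst
    apply measure_mono
    intro x hx
    exact lt_of_le_of_lt (ENNReal.ofReal_le_ofReal hst) hx
  rw [← lintegral_const_mul _ (mm f), ← lintegral_const_mul _ (mm g),
    ← lintegral_add_left ((mm f).const_mul _)]
  apply setLIntegral_mono' measurableSet_Ioo
  intro t ht
  have e1 : ∀ (c : ℝ) (_ : 0 < c) (A : Set ℝ), ENNReal.ofReal c * volume A = volume (c • A) := by
    intro c hc A
    rw [Measure.addHaar_smul]
    simp [abs_of_pos hc]
  rw [e1 a ha, e1 b hb]
  have ht1 : ENNReal.ofReal t < 1 := by simpa using ht.2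
  have ht0 : ENNReal.ofReal t ≠ 0 := by simpa using ht.1
  obtain ⟨x0, hx0⟩ := lt_iSup_iff.1 (hf1 ▸ ht1)
  obtain ⟨y0, hy0⟩ := lt_iSup_iff.1 (hg1 ▸ ht1)
  apply bm_one
  · exact (measurableSet_lt measurable_const hf).const_smul₀ a
  · exact (measurableSet_lt measurable_const hg).const_smul₀ b
  · exact ⟨a • x0, smul_mem_smul_set hx0⟩
  · exact ⟨b • y0, smul_mem_smul_set hy0⟩
  · rintro _ ⟨x, hx, rfl⟩ _ ⟨y, hy, rfl⟩
    refine lt_of_lt_of_le ?_ (H x y)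
    simp only [mem_ofPred_eq] at hx hy
    calc ENNReal.ofReal t = ENNReal.ofReal t ^ a * ENNReal.ofReal t ^ b := by
          rw [← ENNReal.rpow_add _ _ ht0 (by simp), hab, ENNReal.rpow_one]
      _ < f x ^ a * g y ^ b := by
          apply ENNReal.mul_lt_mul
          · exact ENNReal.rpow_lt_rpow hx ha
          · exact ENNReal.rpow_lt_rpow hy hb

lemma pl_one_bdd {a b : ℝ} (ha : 0 < a) (hb : 0 < b) (hab : a + b = 1)
    {f g h : ℝ → ℝ≥0∞} (hf : Measurable f) (hg : Measurable g)
    (hf1 : (⨆ x, f x) ≠ ∞) (hg1 : (⨆ x, g x) ≠ ∞)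
    (H : ∀ x y, f x ^ a * g y ^ b ≤ h (a * x + b * y)) (hh : Measurable h) :
    (∫⁻ x, f x) ^ a * (∫⁻ x, g x) ^ b ≤ ∫⁻ x, h x := by
  set F := ⨆ x, f x with hF
  set G := ⨆ x, g x with hG
  by_cases hF0 : F = 0
  · have : ∀ x, f x = 0 := by simpa [hF] using hF0
    simp [this, ha]
  by_cases hG0 : G = 0
  · have : ∀ x, g x = 0 := by simpa [hG] using hG0
    simp [this, hb]
  have cF0 : F ^ a ≠ 0 := by simp [ENNReal.rpow_eq_zero_iff, hF0, hf1]
  have cG0 : G ^ b ≠ 0 := by simp [ENNReal.rpow_eq_zero_iff, hG0, hg1]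
  have cF : F ^ a ≠ ∞ := ENNReal.rpow_ne_top_of_nonneg ha.le hf1
  have cG : G ^ b ≠ ∞ := ENNReal.rpow_ne_top_of_nonneg hb.le hg1
  have key := pl_one_norm (f := fun x => F⁻¹ * f x) (g := fun x => G⁻¹ * g x)
    (h := fun x => (F ^ a * G ^ b)⁻¹ * h x) ha hb hab (hf.const_mul _) (hg.const_mul _)
    (by rw [← ENNReal.mul_iSup]; exact ENNReal.inv_mul_cancel hF0 hf1)
    (by rw [← ENNReal.mul_iSup]; exact ENNReal.inv_mul_cancel hG0 hg1) (by
      intro x y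
      rw [ENNReal.mul_rpow_of_nonneg _ _ ha.le, ENNReal.mul_rpow_of_nonneg _ _ hb.le,
        ENNReal.inv_rpow, ENNReal.inv_rpow, ENNReal.mul_inv (Or.inl cF0) (Or.inl cF)]
      calc _ = ((F ^ a)⁻¹ * (G ^ b)⁻¹) * (f x ^ a * g y ^ b) := by ring
        _ ≤ _ := by gcongr; exact H x y) (hh.const_mul _)
  rw [lintegral_const_mul _ hf, lintegral_const_mul _ hg, lintegral_const_mul _ hh] at key
  have k2 := (ennreal_amgm ha hb hab _ _).trans key
  rw [ENNReal.mul_rpow_of_nonneg _ _ ha.le, ENNReal.mul_rpow_of_nonneg _ _ hb.le,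
        ENNReal.inv_rpow, ENNReal.inv_rpow, ENNReal.mul_inv (Or.inl cF0) (Or.inl cF)] at k2
  have k3 : (F ^ a)⁻¹ * (G ^ b)⁻¹ * ((∫⁻ x, f x) ^ a * (∫⁻ x, g x) ^ b) ≤
      (F ^ a)⁻¹ * (G ^ b)⁻¹ * ∫⁻ x, h x := by
    refine le_trans (le_of_eq ?_) k2
    ring
  rwa [ENNReal.mul_le_mul_iff_right] at k3
  · simp [cF, cG]
  · exact ENNReal.mul_ne_top (by simpa using cF0) (by simpa using cG0)

lemma pl_one {a b : ℝ} (ha : 0 < a) (hb : 0 < b) (hab : a + b = 1)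
    {f g h : ℝ → ℝ≥0∞} (hf : Measurable f) (hg : Measurable g)
    (H : ∀ x y, f x ^ a * g y ^ b ≤ h (a * x + b * y)) (hh : Measurable h) :
    (∫⁻ x, f x) ^ a * (∫⁻ x, g x) ^ b ≤ ∫⁻ x, h x := by
  have hlim : ∀ f : ℝ → ℝ≥0∞, Measurable f →
      Filter.Tendsto (fun k : ℕ => ∫⁻ x, min (f x) k) Filter.atTop (nhds (∫⁻ x, f x)) := by
    intro f hf
    have := lintegral_tendsto_of_tendsto_of_monotone (μ := volume) (f := fun (k : ℕ) x => min (f x) k)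
      (F := f) (fun k => (hf.min measurable_const).aemeasurable)
      (ae_of_all _ fun x i j hij => by dsimp only; gcongr)
      (ae_of_all _ fun x => by
        have h1 := (tendsto_const_nhds (x := f x)).min ENNReal.tendsto_nat_nhds_top
        simpa using h1)
    exact this
  by_cases hf0 : ∫⁻ x, f x = 0
  · simp [hf0, ha]
  by_cases hg0 : ∫⁻ x, g x = 0
  · simp [hg0, hb]
  have h1 := ((hlim f hf).ennrpow_const a)
  have h2 := ((hlim g hg).ennrpow_const b)
  have h3 := ENNReal.Tendsto.mul h1 (Or.inl (by simp [ENNReal.rpow_eq_zero_iff, hf0, ha.le])) h2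
    (Or.inl (by simp [ENNReal.rpow_eq_zero_iff, hg0, hb.le]))
  refine le_of_tendsto' h3 fun k => ?_
  apply pl_one_bdd ha hb hab (hf.min measurable_const) (hg.min measurable_const) _ _ _ hh
  · exact ne_top_of_le_ne_top (ENNReal.natCast_ne_top k) (iSup_le fun x => min_le_right _ _)
  · exact ne_top_of_le_ne_top (ENNReal.natCast_ne_top k) (iSup_le fun x => min_le_right _ _)
  · intro x y
    refine le_trans ?_ (H x y)
    gcongr <;> exact min_le_left _ _

/-- Prékopa–Leindler inequality on `ℝᵈ`. -/
lemma pl_pi {a b : ℝ} (ha : 0 < a) (hb : 0 < b) (hab : a + b = 1) (d : ℕ) :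
    ∀ {f g h : (Fin d → ℝ) → ℝ≥0∞}, Measurable f → Measurable g → Measurable h →
    (∀ x y, f x ^ a * g y ^ b ≤ h (a • x + b • y)) →
    (∫⁻ x, f x) ^ a * (∫⁻ x, g x) ^ b ≤ ∫⁻ x, h x := by
  induction d with
  | zero =>
    intro f g h hf hg hh H
    have key : ∀ x y z : Fin 0 → ℝ, f x ^ a * g y ^ b ≤ h z := fun x y z => by
      rw [Subsingleton.elim z (a • x + b • y)]
      exact H x y
    simp only [lintegral_unique]
    have hv : volume (univ : Set (Fin 0 → ℝ)) = 1 := by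
      rw [Measure.volume_pi_eq_dirac]; simp
    simpa only [hv, mul_one] using key _ _ _
  | succ d ih =>
    intro f g h hf hg hh H
    have mp := (volume_preserving_piFinSuccAbove (fun _ : Fin (d + 1) => ℝ) 0).symm
    have tr : ∀ k : (Fin (d + 1) → ℝ) → ℝ≥0∞, Measurable k →
        ∫⁻ x, k x = ∫⁻ s : ℝ, ∫⁻ y : Fin d → ℝ, k (Fin.cons s y) := by
      intro k hk
      rw [← mp.lintegral_comp hk, Measure.volume_eq_prod, lintegral_prod]
      · simp [MeasurableEquiv.piFinSuccAbove, Fin.consEquiv]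
      · exact (hk.comp (MeasurableEquiv.measurable _)).aemeasurable
    have meas : ∀ k : (Fin (d + 1) → ℝ) → ℝ≥0∞, Measurable k →
        Measurable fun p : ℝ × (Fin d → ℝ) => k (Fin.cons p.1 p.2) := by
      intro k hk
      have := hk.comp (MeasurableEquiv.piFinSuccAbove (fun _ : Fin (d + 1) => ℝ) 0).symm.measurable
      simpa [MeasurableEquiv.piFinSuccAbove, Fin.consEquiv, Function.comp_def] using this
    rw [tr f hf, tr g hg, tr h hh]
    apply pl_one ha hb hab (meas f hf).lintegral_prod_right' (meas g hg).lintegral_prod_right' _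
      (meas h hh).lintegral_prod_right'
    intro s t
    apply ih ((meas f hf).comp measurable_prodMk_left) ((meas g hg).comp measurable_prodMk_left)
      ((meas h hh).comp measurable_prodMk_left)
    intro x y
    refine (H _ _).trans (le_of_eq ?_)
    simp only [Function.comp_apply]
    congr 1
    funext i
    refine Fin.cases ?_ (fun j => ?_) i <;> simp

end

section
open MeasureTheory Set
open scoped ENNReal Pointwise

lemma bm_mul {n : ℕ} {a b : ℝ} (ha : 0 < a) (hb : 0 < b) (hab : a + b = 1)
    {A B C : Set (EuclideanSpace ℝ (Fin n))} (hA : MeasurableSet A) (hB : MeasurableSet B)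
    (hC : MeasurableSet C) (H : ∀ x ∈ A, ∀ y ∈ B, a • x + b • y ∈ C) :
    volume A ^ a * volume B ^ b ≤ volume C := by
  have mp := PiLp.volume_preserving_toLp (Fin n)
  have me : Measurable (WithLp.toLp 2 : (Fin n → ℝ) → EuclideanSpace ℝ (Fin n)) := mp.measurable
  have tr : ∀ S : Set (EuclideanSpace ℝ (Fin n)), MeasurableSet S →
      volume S = ∫⁻ x, ((WithLp.toLp 2 : (Fin n → ℝ) → EuclideanSpace ℝ (Fin n)) ⁻¹' S).indicator
        (fun _ => (1:ℝ≥0∞)) x := by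
    intro S hS
    rw [lintegral_indicator (me hS)]
    simp [mp.measure_preimage hS.nullMeasurableSet]
  rw [tr A hA, tr B hB, tr C hC]
  apply pl_pi ha hb hab n (measurable_const.indicator (me hA)) (measurable_const.indicator (me hB))
    (measurable_const.indicator (me hC))
  intro x y
  by_cases hx : x ∈ ((WithLp.toLp 2 : (Fin n → ℝ) → EuclideanSpace ℝ (Fin n)) ⁻¹' A)
  · by_cases hy : y ∈ ((WithLp.toLp 2 : (Fin n → ℝ) → EuclideanSpace ℝ (Fin n)) ⁻¹' B)
    · have : a • x + b • y ∈ ((WithLp.toLp 2 : (Fin n → ℝ) → EuclideanSpace ℝ (Fin n)) ⁻¹' C) := by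
        simpa using H _ hx _ hy
      rw [indicator_of_mem hx, indicator_of_mem hy, indicator_of_mem this]
      simp
    · rw [indicator_of_notMem hy]
      simp [hb]
  · rw [indicator_of_notMem hx]
    simp [ha]

lemma bm_ball {n : ℕ} (hn : 2 ≤ n) {A : Set (EuclideanSpace ℝ (Fin n))} (hA : MeasurableSet A)
    {v e k ε : ℝ} (hv : 0 < v) (hk : 0 < k) (hε : 0 < ε) (he : e = ε * k)
    (hAv : volume A = ENNReal.ofReal (v ^ n))
    (hk1 : volume (Metric.ball (0 : EuclideanSpace ℝ (Fin n)) 1) = ENNReal.ofReal (k ^ n)) :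
    ENNReal.ofReal (v ^ n + n * v ^ (n - 1) * e) ≤ volume (Metric.thickening ε A) := by
  have : Nonempty (Fin n) := ⟨⟨0, by omega⟩⟩
  have he0 : 0 < e := by rw [he]; positivity
  have hs : 0 < v + e := by positivity
  have ha : 0 < v / (v + e) := by positivity
  have hb : 0 < e / (v + e) := by positivity
  have hab : v / (v + e) + e / (v + e) = 1 := by field_simp
  set a := v / (v + e) with had
  set b := e / (v + e) with hbd
  have h1 : volume (a⁻¹ • A) = ENNReal.ofReal ((v + e) ^ n) := by
    rw [Measure.addHaar_smul, hAv, ← ENNReal.ofReal_mul (by positivity)]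
    congr 1
    rw [abs_of_pos (by positivity)]
    simp only [finrank_euclideanSpace, Fintype.card_fin]
    rw [← mul_pow, had]
    congr 1
    field_simp
  have h2 : volume (Metric.ball (0 : EuclideanSpace ℝ (Fin n)) (b⁻¹ * ε)) =
      ENNReal.ofReal ((v + e) ^ n) := by
    rw [Measure.addHaar_ball _ _ (by positivity), hk1, ← ENNReal.ofReal_mul (by positivity)]
    congr 1
    simp only [finrank_euclideanSpace, Fintype.card_fin]
    rw [← mul_pow, hbd]
    congr 1
    rw [he] at he0 ⊢
    field_simp
  have key := bm_mul ha hb hab (hA.const_smul₀ a⁻¹)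
    (Metric.isOpen_ball (x := (0 : EuclideanSpace ℝ (Fin n))) (ε := b⁻¹ * ε)).measurableSet
    (Metric.isOpen_thickening (δ := ε) (E := A)).measurableSet (by
      rintro _ ⟨x, hx, rfl⟩ y hy
      rw [Metric.mem_thickening_iff]
      refine ⟨x, hx, ?_⟩
      simp only [smul_smul, mul_inv_cancel₀ ha.ne', one_smul]
      rw [mem_ball_zero_iff] at hy
      rw [dist_eq_norm, add_sub_cancel_left, norm_smul, Real.norm_of_nonneg hb.le]
      calc b * ‖y‖ < b * (b⁻¹ * ε) := by gcongr
        _ = ε := by field_simp)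
  rw [h1, h2, ← ENNReal.rpow_add _ _ (by simp; positivity) (by simp), hab, ENNReal.rpow_one] at key
  refine le_trans (ENNReal.ofReal_le_ofReal ?_) key
  have := one_add_mul_le_pow (a := e / v) (by have : 0 < e / v := by positivity
                                              linarith) n
  have e1 : (v + e) ^ n = v ^ n * (1 + e / v) ^ n := by
    rw [← mul_pow]; congr 1; field_simp
  have e2 : v ^ n + n * v ^ (n - 1) * e = v ^ n * (1 + n * (e / v)) := by
    obtain ⟨m, rfl⟩ : ∃ m, n = m + 1 := ⟨n - 1, by omega⟩
    simp only [Nat.add_sub_cancel]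
    field_simp
    ring
  rw [e1, e2]
  gcongr

end

section
open MeasureTheory Set
open scoped ENNReal Pointwise

lemma level_aux {n : ℕ} (hn : 2 ≤ n) {u : EuclideanSpace ℝ (Fin n) → ℝ}
    (hu : ContDiff ℝ (⊤ : ℕ∞) u) (hc : HasCompactSupport u) {k : ℝ} (hk : 0 < k)
    (hk1 : volume (Metric.ball (0 : EuclideanSpace ℝ (Fin n)) 1) = ENNReal.ofReal (k ^ n))
    {s t w η : ℝ} (hs : 0 ≤ s) (hw : 0 < w)
    (hwt : ENNReal.ofReal (w ^ n) ≤ volume {x | t ≤ |u x|}) (hη : 0 < η) (hηt : s + η < t) :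
    n * w ^ (n - 1) * k * (t - (s + η)) ≤
      (∫ x in {x | s < |u x| ∧ |u x| < t}, ‖fderiv ℝ u x‖) +
        η * volume.real {x | s < |u x| ∧ |u x| < t} := by
  set S := {x | s < |u x| ∧ |u x| < t} with hS
  have huc : Continuous u := hu.continuous
  have hfc : Continuous (fderiv ℝ u) := hu.continuous_fderiv (by simp)
  have hfs : HasCompactSupport (fderiv ℝ u) := hc.fderiv ℝ
  have hSm : MeasurableSet S :=
    ((isOpen_lt continuous_const huc.abs).inter (isOpen_lt huc.abs continuous_const)).measurableSet
  have sub_fin : ∀ τ : ℝ, 0 ≤ τ → volume {x | τ < |u x|} ≠ ∞ := by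
    intro τ hτ
    refine ne_top_of_le_ne_top hc.isCompact.measure_lt_top.ne (measure_mono ?_)
    intro x hx
    apply subset_tsupport
    simp only [Function.mem_support]
    intro h0
    simp only [mem_ofPred_eq, h0, abs_zero] at hx
    linarith
  have hSfin : volume S ≠ ∞ :=
    ne_top_of_le_ne_top (sub_fin s hs) (measure_mono fun x hx => hx.1)
  obtain ⟨M, hM⟩ := hfs.exists_bound_of_continuous hfc
  have hM0 : 0 ≤ M := (norm_nonneg _).trans (hM 0)
  obtain ⟨δ, hδ, hδ'⟩ := Metric.uniformContinuous_iff.1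
    (hfs.uniformContinuous_of_continuous hfc) η hη
  obtain ⟨ε, hε, hεδ, hεM⟩ : ∃ ε > 0, ε < δ ∧ ε * (M + η) ≤ η := by
    refine ⟨min (δ / 2) (η / (M + η)), by positivity, ?_, ?_⟩
    · exact (min_le_left _ _).trans_lt (by linarith)
    · calc _ ≤ η / (M + η) * (M + η) := by gcongr; exact min_le_right _ _
        _ = η := by field_simp
  set R : EuclideanSpace ℝ (Fin n) → ℝ := fun x => ‖fderiv ℝ u x‖ + η with hR
  have hRc : Continuous R := hfc.norm.add continuous_const
  have hR0 : ∀ x, 0 ≤ R x := fun x => by positivity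
  have claim1 : ∀ x y, dist x y < ε → |u y| ≤ |u x| + ε * R x := by
    intro x y hxy
    have h1 : ‖u y - u x - fderiv ℝ u x (y - x)‖ ≤ η * ‖y - x‖ := by
      apply Convex.norm_image_sub_le_of_norm_fderiv_le' (s := Metric.ball x ε)
      · intro z _
        exact hu.differentiable (by simp) z
      · intro z hz
        rw [← dist_eq_norm]
        exact (hδ' (lt_trans hz hεδ)).le
      · exact convex_ball _ _
      · exact Metric.mem_ball_self hε
      · rwa [Metric.mem_ball']
    have h2 : ‖y - x‖ ≤ ε := by rw [← dist_eq_norm, dist_comm]; exact hxy.le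
    have h3 : ‖fderiv ℝ u x (y - x)‖ ≤ ‖fderiv ℝ u x‖ * ‖y - x‖ := ContinuousLinearMap.le_opNorm _ _
    have h4 : |u y| ≤ |u x| + ‖fderiv ℝ u x (y - x)‖ + ‖u y - u x - fderiv ℝ u x (y - x)‖ := by
      have : u y = u x + fderiv ℝ u x (y - x) + (u y - u x - fderiv ℝ u x (y - x)) := by ring
      calc |u y| = |u x + fderiv ℝ u x (y - x) + (u y - u x - fderiv ℝ u x (y - x))| := by
              rw [← this]
        _ ≤ _ := (abs_add_le _ _).trans (add_le_add (abs_add_le _ _) le_rfl)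
    have h5 : R x * ‖y - x‖ ≤ R x * ε := mul_le_mul_of_nonneg_left h2 (hR0 x)
    simp only [hR] at h5 ⊢
    nlinarith
  have claim2 : ∀ τ ∈ Ioo (s + η) t, ENNReal.ofReal (n * w ^ (n - 1) * (ε * k)) ≤
      (volume.restrict S) {x | |u x| ≤ τ ∧ τ ≤ |u x| + ε * R x} := by
    intro τ hτ
    set A := {x | τ < |u x|} with hA
    have hAm : MeasurableSet A := (isOpen_lt continuous_const huc.abs).measurableSet
    have hAf : volume A ≠ ∞ := sub_fin τ (by linarith [hτ.1])
    have hAw : w ^ n ≤ (volume A).toReal := by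
      rw [← ENNReal.ofReal_le_iff_le_toReal hAf]
      exact hwt.trans (measure_mono fun x hx => lt_of_lt_of_le hτ.2 hx)
    set v := (volume A).toReal ^ ((1:ℝ) / n) with hv
    have hvn : v ^ n = (volume A).toReal := by
      rw [hv, one_div, Real.rpow_inv_natCast_pow ENNReal.toReal_nonneg (by omega)]
    have hwv : w ≤ v := by
      rw [← pow_le_pow_iff_left₀ hw.le (by positivity) (n := n) (by omega), hvn]
      exact hAw
    have hv0 : 0 < v := hw.trans_le hwv
    have hb := bm_ball hn hAm hv0 hk hε rfl (by rw [hvn, ENNReal.ofReal_toReal hAf]) hk1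
    have hsub : Metric.thickening ε A ⊆ A ∪ ({x | |u x| ≤ τ ∧ τ ≤ |u x| + ε * R x} ∩ S) := by
      intro x hx
      rw [Metric.mem_thickening_iff] at hx
      obtain ⟨y, hy, hxy⟩ := hx
      by_cases hxA : τ < |u x|
      · exact Or.inl hxA
      · right
        have h1 := claim1 x y hxy
        have h2 : τ < |u y| := hy
        push Not at hxA
        have h3 : ε * R x ≤ ε * (M + η) := by
          have := hM x
          simp only [hR]
          gcongr
        refine ⟨⟨hxA, by linarith⟩, ?_, ?_⟩
        · linarith [hτ.1]
        · linarith [hτ.2]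
    have h2 := (hb.trans (measure_mono hsub)).trans (measure_union_le _ _)
    rw [ENNReal.ofReal_add (by positivity) (by positivity), hvn, ENNReal.ofReal_toReal hAf,
      ENNReal.add_le_add_iff_left hAf] at h2
    rw [Measure.restrict_apply']
    · refine le_trans (ENNReal.ofReal_le_ofReal ?_) h2
      gcongr
    · exact hSm
  set P : Set (ℝ × EuclideanSpace ℝ (Fin n)) := {p | |u p.2| ≤ p.1 ∧ p.1 ≤ |u p.2| + ε * R p.2}
  have hP : MeasurableSet P := by
    have h1 : Continuous fun p : ℝ × EuclideanSpace ℝ (Fin n) => |u p.2| := by fun_prop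
    have h2 : Continuous fun p : ℝ × EuclideanSpace ℝ (Fin n) => R p.2 := by fun_prop
    exact ((isClosed_le h1 continuous_fst).inter
      (isClosed_le continuous_fst (h1.add (h2.const_mul ε)))).measurableSet
  have hfub : ∫⁻ τ, (volume.restrict S) {x | |u x| ≤ τ ∧ τ ≤ |u x| + ε * R x} =
      ∫⁻ x in S, ENNReal.ofReal (ε * R x) := by
    have h1 := Measure.prod_apply (μ := (volume : Measure ℝ)) (ν := volume.restrict S) hP
    have h2 := Measure.prod_apply_symm (μ := (volume : Measure ℝ)) (ν := volume.restrict S) hP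
    rw [h1] at h2
    refine h2.trans (lintegral_congr fun x => ?_)
    have : (fun τ => (τ, x)) ⁻¹' P = Icc (|u x|) (|u x| + ε * R x) := rfl
    rw [this, Real.volume_Icc, add_sub_cancel_left]
  have hInteg : Integrable (fun x => ‖fderiv ℝ u x‖) (volume.restrict S) :=
    (hfc.integrable_of_hasCompactSupport hfs).norm.restrict
  have hcon : Integrable (fun _ => η) (volume.restrict S) := by
    have : IsFiniteMeasure (volume.restrict S) := ⟨by simpa using hSfin.lt_top⟩
    exact integrable_const _
  have hfin : ∫⁻ x in S, ENNReal.ofReal (ε * R x) =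
      ENNReal.ofReal (ε * ((∫ x in S, ‖fderiv ℝ u x‖) + η * volume.real S)) := by
    rw [← ofReal_integral_eq_lintegral_ofReal]
    · congr 1
      rw [integral_const_mul]
      congr 1
      simp only [hR]
      rw [integral_add hInteg hcon]
      simp [mul_comm]
    · exact (hInteg.add hcon).const_mul _
    · exact ae_of_all _ fun x => mul_nonneg hε.le (hR0 x)
  have hlow : ENNReal.ofReal (n * w ^ (n - 1) * (ε * k)) * ENNReal.ofReal (t - (s + η)) ≤
      ∫⁻ τ, (volume.restrict S) {x | |u x| ≤ τ ∧ τ ≤ |u x| + ε * R x} := by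
    calc _ = ∫⁻ τ in Ioo (s + η) t, ENNReal.ofReal (n * w ^ (n - 1) * (ε * k)) := by
          simp
      _ ≤ ∫⁻ τ in Ioo (s + η) t, (volume.restrict S) {x | |u x| ≤ τ ∧ τ ≤ |u x| + ε * R x} :=
          setLIntegral_mono' measurableSet_Ioo claim2
      _ ≤ _ := setLIntegral_le_lintegral _ _
  rw [hfub, hfin, ← ENNReal.ofReal_mul (by positivity)] at hlow
  rw [ENNReal.ofReal_le_ofReal_iff (by positivity)] at hlow
  have : ε * (n * w ^ (n - 1) * k * (t - (s + η))) ≤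
      ε * ((∫ x in S, ‖fderiv ℝ u x‖) + η * volume.real S) := by
    refine le_trans (le_of_eq ?_) hlow
    ring
  exact le_of_mul_le_mul_left this hε

lemma level_grad {n : ℕ} (hn : 2 ≤ n) {u : EuclideanSpace ℝ (Fin n) → ℝ}
    (hu : ContDiff ℝ (⊤ : ℕ∞) u) (hc : HasCompactSupport u) {k : ℝ} (hk : 0 < k)
    (hk1 : volume (Metric.ball (0 : EuclideanSpace ℝ (Fin n)) 1) = ENNReal.ofReal (k ^ n))
    {s t w : ℝ} (hs : 0 ≤ s) (hst : s < t) (hw : 0 < w)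
    (hwt : ENNReal.ofReal (w ^ n) ≤ volume {x | t ≤ |u x|}) :
    n * w ^ (n - 1) * k * (t - s) ≤
      ∫ x in {x | s < |u x| ∧ |u x| < t}, ‖fderiv ℝ u x‖ := by
  have h1 : Filter.Tendsto (fun η : ℝ => n * w ^ (n - 1) * k * (t - (s + η)))
      (nhdsWithin 0 (Ioi 0)) (nhds (n * w ^ (n - 1) * k * (t - (s + 0)))) :=
    Filter.Tendsto.mono_left (Continuous.tendsto (by fun_prop) 0) nhdsWithin_le_nhds
  have h2 : Filter.Tendsto (fun η : ℝ => (∫ x in {x | s < |u x| ∧ |u x| < t}, ‖fderiv ℝ u x‖) +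
        η * volume.real {x | s < |u x| ∧ |u x| < t})
      (nhdsWithin 0 (Ioi 0)) (nhds ((∫ x in {x | s < |u x| ∧ |u x| < t}, ‖fderiv ℝ u x‖) +
        0 * volume.real {x | s < |u x| ∧ |u x| < t})) :=
    Filter.Tendsto.mono_left (Continuous.tendsto (by fun_prop) 0) nhdsWithin_le_nhds
  have h3 := le_of_tendsto_of_tendsto h1 h2 (by
    filter_upwards [Ioo_mem_nhdsGT (sub_pos.2 hst)] with η hη
    exact level_aux hn hu hc hk hk1 hs hw hwt hη.1 (by linarith [hη.2]))
  simpa using h3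

end

section
open MeasureTheory Set
open scoped ENNReal

lemma rpow_q_pow {n : ℕ} (hn : 2 ≤ n) {x : ℝ} (hx : 0 ≤ x) :
    (x ^ (1 - (1:ℝ) / n)) ^ n = x ^ (n - 1) := by
  have hn0 : (n:ℝ) ≠ 0 := by positivity
  rw [← Real.rpow_natCast, ← Real.rpow_mul hx, ← Real.rpow_natCast, Nat.cast_sub (by omega)]
  congr 1
  push_cast
  field_simp

lemma rpow_i_pow {n : ℕ} (hn : 2 ≤ n) {x : ℝ} (hx : 0 ≤ x) :
    (x ^ ((1:ℝ) / n)) ^ n = x := by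
  rw [one_div, Real.rpow_inv_natCast_pow hx (by omega)]

lemma garsia_diam {n : ℕ} (hn : 2 ≤ n) {ψ ρ : ℝ → ℝ} (hψ0 : ψ 0 = 0)
    (hψ : ∀ t, 0 ≤ ψ t)
    (hρ0 : ∀ t, 0 ≤ ρ t) (hρ1 : ∀ t, ρ t ≤ 1) (hρm : Monotone ρ)
    (H : ∀ a b, 0 ≤ a → a ≤ b → ψ b - ψ a ≤ (ρ b - ρ a) ^ ((1:ℝ) / n) * (b - a) ^ (1 - (1:ℝ) / n))
    {l T T2 : ℝ} (hl : 0 < l) (hT : 4 ^ n * (n - 1) * l ≤ T) (hT2 : T ≤ T2)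
    (h1 : T - l ≤ ψ T ^ ((n:ℝ) / (n - 1))) (h2 : T2 - l ≤ ψ T2 ^ ((n:ℝ) / (n - 1))) :
    T2 - T ≤ 2 * 4 ^ n * (n - 1) * l := by
  have hn2 : (2:ℝ) ≤ n := by exact_mod_cast hn
  have hn0 : (n:ℝ) ≠ 0 := by positivity
  have hn1 : (0:ℝ) < (n:ℝ) - 1 := by linarith
  set q : ℝ := 1 - (1:ℝ) / n with hq
  have hqh : 1 / 2 ≤ q := by
    have : (1:ℝ) / n ≤ 1 / 2 := by gcongr
    linarith
  have hq1 : q ≤ 1 := by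
    have : 0 ≤ (1:ℝ) / n := by positivity
    linarith
  have hq0 : 0 < q := by linarith
  have hpq : (n:ℝ) / (n - 1) * q = 1 := by rw [hq]; field_simp
  have h4 : (16:ℝ) ≤ 4 ^ n := by
    calc (16:ℝ) = 4 ^ 2 := by norm_num
      _ ≤ 4 ^ n := by gcongr; norm_num
  have hlK : l * 16 ≤ 4 ^ n * (n - 1) * l := by
    have : (16:ℝ) * 1 ≤ 4 ^ n * (n - 1) := by gcongr; linarith
    nlinarith
  have hTl : l < T := by linarith
  have hT0 : 0 < T := by linarith
  by_cases hD2 : T2 - T < 2 * l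
  · nlinarith
  push Not at hD2
  set D := T2 - T with hD
  have hD0 : 0 < D := by linarith
  have inv : ∀ t, l < t → t - l ≤ ψ t ^ ((n:ℝ) / (n - 1)) → (t - l) ^ q ≤ ψ t := by
    intro t ht h
    calc (t - l) ^ q ≤ (ψ t ^ ((n:ℝ) / (n - 1))) ^ q :=
          Real.rpow_le_rpow (by linarith) h hq0.le
      _ = ψ t := by rw [← Real.rpow_mul (hψ t), hpq, Real.rpow_one]
  have i1 := inv T hTl h1
  have i2 := inv T2 (by linarith) h2
  set θ := ρ T - ρ 0 with hθ
  have hθ0 : 0 ≤ θ := sub_nonneg.2 (hρm hT0.le)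
  have hθ1 : θ ≤ 1 := by linarith [hρ1 T, hρ0 0]
  have a1 : ψ T ≤ θ ^ ((1:ℝ) / n) * T ^ q := by
    have := H 0 T le_rfl hT0.le
    simpa [hψ0] using this
  set y := (n - 1) * (l / T) with hy
  have hy0 : 0 ≤ y := by positivity
  have b1 : 1 - y ≤ θ := by
    have e := pow_le_pow_left₀ (by have : 0 < T - l := by linarith
                                   positivity) (i1.trans a1) n
    rw [mul_pow, rpow_i_pow hn hθ0, rpow_q_pow hn hT0.le, rpow_q_pow hn (by linarith)] at e
    have e2 : (1 + -(l / T)) ^ (n - 1) ≤ θ := by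
      have : (T - l) = T * (1 + -(l / T)) := by field_simp; ring
      rw [this, mul_pow, mul_comm θ] at e
      exact le_of_mul_le_mul_left e (by positivity)
    have e3 := one_add_mul_le_pow (a := -(l / T)) (by
      have : l / T < 1 := (div_lt_one hT0).2 hTl
      linarith) (n - 1)
    rw [Nat.cast_sub (by omega)] at e3
    push_cast at e3
    rw [hy]
    linarith
  have a2 : ψ T2 ≤ T ^ q + y ^ ((1:ℝ) / n) * D ^ q := by
    have h := H T T2 hT0.le hT2
    have c1 : (ρ T2 - ρ T) ^ ((1:ℝ) / n) ≤ y ^ ((1:ℝ) / n) :=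
      Real.rpow_le_rpow (sub_nonneg.2 (hρm hT2)) (by linarith [hρ1 T2, hρ0 0]) (by positivity)
    have c2 : θ ^ ((1:ℝ) / n) * T ^ q ≤ 1 * T ^ q := by
      gcongr
      exact Real.rpow_le_one hθ0 hθ1 (by positivity)
    have c3 : (ρ T2 - ρ T) ^ ((1:ℝ) / n) * D ^ q ≤ y ^ ((1:ℝ) / n) * D ^ q := by gcongr
    linarith
  set Z := T + D / 2 with hZ
  have hZ0 : 0 < Z := by positivity
  have a3 : Z ^ q ≤ T ^ q + y ^ ((1:ℝ) / n) * D ^ q := by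
    refine le_trans (Real.rpow_le_rpow hZ0.le ?_ hq0.le) (i2.trans a2)
    linarith
  have a4 : T ^ q ≤ Z ^ q * (1 + q * -(D / (2 * Z))) := by
    have : T = Z * (1 + -(D / (2 * Z))) := by
      have : Z * (D / (2 * Z)) = D / 2 := by field_simp
      linarith
    have hle : D / (2 * Z) ≤ 1 := by
      rw [div_le_one (by positivity)]
      linarith
    calc T ^ q = (Z * (1 + -(D / (2 * Z)))) ^ q := by rw [← this]
      _ = Z ^ q * (1 + -(D / (2 * Z))) ^ q := Real.mul_rpow hZ0.le (by linarith)
      _ ≤ _ := by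
        gcongr
        exact rpow_one_add_le_one_add_mul_self (by linarith) hq0.le hq1
  have a5 : Z ^ q * (D / (4 * Z)) ≤ y ^ ((1:ℝ) / n) * D ^ q := by
    have : Z ^ q * (D / (4 * Z)) ≤ Z ^ q * (q * (D / (2 * Z))) := by
      have e : D / (4 * Z) = 1 / 2 * (D / (2 * Z)) := by field_simp; ring
      rw [e]
      gcongr
    linarith
  have a6 := pow_le_pow_left₀ (by positivity) a5 n
  rw [mul_pow, mul_pow, rpow_i_pow hn hy0, rpow_q_pow hn hD0.le, rpow_q_pow hn hZ0.le] at a6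
  have a7 : D ≤ 4 ^ n * (y * Z) := by
    obtain ⟨m, rfl⟩ : ∃ m, n = m + 1 := ⟨n - 1, by omega⟩
    simp only [Nat.add_sub_cancel] at a6
    have e : Z ^ m * (D / (4 * Z)) ^ (m + 1) = D ^ m * (D / (4 ^ (m + 1) * Z)) := by
      rw [div_pow, mul_pow]
      field_simp
      ring
    rw [e, mul_comm y] at a6
    have := le_of_mul_le_mul_left a6 (by positivity)
    rw [div_le_iff₀ (by positivity)] at this
    linarith
  have a8 : y * Z = (n - 1) * l + (n - 1) * l / T * (D / 2) := by
    rw [hy, hZ]; field_simp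
  have a9 : 4 ^ n * ((n - 1) * l / T * (D / 2)) ≤ D / 2 := by
    have : 4 ^ n * ((n - 1) * l / T * (D / 2)) = (4 ^ n * (n - 1) * l) / T * (D / 2) := by ring
    rw [this]
    have h1 : (4 ^ n * (n - 1) * l) / T ≤ 1 := (div_le_one hT0).2 hT
    have := mul_le_mul_of_nonneg_right h1 (by positivity : 0 ≤ D / 2)
    linarith
  rw [a8, mul_add] at a7
  linarith

lemma garsia {n : ℕ} (hn : 2 ≤ n) : ∃ C : ℝ, 0 < C ∧ ∀ ψ ρ : ℝ → ℝ, ψ 0 = 0 → Measurable ψ →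
    (∀ t, 0 ≤ ψ t) → (∀ t, 0 ≤ ρ t) → (∀ t, ρ t ≤ 1) → Monotone ρ →
    (∀ a b, 0 ≤ a → a ≤ b → ψ b - ψ a ≤ (ρ b - ρ a) ^ ((1:ℝ) / n) * (b - a) ^ (1 - (1:ℝ) / n)) →
    ∫⁻ t in Ioi 0, ENNReal.ofReal (Real.exp (ψ t ^ ((n:ℝ) / (n - 1)) - t)) ≤ ENNReal.ofReal C := by
  have hn2 : (2:ℝ) ≤ n := by exact_mod_cast hn
  have hn0 : (n:ℝ) ≠ 0 := by positivity
  have hn1 : (0:ℝ) < (n:ℝ) - 1 := by linarith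
  set K : ℝ := 5 * 4 ^ n * (n - 1) with hK
  have hK0 : 0 < K := by positivity
  have hsum : Summable fun j : ℕ => Real.exp (-(j:ℝ)) * (K * (j + 1)) := by
    have h1 : Summable fun j : ℕ => (j:ℝ) ^ 1 * Real.exp (-1) ^ j :=
      summable_pow_mul_geometric_of_norm_lt_one 1 (by simp)
    have h2 : Summable fun j : ℕ => Real.exp (-1) ^ j :=
      summable_geometric_of_lt_one (by positivity) (by simp)
    refine ((h1.add h2).mul_left K).congr fun j => ?_
    rw [← Real.exp_nat_mul]
    simp
    ring
  refine ⟨∑' j : ℕ, Real.exp (-(j:ℝ)) * (K * (j + 1)), ?_, ?_⟩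
  · exact hsum.tsum_pos (fun j => by positivity) 0 (by positivity)
  intro ψ ρ hψ0 hψm hψ hρ0 hρ1 hρm H
  set F : ℝ → ℝ := fun t => t - ψ t ^ ((n:ℝ) / (n - 1)) with hF
  have hFm : Measurable F := by fun_prop
  have hF0 : ∀ t, 0 ≤ t → 0 ≤ F t := by
    intro t ht
    have a1 : ψ t ≤ 1 * t ^ (1 - (1:ℝ) / n) := by
      have := H 0 t le_rfl ht
      rw [hψ0, sub_zero, sub_zero] at this
      refine this.trans ?_
      gcongr
      exact Real.rpow_le_one (sub_nonneg.2 (hρm ht)) (by linarith [hρ1 t, hρ0 0]) (by positivity)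
    rw [one_mul] at a1
    have := Real.rpow_le_rpow (hψ t) a1 (z := (n:ℝ) / (n - 1)) (by positivity)
    rw [← Real.rpow_mul ht] at this
    have e : (1 - (1:ℝ) / n) * ((n:ℝ) / (n - 1)) = 1 := by field_simp
    rw [e, Real.rpow_one] at this
    simp only [hF]
    linarith
  have hE : ∀ l : ℝ, 0 < l → volume ({t | F t ≤ l} ∩ Ioi 0) ≤ ENNReal.ofReal (K * l) := by
    intro l hl
    set K0 : ℝ := 4 ^ n * (n - 1) * l with hK0
    have hK00 : 0 < K0 := by positivity
    by_cases hne : ({t | F t ≤ l} ∩ Ioi K0).Nonempty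
    · obtain ⟨t0, ht0, ht0'⟩ := hne
      have hsub : {t | F t ≤ l} ∩ Ioi 0 ⊆ Icc 0 K0 ∪ Icc (t0 - 2 * K0) (t0 + 2 * K0) := by
        rintro t ⟨ht, htp⟩
        by_cases h : t ≤ K0
        · exact Or.inl ⟨le_of_lt htp, h⟩
        · right
          push Not at h
          simp only [mem_ofPred_eq, hF] at ht ht0
          rcases le_total t t0 with h' | h'
          · have := garsia_diam hn hψ0 hψ hρ0 hρ1 hρm H hl h.le h' (by linarith) (by linarith)
            constructor <;> linarith
          · have := garsia_diam hn hψ0 hψ hρ0 hρ1 hρm H hl (le_of_lt ht0') h' (by linarith)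
              (by linarith)
            constructor <;> linarith
      refine (measure_mono hsub).trans ((measure_union_le _ _).trans ?_)
      rw [Real.volume_Icc, Real.volume_Icc, ← ENNReal.ofReal_add (by linarith) (by linarith)]
      apply ENNReal.ofReal_le_ofReal
      rw [hK0, hK]
      apply le_of_eq; ring
    · have hsub : {t | F t ≤ l} ∩ Ioi 0 ⊆ Icc 0 K0 := by
        rintro t ⟨ht, htp⟩
        refine ⟨le_of_lt htp, ?_⟩
        by_contra h
        exact hne ⟨t, ht, not_le.1 h⟩
      refine (measure_mono hsub).trans ?_
      rw [Real.volume_Icc]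
      apply ENNReal.ofReal_le_ofReal
      rw [hK0, hK]
      have : 0 < 4 ^ n * (n - 1) * l := by positivity
      linarith
  calc ∫⁻ t in Ioi 0, ENNReal.ofReal (Real.exp (ψ t ^ ((n:ℝ) / (n - 1)) - t))
      ≤ ∫⁻ t in Ioi 0, ∑' j : ℕ, {t | F t ≤ j + 1}.indicator
          (fun _ => ENNReal.ofReal (Real.exp (-(j:ℝ)))) t := by
        apply setLIntegral_mono' measurableSet_Ioi
        intro t ht
        have hft := hF0 t (le_of_lt ht)
        refine le_trans ?_ (ENNReal.le_tsum ⌊F t⌋₊)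
        rw [indicator_of_mem]
        · apply ENNReal.ofReal_le_ofReal
          apply Real.exp_le_exp.2
          have := Nat.floor_le hft
          simp only [hF] at this ⊢
          linarith
        · exact (Nat.lt_floor_add_one (F t)).le
    _ = ∑' j : ℕ, ∫⁻ t in Ioi 0, {t | F t ≤ j + 1}.indicator
          (fun _ => ENNReal.ofReal (Real.exp (-(j:ℝ)))) t := by
        apply lintegral_tsum
        intro j
        exact (measurable_const.indicator (measurableSet_le hFm measurable_const)).aemeasurable
    _ ≤ ∑' j : ℕ, ENNReal.ofReal (Real.exp (-(j:ℝ)) * (K * (j + 1))) := by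
        apply ENNReal.tsum_le_tsum
        intro j
        rw [lintegral_indicator (measurableSet_le hFm measurable_const),
          lintegral_const, Measure.restrict_apply_univ,
          ENNReal.ofReal_mul (by positivity),
          Measure.restrict_apply (measurableSet_le hFm measurable_const)]
        gcongr
        exact hE _ (by positivity)
    _ = _ := (ENNReal.ofReal_tsum_of_nonneg (fun j => by positivity) hsum).symm

end

section
open MeasureTheory Set
open scoped ENNReal

lemma subdivide {n : ℕ} (hn : 2 ≤ n) {ψ ρ : ℝ → ℝ} (hρm : Monotone ρ)
    (H : ∀ a b, 0 ≤ a → a ≤ b →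
      ψ b - ψ a ≤ (ρ b - ρ a) ^ ((1:ℝ) / n) * (Real.exp (b - a) - 1) ^ (1 - (1:ℝ) / n)) :
    ∀ a b, 0 ≤ a → a ≤ b →
      ψ b - ψ a ≤ (ρ b - ρ a) ^ ((1:ℝ) / n) * (b - a) ^ (1 - (1:ℝ) / n) := by
  intro a b ha hab
  have hn2 : (2:ℝ) ≤ n := by exact_mod_cast hn
  have hn0 : (n:ℝ) ≠ 0 := by positivity
  have hn1 : (0:ℝ) < (n:ℝ) - 1 := by linarith
  have hq0 : 0 < 1 - (1:ℝ) / n := by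
    have : 1 - (1:ℝ) / n = (n - 1) / n := by field_simp
    rw [this]; positivity
  have hconj : Real.HolderConjugate (n:ℝ) (1 - (1:ℝ) / n)⁻¹ := by
    rw [Real.holderConjugate_iff]
    refine ⟨by linarith, ?_⟩
    rw [inv_inv]; field_simp; ring
  have step : ∀ m : ℕ, ψ b - ψ a ≤ (ρ b - ρ a) ^ ((1:ℝ) / n) *
      ((b - a) * Real.exp ((b - a) / (m + 1 : ℕ))) ^ (1 - (1:ℝ) / n) := by
    intro m
    set N := m + 1 with hN
    have hNp : (0:ℝ) < N := by positivity
    set δ := (b - a) / N with hδ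
    have hδ0 : 0 ≤ δ := div_nonneg (by linarith) hNp.le
    set x : ℕ → ℝ := fun i => a + i * δ with hx
    have hxm : Monotone x := by
      intro i j hij
      simp only [hx]
      gcongr
    have hx0 : x 0 = a := by simp [hx]
    have hxN : x N = b := by simp only [hx, hδ]; field_simp; ring
    have hd : ∀ i, x (i + 1) - x i = δ := by intro i; simp only [hx]; push_cast; ring
    have he0 : 0 ≤ Real.exp δ - 1 := by linarith [Real.one_le_exp hδ0]
    have hh := Real.inner_le_Lp_mul_Lq_of_nonneg (Finset.range N) hconj
      (f := fun i => (ρ (x (i + 1)) - ρ (x i)) ^ ((1:ℝ) / n))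
      (g := fun i => (Real.exp δ - 1) ^ (1 - (1:ℝ) / n))
      (fun i _ => Real.rpow_nonneg (sub_nonneg.2 (hρm (hxm (Nat.le_succ i)))) _)
      (fun i _ => Real.rpow_nonneg he0 _)
    have e1 : ∀ i, ((ρ (x (i + 1)) - ρ (x i)) ^ ((1:ℝ) / n)) ^ (n:ℝ) = ρ (x (i + 1)) - ρ (x i) := by
      intro i
      rw [← Real.rpow_mul (sub_nonneg.2 (hρm (hxm (Nat.le_succ i)))), one_div,
        inv_mul_cancel₀ hn0, Real.rpow_one]
    have e2 : ((Real.exp δ - 1) ^ (1 - (1:ℝ) / n)) ^ ((1 - (1:ℝ) / n)⁻¹) = Real.exp δ - 1 := by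
      rw [← Real.rpow_mul he0, mul_inv_cancel₀ hq0.ne', Real.rpow_one]
    simp only [e1, e2, Finset.sum_const, Finset.card_range, nsmul_eq_mul] at hh
    rw [Finset.sum_range_sub (fun i => ρ (x i)), hx0, hxN, one_div (1 - (1:ℝ) / n)⁻¹, inv_inv] at hh
    have hs : ψ b - ψ a = ∑ i ∈ Finset.range N, (ψ (x (i + 1)) - ψ (x i)) := by
      rw [Finset.sum_range_sub (fun i => ψ (x i)), hx0, hxN]
    rw [hs]
    refine le_trans (Finset.sum_le_sum fun i _ => ?_) (hh.trans ?_)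
    · have := H (x i) (x (i + 1)) (by simp only [hx]; positivity) (hxm (Nat.le_succ i))
      rwa [hd] at this
    · have hρ0 : 0 ≤ ρ b - ρ a := sub_nonneg.2 (hρm hab)
      have : 1 - δ ≤ Real.exp (-δ) := by linarith [Real.add_one_le_exp (-δ)]
      have h2 : Real.exp (-δ) * Real.exp δ = 1 := by rw [← Real.exp_add]; simp
      have h3 : Real.exp δ - 1 ≤ δ * Real.exp δ := by nlinarith [Real.exp_pos δ]
      have h4 : (N:ℝ) * (Real.exp δ - 1) ≤ (b - a) * Real.exp δ := by
        calc (N:ℝ) * (Real.exp δ - 1) ≤ N * (δ * Real.exp δ) := by gcongr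
          _ = (b - a) * Real.exp δ := by rw [hδ]; field_simp
      exact mul_le_mul_of_nonneg_left (Real.rpow_le_rpow (by positivity) h4 hq0.le)
        (Real.rpow_nonneg hρ0 _)
  have hlim : Filter.Tendsto (fun m : ℕ => (ρ b - ρ a) ^ ((1:ℝ) / n) *
      ((b - a) * Real.exp ((b - a) / (m + 1 : ℕ))) ^ (1 - (1:ℝ) / n)) Filter.atTop
      (nhds ((ρ b - ρ a) ^ ((1:ℝ) / n) * ((b - a) * Real.exp 0) ^ (1 - (1:ℝ) / n))) := by
    apply Filter.Tendsto.const_mul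
    apply Filter.Tendsto.rpow_const _ (Or.inr hq0.le)
    apply Filter.Tendsto.const_mul
    apply (Real.continuous_exp.tendsto 0).comp
    exact (tendsto_const_div_atTop_nhds_zero_nat (b - a)).comp (Filter.tendsto_add_atTop_nat 1)
  have := ge_of_tendsto' hlim step
  simpa using this

lemma level_local {n : ℕ} (hn : 2 ≤ n) {u : EuclideanSpace ℝ (Fin n) → ℝ}
    (hu : ContDiff ℝ (⊤ : ℕ∞) u) (hc : HasCompactSupport u) {k : ℝ} (hk : 0 < k)
    (hk1 : volume (Metric.ball (0 : EuclideanSpace ℝ (Fin n)) 1) = ENNReal.ofReal (k ^ n))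
    {s t m1 m2 : ℝ} (hs : 0 ≤ s) (hst : s < t) (hm2 : 0 < m2)
    (h1 : volume.real {x | s < |u x|} ≤ m1) (h2 : m2 ≤ volume.real {x | t ≤ |u x|}) :
    n * k * (t - s) * m2 ^ (1 - (1:ℝ) / n) ≤
      (∫ x in {x | s < |u x| ∧ |u x| < t}, ‖fderiv ℝ u x‖ ^ n) ^ ((1:ℝ) / n) *
        (m1 - m2) ^ (1 - (1:ℝ) / n) := by
  have hn2 : (2:ℝ) ≤ n := by exact_mod_cast hn
  have hn0 : (n:ℝ) ≠ 0 := by positivity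
  have hn1 : (0:ℝ) < (n:ℝ) - 1 := by linarith
  have hq0 : 0 < 1 - (1:ℝ) / n := by
    have : 1 - (1:ℝ) / n = (n - 1) / n := by field_simp
    rw [this]; positivity
  have hconj : Real.HolderConjugate (n:ℝ) (1 - (1:ℝ) / n)⁻¹ := by
    rw [Real.holderConjugate_iff]
    refine ⟨by linarith, ?_⟩
    rw [inv_inv]; field_simp; ring
  have huc : Continuous u := hu.continuous
  have hfc : Continuous (fderiv ℝ u) := hu.continuous_fderiv (by simp)
  have hfs : HasCompactSupport (fderiv ℝ u) := hc.fderiv ℝ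
  have sub_fin : ∀ τ : ℝ, 0 ≤ τ → volume {x | τ < |u x|} ≠ ∞ := by
    intro τ hτ
    refine ne_top_of_le_ne_top hc.isCompact.measure_lt_top.ne (measure_mono ?_)
    intro x hx
    apply subset_tsupport
    simp only [Function.mem_support]
    intro h0
    simp only [mem_ofPred_eq, h0, abs_zero] at hx
    linarith
  set S := {x | s < |u x| ∧ |u x| < t} with hS
  have hSfin : volume S ≠ ∞ :=
    ne_top_of_le_ne_top (sub_fin s hs) (measure_mono fun x hx => hx.1)
  have htfin : volume {x | t ≤ |u x|} ≠ ∞ :=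
    ne_top_of_le_ne_top (sub_fin s hs) (measure_mono fun x hx => lt_of_lt_of_le hst hx)
  have hfm : IsFiniteMeasure (volume.restrict S) := ⟨by simpa using hSfin.lt_top⟩
  have hSV : volume.real S ≤ m1 - m2 := by
    have hd : volume.real (S ∪ {x | t ≤ |u x|}) = volume.real S + volume.real {x | t ≤ |u x|} := by
      apply measureReal_union _ _ hSfin htfin
      · rw [Set.disjoint_left]
        intro x hx hx'
        exact absurd hx.2 (not_lt.2 hx')
      · exact (isClosed_le continuous_const huc.abs).measurableSet
    have hle : volume.real (S ∪ {x | t ≤ |u x|}) ≤ volume.real {x | s < |u x|} := by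
      apply measureReal_mono _ (sub_fin s hs)
      rintro x (hx | hx)
      · exact hx.1
      · exact lt_of_lt_of_le hst hx
    linarith
  set w := m2 ^ ((1:ℝ) / n) with hw
  have hw0 : 0 < w := by positivity
  have hwn : w ^ n = m2 := rpow_i_pow hn hm2.le
  have hwq : w ^ (n - 1) = m2 ^ (1 - (1:ℝ) / n) := by
    rw [hw, ← Real.rpow_natCast, ← Real.rpow_mul hm2.le, Nat.cast_sub (by omega)]
    congr 1
    push_cast; field_simp
  have g := level_grad hn hu hc hk hk1 hs hst hw0 (by
    rw [hwn, ENNReal.ofReal_le_iff_le_toReal htfin]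
    exact h2)
  have hol := integral_mul_le_Lp_mul_Lq_of_nonneg (μ := volume.restrict S) hconj
    (f := fun x => ‖fderiv ℝ u x‖) (g := fun _ => (1:ℝ))
    (ae_of_all _ fun x => norm_nonneg _) (ae_of_all _ fun x => zero_le_one)
    ((hfc.memLp_of_hasCompactSupport hfs).norm.restrict S) (memLp_const _)
  simp only [mul_one, Real.rpow_natCast, Real.one_rpow, one_div (1 - (1:ℝ) / n)⁻¹, inv_inv,
    integral_const, smul_eq_mul, measureReal_restrict_apply_univ] at hol
  calc n * k * (t - s) * m2 ^ (1 - (1:ℝ) / n) = n * w ^ (n - 1) * k * (t - s) := by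
        rw [hwq]; ring
    _ ≤ _ := g
    _ ≤ _ := hol
    _ ≤ _ := by
      gcongr

end

section
open MeasureTheory Set
open scoped ENNReal

lemma moser_core {n : ℕ} (hn : 2 ≤ n) {k : ℝ} (hk : 0 < k)
    (hk1 : volume (Metric.ball (0 : EuclideanSpace ℝ (Fin n)) 1) = ENNReal.ofReal (k ^ n)) :
    ∃ C : ℝ, 0 < C ∧ ∀ (Ω : Set (EuclideanSpace ℝ (Fin n))), MeasurableSet Ω → volume Ω ≠ ∞ →
      volume Ω ≠ 0 → 
      ∀ u : EuclideanSpace ℝ (Fin n) → ℝ, ContDiff ℝ (⊤ : ℕ∞) u → HasCompactSupport u →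
        tsupport u ⊆ Ω → (∫ x in Ω, ‖fderiv ℝ u x‖ ^ n) ≤ 1 →
        ∫⁻ x in Ω, ENNReal.ofReal (Real.exp ((n * k * |u x|) ^ ((n : ℝ) / (n - 1)))) ≤
          volume Ω * ENNReal.ofReal C := by
  obtain ⟨C, hC0, hC⟩ := garsia hn
  refine ⟨C, hC0, ?_⟩
  intro Ω hΩm hΩf hΩ0 u hu hc hsupp hInteg
  have hn2 : (2:ℝ) ≤ n := by exact_mod_cast hn
  have hn0 : (n:ℝ) ≠ 0 := by positivity
  have hn1 : (0:ℝ) < (n:ℝ) - 1 := by linarith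
  have hq0 : 0 < 1 - (1:ℝ) / n := by
    have : 1 - (1:ℝ) / n = (n - 1) / n := by field_simp
    rw [this]; positivity
  have huc : Continuous u := hu.continuous
  have hfc : Continuous (fderiv ℝ u) := hu.continuous_fderiv (by simp)
  have hfs : HasCompactSupport (fderiv ℝ u) := hc.fderiv ℝ
  have hsub : ∀ τ : ℝ, 0 ≤ τ → {x | τ < |u x|} ⊆ Ω := by
    intro τ hτ x hx
    apply hsupp
    apply subset_tsupport
    simp only [Function.mem_support]
    intro h0
    simp only [mem_ofPred_eq, h0, abs_zero] at hx
    linarith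
  have sub_fin : ∀ τ : ℝ, 0 ≤ τ → volume {x | τ < |u x|} ≠ ∞ := fun τ hτ =>
    ne_top_of_le_ne_top hΩf (measure_mono (hsub τ hτ))
  set V := volume.real Ω with hV
  have hV0 : 0 < V := ENNReal.toReal_pos hΩ0 hΩf
  set μ : ℝ → ℝ := fun t => volume.real {x | t < |u x|} with hμ
  have hμanti : ∀ s t, 0 ≤ s → s ≤ t → μ t ≤ μ s := fun s t hs hst =>
    measureReal_mono (fun x hx => lt_of_le_of_lt hst hx) (sub_fin s hs)
  set S : ℝ → Set ℝ := fun τ => {t | 0 ≤ t ∧ μ t ≤ V * Real.exp (-τ)} with hS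
  have hSb : ∀ τ, BddBelow (S τ) := fun τ => ⟨0, fun t ht => ht.1⟩
  obtain ⟨B, hB⟩ := hc.exists_bound_of_continuous huc
  have hB0 : 0 ≤ B := (norm_nonneg _).trans (hB 0)
  have hSn : ∀ τ, (S τ).Nonempty := fun τ => ⟨B, hB0, by
    have : {x | B < |u x|} = ∅ := by
      ext x
      simpa using hB x
    simp only [hμ, this, measureReal_empty]
    positivity⟩
  set φ : ℝ → ℝ := fun τ => sInf (S τ) with hφ
  have hφ0 : ∀ τ, 0 ≤ φ τ := fun τ => le_csInf (hSn τ) fun t ht => ht.1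
  have hφm : Monotone φ := by
    intro a b hab
    apply csInf_le_csInf (hSb a) (hSn b)
    intro t ht
    refine ⟨ht.1, ht.2.trans ?_⟩
    gcongr
  have hφz : φ 0 = 0 := by
    refine le_antisymm (csInf_le (hSb 0) ⟨le_rfl, ?_⟩) (hφ0 0)
    have h0 : μ 0 ≤ V := measureReal_mono (hsub 0 le_rfl) hΩf
    rw [neg_zero, Real.exp_zero, mul_one]
    exact h0
  have hφlt : ∀ τ t, 0 ≤ t → t < φ τ → V * Real.exp (-τ) < μ t := by
    intro τ t ht htφ
    by_contra h
    exact notMem_of_lt_csInf htφ (hSb τ) ⟨ht, not_lt.1 h⟩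
  have hφμ : ∀ τ, μ (φ τ) ≤ V * Real.exp (-τ) := by
    intro τ
    have hU : {x | φ τ < |u x|} = ⋃ j : ℕ, {x | φ τ + 1 / ((j:ℝ) + 1) < |u x|} := by
      ext x
      simp only [mem_ofPred_eq, mem_iUnion]
      constructor
      · intro h
        obtain ⟨j, hj⟩ := exists_nat_one_div_lt (sub_pos.2 h)
        exact ⟨j, by linarith⟩
      · rintro ⟨j, hj⟩
        have : 0 < 1 / ((j:ℝ) + 1) := by positivity
        linarith
    have hmono : Monotone fun j : ℕ => {x | φ τ + 1 / ((j:ℝ) + 1) < |u x|} := by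
      intro i j hij x hx
      simp only [mem_ofPred_eq] at hx ⊢
      refine lt_of_le_of_lt ?_ hx
      gcongr
    apply ENNReal.toReal_le_of_le_ofReal (by positivity)
    rw [hU, hmono.measure_iUnion]
    apply iSup_le
    intro j
    have hjp : 0 < 1 / ((j:ℝ) + 1) := by positivity
    rw [← ENNReal.ofReal_toReal (sub_fin (φ τ + 1 / ((j:ℝ) + 1)) (by linarith [hφ0 τ]))]
    apply ENNReal.ofReal_le_ofReal
    obtain ⟨t, ht, htlt⟩ := exists_lt_of_csInf_lt (hSn τ) (show sInf (S τ) < φ τ + 1 / ((j:ℝ) + 1) by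
      simp only [hφ]; linarith)
    exact (hμanti t _ ht.1 htlt.le).trans ht.2
  have hiff : ∀ τ a, 0 ≤ a → (a < φ τ ↔ V * Real.exp (-τ) < μ a) := by
    intro τ a ha
    refine ⟨hφlt τ a ha, fun h => ?_⟩
    by_contra h'
    exact absurd (h.trans_le ((hμanti _ _ (hφ0 τ) (not_lt.1 h')).trans (hφμ τ))) (lt_irrefl _)
  have hI : Integrable (fun x => ‖fderiv ℝ u x‖ ^ n) := by
    apply Continuous.integrable_of_hasCompactSupport (by fun_prop)
    exact hfs.norm.comp_left (g := fun y : ℝ => y ^ n) (by simp; omega)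
  have hInn : ∀ x, 0 ≤ ‖fderiv ℝ u x‖ ^ n := fun x => by positivity
  have hItot : ∫ x, ‖fderiv ℝ u x‖ ^ n ≤ 1 := by
    rw [setIntegral_eq_integral_of_forall_compl_eq_zero] at hInteg
    · exact hInteg
    · intro x hx
      have : fderiv ℝ u x = 0 := by
        by_contra h
        exact hx (hsupp (support_fderiv_subset ℝ h))
      simp [this]; omega
  set ρ : ℝ → ℝ := fun τ => ∫ x in {x | |u x| < φ τ}, ‖fderiv ℝ u x‖ ^ n with hρ
  have hρ0 : ∀ τ, 0 ≤ ρ τ := fun τ => setIntegral_nonneg_of_ae (ae_of_all _ hInn)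
  have hρ1 : ∀ τ, ρ τ ≤ 1 := fun τ =>
    (setIntegral_le_integral hI (ae_of_all _ hInn)).trans hItot
  have hρm : Monotone ρ := by
    intro a b hab
    apply setIntegral_mono_set hI.integrableOn (ae_of_all _ hInn)
    exact Filter.Eventually.of_forall fun x hx => lt_of_lt_of_le hx (hφm hab)
  set ψ : ℝ → ℝ := fun τ => n * k * φ τ with hψ
  have H0 : ∀ a b, 0 ≤ a → a ≤ b →
      ψ b - ψ a ≤ (ρ b - ρ a) ^ ((1:ℝ) / n) * (Real.exp (b - a) - 1) ^ (1 - (1:ℝ) / n) := by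
    intro a b ha hab
    have hρab : 0 ≤ ρ b - ρ a := sub_nonneg.2 (hρm hab)
    have he : 0 ≤ Real.exp (b - a) - 1 := by linarith [Real.one_le_exp (sub_nonneg.2 hab)]
    rcases (hφm hab).eq_or_lt with heq | hlt
    · simp only [hψ]
      rw [heq, sub_self]
      positivity
    have key : ∀ t ∈ Ioo (φ a) (φ b), n * k * (t - φ a) ≤
        (ρ b - ρ a) ^ ((1:ℝ) / n) * (Real.exp (b - a) - 1) ^ (1 - (1:ℝ) / n) := by
      intro t ht
      have ht0 : 0 ≤ t := (hφ0 a).trans ht.1.le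
      have hm2 : 0 < V * Real.exp (-b) := by positivity
      have hl := level_local hn hu hc hk hk1 (hφ0 a) ht.1 hm2 (hφμ a) (by
        refine (hφlt b t ht0 ht.2).le.trans (measureReal_mono
          (fun x (hx : t < |u x|) => (le_of_lt hx : t ≤ |u x|)) ?_)
        exact ne_top_of_le_ne_top (sub_fin (φ a) (hφ0 a))
          (measure_mono fun x hx => lt_of_lt_of_le ht.1 hx))
      have e1 : V * Real.exp (-a) - V * Real.exp (-b) =
          (Real.exp (b - a) - 1) * (V * Real.exp (-b)) := by
        have : Real.exp (-a) = Real.exp (b - a) * Real.exp (-b) := by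
          rw [← Real.exp_add]; congr 1; ring
        rw [this]; ring
      rw [e1, Real.mul_rpow he hm2.le, ← mul_assoc] at hl
      have hl2 := le_of_mul_le_mul_right hl (Real.rpow_pos_of_pos hm2 _)
      refine hl2.trans ?_
      gcongr
      have hun : (∫ x in {x | |u x| < φ a} ∪ {x | φ a < |u x| ∧ |u x| < t}, ‖fderiv ℝ u x‖ ^ n) =
          ρ a + ∫ x in {x | φ a < |u x| ∧ |u x| < t}, ‖fderiv ℝ u x‖ ^ n := by
        apply setIntegral_union _ _ hI.integrableOn hI.integrableOn
        · rw [Set.disjoint_left]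
          intro x hx hx'
          exact absurd hx'.1 (not_lt.2 (le_of_lt hx))
        · exact ((isOpen_lt continuous_const huc.abs).inter
            (isOpen_lt huc.abs continuous_const)).measurableSet
      have hle : (∫ x in {x | |u x| < φ a} ∪ {x | φ a < |u x| ∧ |u x| < t}, ‖fderiv ℝ u x‖ ^ n) ≤
          ρ b := by
        apply setIntegral_mono_set hI.integrableOn (ae_of_all _ hInn)
        refine Filter.Eventually.of_forall fun x hx => ?_
        rcases hx with hx | hx
        · exact lt_trans hx hlt
        · exact lt_trans hx.2 ht.2
      linarith
    have hlim : Filter.Tendsto (fun t => n * k * (t - φ a)) (nhdsWithin (φ b) (Iio (φ b)))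
        (nhds (n * k * (φ b - φ a))) :=
      Filter.Tendsto.mono_left (Continuous.tendsto (by fun_prop) _) nhdsWithin_le_nhds
    have := le_of_tendsto hlim (by
      filter_upwards [Ioo_mem_nhdsLT hlt] with t ht
      exact key t ht)
    simp only [hψ]
    linarith
  have hfinal := hC ψ ρ (by simp [hψ, hφz]) (hφm.measurable.const_mul _)
    (fun t => by have := hφ0 t; simp only [hψ]; positivity) hρ0 hρ1 hρm (subdivide hn hρm H0)
  -- distribution
  set ν1 : Measure ℝ := (volume.restrict Ω).map (fun x => |u x|) with hν1
  set E : Measure ℝ := (volume.restrict (Ioi (0:ℝ))).withDensity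
    (fun τ => ENNReal.ofReal (Real.exp (-τ))) with hE
  have hexp : ∀ L : ℝ, ∫⁻ τ in Ioi L, ENNReal.ofReal (Real.exp (-τ)) =
      ENNReal.ofReal (Real.exp (-L)) := by
    intro L
    rw [← ofReal_integral_eq_lintegral_ofReal (integrableOn_exp_neg_Ioi L)
      (ae_of_all _ fun x => (Real.exp_pos _).le), integral_exp_neg_Ioi]
  have hΩV : volume Ω = ENNReal.ofReal V := (ENNReal.ofReal_toReal hΩf).symm
  have hEu : E univ = 1 := by
    rw [hE, withDensity_apply _ MeasurableSet.univ, Measure.restrict_univ, hexp]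
    simp
  have hfin1 : IsFiniteMeasure ν1 := by
    constructor
    rw [hν1, Measure.map_apply (by fun_prop) MeasurableSet.univ]
    simpa using hΩf.lt_top
  have huniv : ν1 univ = (volume Ω • E.map φ) univ := by
    rw [hν1, Measure.map_apply (by fun_prop) MeasurableSet.univ, Measure.smul_apply,
      Measure.map_apply hφm.measurable MeasurableSet.univ]
    simp [hEu]
  have hνeq : ν1 = volume Ω • E.map φ := by
    apply ext_of_generate_finite (range Ioi)
      (BorelSpace.measurable_eq.trans (borel_eq_generateFrom_Ioi ℝ)) isPiSystem_Ioi _ huniv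
    rintro _ ⟨a, rfl⟩
    by_cases ha : 0 ≤ a
    · rw [hν1, Measure.map_apply (by fun_prop) measurableSet_Ioi, Measure.smul_apply,
        Measure.map_apply hφm.measurable measurableSet_Ioi, hE,
        withDensity_apply _ (hφm.measurable measurableSet_Ioi),
        Measure.restrict_restrict (hφm.measurable measurableSet_Ioi)]
      have e1 : (volume.restrict Ω) ((fun x => |u x|) ⁻¹' Ioi a) = ENNReal.ofReal (μ a) := by
        have hs' : (fun x => |u x|) ⁻¹' Ioi a ⊆ Ω := hsub a ha
        rw [Measure.restrict_apply' hΩm, inter_eq_left.2 hs']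
        exact (ENNReal.ofReal_toReal (sub_fin a ha)).symm
      rw [e1]
      have hμ0 : 0 ≤ μ a := measureReal_nonneg
      rcases hμ0.eq_or_lt with h0 | hpos
      · have : φ ⁻¹' Ioi a = ∅ := by
          ext τ
          simp only [mem_preimage, mem_Ioi, mem_empty_iff_false, iff_false]
          rw [hiff τ a ha, ← h0, not_lt]
          positivity
        rw [this, ← h0]
        simp
      · have hle : μ a ≤ V := measureReal_mono (hsub a ha) hΩf
        have : φ ⁻¹' Ioi a ∩ Ioi 0 = Ioi (Real.log (V / μ a)) := by
          ext τ
          simp only [mem_inter_iff, mem_preimage, mem_Ioi]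
          rw [hiff τ a ha, Real.log_lt_iff_lt_exp (by positivity), div_lt_iff₀ hpos, Real.exp_neg,
            ← div_eq_mul_inv, div_lt_iff₀ (Real.exp_pos _), mul_comm (μ a)]
          refine ⟨fun h => h.1, fun h => ⟨h, ?_⟩⟩
          by_contra h'
          have : Real.exp τ ≤ 1 := Real.exp_le_one_iff.2 (not_lt.1 h')
          nlinarith
        rw [this, hexp, hΩV, smul_eq_mul, ← ENNReal.ofReal_mul hV0.le, Real.exp_neg,
          Real.exp_log (by positivity)]
        congr 1
        field_simp
    · push Not at ha
      have e1 : (fun x => |u x|) ⁻¹' Ioi a = univ := by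
        ext x
        simpa using ha.trans_le (abs_nonneg _)
      have e2 : φ ⁻¹' Ioi a = univ := by
        ext x
        simpa using ha.trans_le (hφ0 x)
      rw [Measure.map_apply (by fun_prop) MeasurableSet.univ, Measure.smul_apply,
        Measure.map_apply hφm.measurable MeasurableSet.univ] at huniv
      rw [hν1, Measure.map_apply (by fun_prop) measurableSet_Ioi, Measure.smul_apply,
        Measure.map_apply hφm.measurable measurableSet_Ioi, e1, e2]
      exact huniv
  have hG : Measurable fun y : ℝ =>
    ENNReal.ofReal (Real.exp ((n * k * y) ^ ((n : ℝ) / (n - 1)))) := by fun_prop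
  have hGφ : Measurable fun a : ℝ =>
    ENNReal.ofReal (Real.exp ((n * k * φ a) ^ ((n : ℝ) / (n - 1)))) := hG.comp hφm.measurable
  calc ∫⁻ x in Ω, ENNReal.ofReal (Real.exp ((n * k * |u x|) ^ ((n : ℝ) / (n - 1))))
      = ∫⁻ y, ENNReal.ofReal (Real.exp ((n * k * y) ^ ((n : ℝ) / (n - 1)))) ∂ν1 := by
        rw [hν1, lintegral_map hG (by fun_prop)]
    _ = volume Ω * ∫⁻ t in Ioi 0, ENNReal.ofReal (Real.exp (ψ t ^ ((n:ℝ) / (n - 1)) - t)) := by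
        rw [hνeq, lintegral_smul_measure, lintegral_map hG hφm.measurable, hE,
          lintegral_withDensity_eq_lintegral_mul _ (by fun_prop) hGφ,
          smul_eq_mul]
        congr 1
        refine lintegral_congr fun t => ?_
        simp only [Pi.mul_apply, Function.comp_apply]
        rw [← ENNReal.ofReal_mul (Real.exp_pos _).le, ← Real.exp_add]
        congr 2
        simp only [hψ]
        ring
    _ ≤ _ := by gcongr

end

/-- Moser's sharp inequality in `ℝⁿ`: there is `C = C(n) > 0` so that for every
bounded open `Ω ⊆ ℝⁿ` and every smooth compactly supported `u` with support in `Ω`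
and `∫_Ω |∇u|ⁿ ≤ 1`, one has `∫_Ω exp(α_n |u|^{n/(n−1)}) ≤ C · vol(Ω)`. -/
theorem moser_inequality (n : ℕ) (hn : 2 ≤ n) :
    ∃ C > 0, ∀ (Ω : Set (EuclideanSpace ℝ (Fin n))), IsOpen Ω → Bornology.IsBounded Ω →
      ∀ u : EuclideanSpace ℝ (Fin n) → ℝ, ContDiff ℝ (⊤ : ℕ∞) u → HasCompactSupport u →
        tsupport u ⊆ Ω →
        (∫ x in Ω, ‖gradient u x‖ ^ n) ≤ 1 →
        (∫ x in Ω, Real.exp (moserConst n * |u x| ^ ((n : ℝ) / (n - 1)))) ≤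
          C * (volume Ω).toReal := by
  have hn2 : (2:ℝ) ≤ n := by exact_mod_cast hn
  have hn0 : (0:ℝ) < n := by linarith
  have hn1 : (0:ℝ) < n - 1 := by linarith
  set κ := (volume (Metric.ball (0 : EuclideanSpace ℝ (Fin n)) 1)).toReal with hκ
  have hfin : volume (Metric.ball (0 : EuclideanSpace ℝ (Fin n)) 1) ≠ ⊤ :=
    Metric.isBounded_ball.measure_lt_top.ne
  have hκ0 : 0 < κ :=
    ENNReal.toReal_pos (Metric.measure_ball_pos _ _ one_pos).ne' hfin
  set k : ℝ := κ ^ ((1:ℝ) / n) with hkdef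
  have hk : 0 < k := by positivity
  have hkn : k ^ n = κ := by
    rw [hkdef, one_div]
    exact Real.rpow_inv_natCast_pow hκ0.le (by omega)
  have hk1 : volume (Metric.ball (0 : EuclideanSpace ℝ (Fin n)) 1) = ENNReal.ofReal (k ^ n) := by
    rw [hkn, hκ, ENNReal.ofReal_toReal hfin]
  have hconst : (n * k) ^ ((n:ℝ) / (n - 1)) = moserConst n := by
    unfold moserConst sphereArea
    rw [← hκ, Real.mul_rpow hn0.le hk.le, Real.mul_rpow hn0.le hκ0.le, ← mul_assoc, hkdef,
      ← Real.rpow_mul hκ0.le]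
    congr 1
    · have he : (n:ℝ) / (n - 1) = 1 + 1 / (n - 1) := by
        field_simp
        ring
      rw [he, Real.rpow_add hn0, Real.rpow_one]
    · congr 1
      field_simp
  obtain ⟨C, hC, hcore⟩ := moser_core hn hk hk1
  refine ⟨C, hC, fun Ω hΩ hb u hu hc hs hg => ?_⟩
  have hf : volume Ω ≠ ⊤ := hb.measure_lt_top.ne
  by_cases h0 : volume Ω = 0
  · rw [Measure.restrict_eq_zero.2 h0, h0]
    simp
  have hg' : (∫ x in Ω, ‖fderiv ℝ u x‖ ^ n) ≤ 1 := by
    refine le_trans (le_of_eq ?_) hg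
    congr 1
    funext x
    simp [gradient]
  have hm := hcore Ω hΩ.measurableSet hf h0 u hu hc hs hg'
  have hfun : ∀ x, (n * k * |u x|) ^ ((n:ℝ) / (n - 1)) =
      moserConst n * |u x| ^ ((n : ℝ) / (n - 1)) := by
    intro x
    rw [Real.mul_rpow (by positivity) (abs_nonneg _), hconst]
  simp only [hfun] at hm
  have hmeas : Measurable fun x => Real.exp (moserConst n * |u x| ^ ((n : ℝ) / (n - 1))) := by
    have := hu.continuous.measurable
    fun_prop
  rw [integral_eq_lintegral_of_nonneg_ae (Filter.Eventually.of_forall fun x => (Real.exp_pos _).le)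
    hmeas.aestronglyMeasurable]
  refine (ENNReal.toReal_mono (ENNReal.mul_ne_top hf ENNReal.ofReal_ne_top) hm).trans ?_
  rw [ENNReal.toReal_mul, ENNReal.toReal_ofReal hC.le, mul_comm]

end
end

section
/- (Sharpness of Moser's constant in ℝⁿ.) Fix an integer n ≥ 2, let ω_{n−1} = n · vol(unit ball in ℝⁿ) be the surface area of the unit sphere, α_n = n · ω_{n−1}^{1/(n−1)}, and let B be the open unit ball in ℝⁿ. Then for every β > α_n, the supremum of ∫_B exp( β |u|^{n/(n−1)} ) dx over all smooth functions u : ℝⁿ → ℝ with compact support contained in B satisfying ∫_B |∇u|ⁿ dx ≤ 1 is infinite: for every M > 0 there is such a u with ∫_B exp( β |u|^{n/(n−1)} ) dx > M. -/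
noncomputable section

open MeasureTheory Real

open Set Filter Topology

def msRho (k t : ℝ) : ℝ := smoothTransition (t - 1) * smoothTransition (k - 1 - t)

def msTheta (k t : ℝ) : ℝ := ∫ s in (1 : ℝ)..t, msRho k s

lemma msRho_contDiff (k : ℝ) : ContDiff ℝ (⊤ : ℕ∞) (msRho k) := by
  unfold msRho
  exact (smoothTransition.contDiff.comp (contDiff_id.sub contDiff_const)).mul
    (smoothTransition.contDiff.comp (contDiff_const.sub contDiff_id))

lemma msRho_nonneg (k t : ℝ) : 0 ≤ msRho k t :=
  mul_nonneg (smoothTransition.nonneg _) (smoothTransition.nonneg _)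

lemma msRho_le_one (k t : ℝ) : msRho k t ≤ 1 :=
  mul_le_one₀ (smoothTransition.le_one _) (smoothTransition.nonneg _) (smoothTransition.le_one _)

lemma msTheta_hasDerivAt (k t : ℝ) : HasDerivAt (msTheta k) (msRho k t) t := by
  have hc := (msRho_contDiff k).continuous
  exact intervalIntegral.integral_hasDerivAt_right (hc.intervalIntegrable _ _)
    hc.aestronglyMeasurable.stronglyMeasurableAtFilter hc.continuousAt

lemma msTheta_contDiff (k : ℝ) : ContDiff ℝ (⊤ : ℕ∞) (msTheta k) := by
  refine contDiff_infty_iff_deriv.2 ⟨fun t => (msTheta_hasDerivAt k t).differentiableAt, ?_⟩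
  have : deriv (msTheta k) = msRho k := funext fun t => (msTheta_hasDerivAt k t).deriv
  rw [this]
  exact msRho_contDiff k

lemma msTheta_zero (k t : ℝ) (ht : t ≤ 1) : msTheta k t = 0 := by
  unfold msTheta
  apply intervalIntegral.integral_zero_ae
  refine Eventually.of_forall fun x hx => ?_
  rw [uIoc_of_ge ht] at hx
  simp [msRho, smoothTransition.zero_of_nonpos (sub_nonpos.2 hx.2)]

lemma msTheta_ge (k t : ℝ) (hk : 4 ≤ k) (ht : k - 1 ≤ t) : k - 4 ≤ msTheta k t := by
  have hc := (msRho_contDiff k).continuous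
  have h1 : ∫ s in (2 : ℝ)..(k - 2), msRho k s = k - 4 := by
    rw [intervalIntegral.integral_congr (g := fun _ => (1 : ℝ))]
    · simp; ring
    · intro x hx
      rw [uIcc_of_le (by linarith)] at hx
      have h2 : 1 ≤ x - 1 := by linarith [hx.1]
      have h3 : 1 ≤ k - 1 - x := by linarith [hx.2]
      simp [msRho, smoothTransition.one_of_one_le h2, smoothTransition.one_of_one_le h3]
  rw [← h1]
  exact intervalIntegral.integral_mono_interval (by norm_num) (by linarith) (by linarith)
    (Eventually.of_forall fun x => msRho_nonneg k x) (hc.intervalIntegrable _ _)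

lemma ms_growth (B p n : ℝ) (hB : n < B) :
    Tendsto (fun k : ℝ => k * (B * ((k - 4) / k) ^ p - n)) atTop atTop := by
  have h1 : Tendsto (fun k : ℝ => (k - 4) / k) atTop (𝓝 1) := by
    have : Tendsto (fun k : ℝ => 1 - 4 / k) atTop (𝓝 (1 - 0)) :=
      tendsto_const_nhds.sub (tendsto_const_nhds.div_atTop tendsto_id)
    rw [sub_zero] at this
    refine this.congr' ?_
    filter_upwards [eventually_gt_atTop 0] with k hk
    field_simp
  have h2 : Tendsto (fun k : ℝ => B * ((k - 4) / k) ^ p - n) atTop (𝓝 (B * 1 ^ p - n)) :=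
    ((h1.rpow_const (Or.inl one_ne_zero)).const_mul B).sub_const n
  rw [one_rpow, mul_one] at h2
  exact tendsto_id.atTop_mul_pos (sub_pos.2 hB) h2

def msU (n : ℕ) (c k : ℝ) (x : EuclideanSpace ℝ (Fin n)) : ℝ :=
  c * msTheta k (-(1 / 2) * Real.log (‖x‖ ^ 2 + Real.exp (-2 * k)))

lemma ms_pos {n : ℕ} (k : ℝ) (x : EuclideanSpace ℝ (Fin n)) :
    0 < ‖x‖ ^ 2 + Real.exp (-2 * k) := by positivity

lemma msU_contDiff (n : ℕ) (c k : ℝ) : ContDiff ℝ (⊤ : ℕ∞) (msU n c k) := by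
  unfold msU
  refine contDiff_const.mul ((msTheta_contDiff k).comp (contDiff_const.mul ?_))
  exact ((contDiff_norm_sq ℝ).add contDiff_const).log fun x => (ms_pos k x).ne'

lemma msU_zero (n : ℕ) (c k : ℝ) (x : EuclideanSpace ℝ (Fin n)) (hx : Real.exp (-1) ≤ ‖x‖) :
    msU n c k x = 0 := by
  unfold msU
  rw [msTheta_zero, mul_zero]
  have h1 : Real.exp (-2) ≤ ‖x‖ ^ 2 + Real.exp (-2 * k) := by
    have : Real.exp (-2) = Real.exp (-1) ^ 2 := by rw [← Real.exp_nat_mul]; norm_num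
    have h3 := pow_le_pow_left₀ (Real.exp_pos (-1)).le hx 2
    have := Real.exp_pos (-2 * k)
    linarith
  have := (Real.le_log_iff_exp_le (ms_pos k x)).2 h1
  linarith

lemma ms_exp_two : 2 ≤ Real.exp 2 := by
  have := Real.add_one_le_exp (2 : ℝ)
  linarith

lemma msU_ge (n : ℕ) (c k : ℝ) (hc : 0 ≤ c) (hk : 4 ≤ k) (x : EuclideanSpace ℝ (Fin n))
    (hx : ‖x‖ ≤ Real.exp (-k)) : c * (k - 4) ≤ msU n c k x := by
  unfold msU
  refine mul_le_mul_of_nonneg_left (msTheta_ge k _ hk ?_) hc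
  have h1 : ‖x‖ ^ 2 + Real.exp (-2 * k) ≤ Real.exp (-2 * k + 2) := by
    have : Real.exp (-2 * k) = Real.exp (-k) ^ 2 := by
      rw [← Real.exp_nat_mul]; congr 1; push_cast; ring
    have h3 := pow_le_pow_left₀ (norm_nonneg x) hx 2
    rw [← this] at h3
    rw [Real.exp_add]
    nlinarith [ms_exp_two, Real.exp_pos (-2 * k)]
  have := (Real.log_le_iff_le_exp (ms_pos k x)).2 h1
  linarith

lemma msU_gradient (n : ℕ) (c k : ℝ) (hc : 0 ≤ c) (x : EuclideanSpace ℝ (Fin n)) :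
    ‖gradient (msU n c k) x‖ ^ n ≤
      (Ioc (Real.exp (-k)) 1).indicator (fun r : ℝ => c ^ n * (r ^ n)⁻¹) ‖x‖ ∨
      (n = 0) := by
  by_cases hn : n = 0
  · exact Or.inr hn
  left
  set s := -(1 / 2) * Real.log (‖x‖ ^ 2 + Real.exp (-2 * k)) with hs
  have hp := ms_pos k x
  have hd : HasFDerivAt (msU n c k)
      (c • (msRho k s • ((-(1 / 2) : ℝ) • ((‖x‖ ^ 2 + Real.exp (-2 * k))⁻¹ •
        ((2 : ℕ) • (innerSL ℝ x)))))) x := by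
    have h1 : HasFDerivAt (fun x : EuclideanSpace ℝ (Fin n) => ‖x‖ ^ 2 + Real.exp (-2 * k))
        ((2 : ℕ) • (innerSL ℝ x)) x := (hasStrictFDerivAt_norm_sq x).hasFDerivAt.add_const _
    have h2 := (h1.log hp.ne').const_mul (-(1 / 2) : ℝ)
    exact ((msTheta_hasDerivAt k s).comp_hasFDerivAt x h2).const_mul c
  have hg : ‖gradient (msU n c k) x‖ =
      c * (msRho k s * ((‖x‖ ^ 2 + Real.exp (-2 * k))⁻¹ * ‖x‖)) := by
    unfold gradient
    rw [LinearIsometryEquiv.norm_map, hd.fderiv, ← Nat.cast_smul_eq_nsmul ℝ]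
    simp only [norm_smul, innerSL_apply_norm, Real.norm_eq_abs]
    rw [abs_of_nonneg hc, abs_of_nonneg (msRho_nonneg _ _), abs_of_nonneg (inv_nonneg.2 hp.le)]
    norm_num
    left; left; ring
  rw [hg]
  by_cases hr : msRho k s = 0
  · rw [hr]
    simp only [zero_mul, mul_zero, zero_pow hn]
    apply indicator_nonneg
    intro r hr
    have : 0 < r := (Real.exp_pos _).trans hr.1
    positivity
  have hs1 : 1 < s := by
    by_contra! h
    exact hr (by simp [msRho, smoothTransition.zero_of_nonpos (sub_nonpos.2 h)])
  have hs2 : s < k - 1 := by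
    by_contra! h
    exact hr (by simp [msRho, smoothTransition.zero_of_nonpos (sub_nonpos.2 h)])
  have hx1 : ‖x‖ ≤ 1 := by
    have h1 : Real.log (‖x‖ ^ 2 + Real.exp (-2 * k)) < 0 := by linarith
    have h2 := (Real.log_neg_iff hp).1 h1
    have := Real.exp_pos (-2 * k)
    nlinarith [norm_nonneg x]
  have hx2 : Real.exp (-k) < ‖x‖ := by
    have h1 : -2 * k + 2 < Real.log (‖x‖ ^ 2 + Real.exp (-2 * k)) := by linarith
    have h2 := (Real.lt_log_iff_exp_lt hp).1 h1
    have : Real.exp (-2 * k) = Real.exp (-k) ^ 2 := by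
      rw [← Real.exp_nat_mul]; congr 1; push_cast; ring
    rw [Real.exp_add] at h2
    have h3 : Real.exp (-k) ^ 2 < ‖x‖ ^ 2 := by
      rw [← this]
      nlinarith [ms_exp_two, Real.exp_pos (-2 * k)]
    exact lt_of_pow_lt_pow_left₀ 2 (norm_nonneg x) h3
  have hx0 : 0 < ‖x‖ := (Real.exp_pos _).trans hx2
  rw [indicator_of_mem (show ‖x‖ ∈ Ioc (Real.exp (-k)) 1 from ⟨hx2, hx1⟩), ← inv_pow, ← mul_pow]
  have h4 : (‖x‖ ^ 2 + Real.exp (-2 * k))⁻¹ * ‖x‖ ≤ ‖x‖⁻¹ := by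
    rw [inv_mul_le_iff₀ hp]
    have : ‖x‖ ^ 2 * ‖x‖⁻¹ = ‖x‖ := by field_simp
    rw [add_mul, this]
    have : 0 ≤ Real.exp (-2 * k) * ‖x‖⁻¹ := by positivity
    linarith
  have h5 : 0 ≤ (‖x‖ ^ 2 + Real.exp (-2 * k))⁻¹ * ‖x‖ := by positivity
  have h6 := msRho_nonneg k s
  refine pow_le_pow_left₀ (by positivity) (mul_le_mul_of_nonneg_left ?_ hc) n
  calc _ ≤ 1 * ((‖x‖ ^ 2 + Real.exp (-2 * k))⁻¹ * ‖x‖) :=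
        mul_le_mul_of_nonneg_right (msRho_le_one k s) h5
    _ ≤ _ := by rw [one_mul]; exact h4

lemma ms_integral (n : ℕ) (hn : 2 ≤ n) (c k : ℝ) (hk : 0 ≤ k) :
    Integrable (fun x : EuclideanSpace ℝ (Fin n) =>
      (Ioc (Real.exp (-k)) 1).indicator (fun r : ℝ => c ^ n * (r ^ n)⁻¹) ‖x‖) ∧
    ∫ x : EuclideanSpace ℝ (Fin n),
      (Ioc (Real.exp (-k)) 1).indicator (fun r : ℝ => c ^ n * (r ^ n)⁻¹) ‖x‖ =
      c ^ n * (sphereArea n * k) := by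
  have : Nonempty (Fin n) := ⟨⟨0, by omega⟩⟩
  have he := Real.exp_pos (-k)
  have he1 : Real.exp (-k) ≤ 1 := Real.exp_le_one_iff.2 (by linarith)
  have hsub : Ioc (Real.exp (-k)) 1 ⊆ Ioi 0 := fun y hy => he.trans hy.1
  have hf : (fun y : ℝ => y ^ (n - 1) •
      (Ioc (Real.exp (-k)) 1).indicator (fun r : ℝ => c ^ n * (r ^ n)⁻¹) y) =
      (Ioc (Real.exp (-k)) 1).indicator (fun y => c ^ n * y⁻¹) := by
    funext y
    by_cases hy : y ∈ Ioc (Real.exp (-k)) 1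
    · rw [indicator_of_mem hy, indicator_of_mem hy]
      have hy0 : y ≠ 0 := (he.trans hy.1).ne'
      obtain ⟨m, rfl⟩ : ∃ m, n = m + 1 := ⟨n - 1, by omega⟩
      simp only [Nat.add_sub_cancel, smul_eq_mul]
      field_simp
      ring
    · simp [indicator_of_notMem hy]
  have hii : IntervalIntegrable (fun y : ℝ => c ^ n * y⁻¹) volume (Real.exp (-k)) 1 := by
    apply IntervalIntegrable.const_mul
    exact intervalIntegrable_inv_iff.2 (Or.inr (notMem_uIcc_of_lt he one_pos))
  constructor
  · refine (integrable_fun_norm_addHaar volume (E := EuclideanSpace ℝ (Fin n))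
      (f := (Ioc (Real.exp (-k)) 1).indicator (fun r : ℝ => c ^ n * (r ^ n)⁻¹))).2 ?_
    rw [finrank_euclideanSpace_fin, hf]
    apply Integrable.integrableOn
    rw [integrable_indicator_iff measurableSet_Ioc]
    exact hii.1
  · rw [integral_fun_norm_addHaar volume (E := EuclideanSpace ℝ (Fin n))
      ((Ioc (Real.exp (-k)) 1).indicator (fun r : ℝ => c ^ n * (r ^ n)⁻¹)),
      finrank_euclideanSpace_fin, hf, setIntegral_indicator measurableSet_Ioc,
      inter_eq_self_of_subset_right hsub, ← intervalIntegral.integral_of_le he1,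
      intervalIntegral.integral_const_mul, integral_inv_of_pos he one_pos]
    simp [sphereArea, Measure.real]
    ring

lemma sphereArea_pos (n : ℕ) (hn : 2 ≤ n) : 0 < sphereArea n := by
  unfold sphereArea
  have : 0 < (volume (Metric.ball (0 : EuclideanSpace ℝ (Fin n)) 1)).toReal :=
    ENNReal.toReal_pos (Metric.measure_ball_pos _ _ one_pos).ne' measure_ball_lt_top.ne
  positivity

/-- Sharpness of Moser's constant: for every `β > α_n` the corresponding
exponential integral over the unit ball is unbounded over smooth functions
compactly supported in the ball with `∫ |∇u|ⁿ ≤ 1`. -/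
theorem moser_const_sharp (n : ℕ) (hn : 2 ≤ n) (β : ℝ) (hβ : β > moserConst n)
    (M : ℝ) (hM : M > 0) :
    ∃ u : EuclideanSpace ℝ (Fin n) → ℝ, ContDiff ℝ (⊤ : ℕ∞) u ∧ HasCompactSupport u ∧
      tsupport u ⊆ Metric.ball (0 : EuclideanSpace ℝ (Fin n)) 1 ∧
      (∫ x in Metric.ball (0 : EuclideanSpace ℝ (Fin n)) 1, ‖gradient u x‖ ^ n) ≤ 1 ∧
      (∫ x in Metric.ball (0 : EuclideanSpace ℝ (Fin n)) 1,
        Real.exp (β * |u x| ^ ((n : ℝ) / (n - 1)))) > M := by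
  have : Nonempty (Fin n) := ⟨⟨0, by omega⟩⟩
  have hω := sphereArea_pos n hn
  have hn1 : (0 : ℝ) < (n : ℝ) - 1 := by
    have : (2 : ℝ) ≤ n := by exact_mod_cast hn
    linarith
  have hn0 : (0 : ℝ) < n := by linarith
  set q : ℝ := 1 / ((n : ℝ) - 1) with hq
  set p : ℝ := (n : ℝ) / ((n : ℝ) - 1) with hp
  have hp0 : 0 < p := by positivity
  have hpq : p = 1 + q := by rw [hp, hq]; field_simp; ring
  have hnp : (1 / (n : ℝ)) * p = q := by rw [hp, hq]; field_simp
  have hωq : 0 < sphereArea n ^ q := rpow_pos_of_pos hω q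
  have hB : (n : ℝ) < β / sphereArea n ^ q := by
    rw [lt_div_iff₀ hωq]
    exact hβ
  have hβ0 : 0 < β := lt_trans (mul_pos hn0 hωq) hβ
  set V : ℝ := (volume (Metric.ball (0 : EuclideanSpace ℝ (Fin n)) 1)).toReal with hV
  have hV0 : 0 < V :=
    ENNReal.toReal_pos (Metric.measure_ball_pos _ _ one_pos).ne' measure_ball_lt_top.ne
  obtain ⟨k, hkM, hk5⟩ := (((Real.tendsto_exp_atTop.comp
    (ms_growth (β / sphereArea n ^ q) p n hB)).eventually_gt_atTop (M / V)).and
      (eventually_ge_atTop 5)).exists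
  have hk0 : 0 < k := by linarith
  set c : ℝ := (sphereArea n * k) ^ (-(1 / (n : ℝ))) with hc
  have hc0 : 0 < c := rpow_pos_of_pos (by positivity) _
  have hcn : c ^ n * (sphereArea n * k) = 1 := by
    have h : 0 < sphereArea n * k := by positivity
    rw [hc, ← rpow_natCast, ← rpow_mul h.le, neg_mul, one_div,
      inv_mul_cancel₀ hn0.ne', rpow_neg_one, inv_mul_cancel₀ h.ne']
  have hsupp : tsupport (msU n c k) ⊆ Metric.closedBall 0 (Real.exp (-1)) := by
    refine closure_minimal ?_ Metric.isClosed_closedBall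
    intro x hx
    rw [mem_closedBall_zero_iff]
    by_contra! h
    exact hx (msU_zero n c k x h.le)
  have hcont : Continuous (msU n c k) := (msU_contDiff n c k).continuous
  refine ⟨msU n c k, msU_contDiff n c k, ?_, ?_, ?_, ?_⟩
  · exact (isCompact_closedBall _ _).of_isClosed_subset (isClosed_tsupport _) hsupp
  · refine hsupp.trans (Metric.closedBall_subset_ball ?_)
    exact Real.exp_lt_one_iff.2 (by norm_num)
  · obtain ⟨hi, he⟩ := ms_integral n hn c k hk0.le
    rw [← hcn, ← he]
    have hb : ∀ x : EuclideanSpace ℝ (Fin n), ‖gradient (msU n c k) x‖ ^ n ≤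
      (Ioc (Real.exp (-k)) 1).indicator (fun r : ℝ => c ^ n * (r ^ n)⁻¹) ‖x‖ :=
      fun x => (msU_gradient n c k hc0.le x).resolve_right (by omega)
    refine (integral_mono_of_nonneg (Eventually.of_forall fun x => by positivity)
      hi.integrableOn (Eventually.of_forall hb)).trans ?_
    exact setIntegral_le_integral hi
      (Eventually.of_forall fun x => le_trans (by positivity) (hb x))
  · have hFc : Continuous fun x : EuclideanSpace ℝ (Fin n) =>
        Real.exp (β * |msU n c k x| ^ p) :=
      Real.continuous_exp.comp (continuous_const.mul (hcont.abs.rpow_const fun _ => Or.inr hp0.le))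
    have hFi : IntegrableOn (fun x : EuclideanSpace ℝ (Fin n) =>
        Real.exp (β * |msU n c k x| ^ p)) (Metric.ball 0 1) :=
      (hFc.continuousOn.integrableOn_compact (isCompact_closedBall 0 1)).mono_set
        Metric.ball_subset_closedBall
    have he1 : Real.exp (-k) ≤ 1 := Real.exp_le_one_iff.2 (by linarith)
    have hss : Metric.ball (0 : EuclideanSpace ℝ (Fin n)) (Real.exp (-k)) ⊆ Metric.ball 0 1 :=
      Metric.ball_subset_ball he1
    have hvol : (volume : Measure (EuclideanSpace ℝ (Fin n))).real
        (Metric.ball 0 (Real.exp (-k))) = Real.exp (-k) ^ n * V := by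
      rw [Measure.real, Measure.addHaar_ball _ _ (Real.exp_pos _).le, finrank_euclideanSpace_fin,
        ENNReal.toReal_mul, ENNReal.toReal_ofReal (by positivity)]
    have hlow : Real.exp (-k) ^ n * V * Real.exp (β * (c * (k - 4)) ^ p) ≤
        ∫ x in Metric.ball (0 : EuclideanSpace ℝ (Fin n)) 1,
          Real.exp (β * |msU n c k x| ^ p) := by
      refine le_trans ?_ (setIntegral_mono_set hFi
        (Eventually.of_forall fun x => (Real.exp_pos _).le) hss.eventuallyLE)
      rw [← hvol, ← smul_eq_mul, ← setIntegral_const]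
      refine setIntegral_mono_on (integrableOn_const measure_ball_lt_top.ne)
        (hFi.mono_set hss) measurableSet_ball ?_
      intro x hx
      rw [mem_ball_zero_iff] at hx
      have hge := msU_ge n c k hc0.le (by linarith) x hx.le
      have h0 : 0 ≤ c * (k - 4) := mul_nonneg hc0.le (by linarith)
      apply Real.exp_le_exp.2
      refine mul_le_mul_of_nonneg_left (rpow_le_rpow h0 (hge.trans (le_abs_self _)) hp0.le) hβ0.le
    refine lt_of_lt_of_le ?_ hlow
    have hexp : Real.exp (-k) ^ n * Real.exp (β * (c * (k - 4)) ^ p) =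
        Real.exp (k * (β / sphereArea n ^ q * ((k - 4) / k) ^ p - n)) := by
      rw [← Real.exp_nat_mul, ← Real.exp_add]
      congr 1
      have h4 : 0 ≤ k - 4 := by linarith
      have hkq : 0 < k ^ q := rpow_pos_of_pos hk0 q
      rw [mul_rpow hc0.le h4, div_rpow h4 hk0.le, hc, ← rpow_mul (by positivity), neg_mul, hnp,
        rpow_neg (by positivity), mul_rpow hω.le hk0.le,
        show k ^ p = k * k ^ q by rw [hpq, rpow_add hk0, rpow_one]]
      field_simp
      ring
    have : Real.exp (-k) ^ n * V * Real.exp (β * (c * (k - 4)) ^ p) =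
        Real.exp (k * (β / sphereArea n ^ q * ((k - 4) / k) ^ p - n)) * V := by
      rw [← hexp]; ring
    rw [this]
    exact (div_lt_iff₀ hV0).1 hkM

end
end

section
/- (Adams' inequality in dimension 4.) There exists a constant C > 0 such that for every bounded open set Ω ⊂ ℝ⁴ and every smooth function u : ℝ⁴ → ℝ with compact support contained in Ω satisfying ∫_Ω (Δu)² dx ≤ 1, one has ∫_Ω e^{32π² u²} dx ≤ C · vol(Ω). -/
noncomputable section

open MeasureTheory Real

/-- The Euclidean Laplacian of `u : ℝ⁴ → ℝ` at `x`. -/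
def lap (u : EuclideanSpace ℝ (Fin 4) → ℝ) (x : EuclideanSpace ℝ (Fin 4)) : ℝ :=
  ∑ i, iteratedFDeriv ℝ 2 u x ![EuclideanSpace.single i 1, EuclideanSpace.single i 1]

local notation "E4" => EuclideanSpace ℝ (Fin 4)

lemma disc_sum_sq (a L : ℕ → ℝ) (hL : ∀ k, L k ^ 2 = L (k+1) ^ 2 + a k ^ 2) (k d : ℕ) :
    ∑ j ∈ Finset.range d, a (k + j) ^ 2 = L k ^ 2 - L (k + d) ^ 2 := by
  induction d with
  | zero => simp
  | succ d ih => rw [Finset.sum_range_succ, ih, ← add_assoc]; linarith [hL (k+d)]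

lemma disc_cs (a L : ℕ → ℝ) (hL : ∀ k, L k ^ 2 = L (k+1) ^ 2 + a k ^ 2) (k d : ℕ) :
    (∑ j ∈ Finset.range d, a (k + j)) ^ 2 ≤ d * (L k ^ 2 - L (k + d) ^ 2) := by
  rw [← disc_sum_sq a L hL]
  simpa using sq_sum_le_card_mul_sum_sq (s := Finset.range d) (f := fun j => a (k+j))

lemma disc_step1 (a L : ℕ → ℝ) (hL0 : ∀ k, 0 ≤ L k) 
    (hL : ∀ k, L k ^ 2 = L (k+1) ^ 2 + a k ^ 2) (h1 : L 0 ≤ 1) (k : ℕ) :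
    (∑ j ∈ Finset.range k, a j + 2 * L k) ^ 2 ≤ k - k * L k ^ 2 / 2 + 12 := by
  have h := disc_cs a L hL 0 k
  simp only [zero_add] at h
  set S := ∑ j ∈ Finset.range k, a j
  have hk : (0:ℝ) ≤ k := Nat.cast_nonneg k
  have hL01 : L 0 ^ 2 ≤ 1 := by nlinarith [hL0 0]
  have hS : S ^ 2 ≤ k * (1 - L k ^2) := h.trans (by gcongr)
  have hLk : L k ^ 2 ≤ 1 := by
    have := disc_sum_sq a L hL 0 k
    simp only [zero_add] at this
    have h2 : 0 ≤ ∑ j ∈ Finset.range k, a j ^ 2 := Finset.sum_nonneg (fun i _ => sq_nonneg _)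
    linarith
  have hSk : S ≤ √k := by
    apply Real.le_sqrt_of_sq_le
    nlinarith [sq_nonneg (L k)]
  have hsq : √(k:ℝ) ^ 2 = k := Real.sq_sqrt hk
  have h4 : S * L k ≤ √k * L k := mul_le_mul_of_nonneg_right hSk (hL0 k)
  have h5 : 4 * (√k * L k) ≤ (√k * L k)^2/2 + 8 := by nlinarith [sq_nonneg (√k * L k - 4)]
  have h6 : (√k * L k)^2 = k * L k ^2 := by rw [mul_pow, hsq]
  nlinarith

lemma disc_step2 (a L : ℕ → ℝ) (hL0 : ∀ k, 0 ≤ L k) (ha : ∀ k, 0 ≤ a k)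
    (hL : ∀ k, L k ^ 2 = L (k+1) ^ 2 + a k ^ 2) (h1 : L 0 ≤ 1) (n k d : ℕ)
    (hk1 : (k:ℝ) - (∑ j ∈ Finset.range k, a j + 2 * L k) ^ 2 ≤ n)
    (hk2 : ((k + d : ℕ):ℝ) - (∑ j ∈ Finset.range (k+d), a j + 2 * L (k+d)) ^ 2 ≤ n)
    (hM : 192 * (n + 1) ≤ k) : d ≤ 390 * (n + 1) := by
  have hs1 := disc_step1 a L hL0 hL h1 k
  have hx : k * L k ^ 2 ≤ 24 * ((n:ℝ) + 1) := by
    have : (0:ℝ) ≤ n := Nat.cast_nonneg n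
    linarith
  have hM' : 192 * ((n:ℝ) + 1) ≤ k := by exact_mod_cast hM
  have hn : (0:ℝ) ≤ n := Nat.cast_nonneg n
  have hkp : (0:ℝ) < k := by linarith
  have hL8 : L k ^ 2 ≤ 1 / 8 := by
    by_contra hc
    push Not at hc
    nlinarith
  have hc1 := disc_cs a L hL 0 k
  have hc2 := disc_cs a L hL k d
  simp only [zero_add] at hc1
  rw [Finset.sum_range_add] at hk2
  set S := ∑ j ∈ Finset.range k, a j
  set R := ∑ j ∈ Finset.range d, a (k + j)
  have hL01 : L 0 ^ 2 ≤ 1 := by nlinarith [hL0 0]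
  have hd : (0:ℝ) ≤ d := Nat.cast_nonneg d
  have hSk : S ≤ √k := by
    apply Real.le_sqrt_of_sq_le
    nlinarith [sq_nonneg (L k)]
  have hsd : √(d:ℝ) ^ 2 = d := Real.sq_sqrt hd
  have hsk : √(k:ℝ) ^ 2 = k := Real.sq_sqrt hkp.le
  have hRd : R ≤ √d * L k := by
    apply abs_le_of_sq_le_sq' _ (mul_nonneg (Real.sqrt_nonneg _) (hL0 k)) |>.2
    rw [mul_pow, hsd]
    nlinarith [sq_nonneg (L (k+d))]
  have hLd : L (k+d) ≤ L k := by
    apply abs_le_of_sq_le_sq' _ (hL0 k) |>.2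
    have := disc_sum_sq a L hL k d
    have h2 : 0 ≤ ∑ j ∈ Finset.range d, a (k + j) ^ 2 := Finset.sum_nonneg (fun i _ => sq_nonneg _)
    linarith
  have hS0 : 0 ≤ S := Finset.sum_nonneg (fun i _ => ha _)
  have hR0 : 0 ≤ R := Finset.sum_nonneg (fun i _ => ha _)
  have hb : S + R + 2 * L (k+d) ≤ √k + L k * (√d + 2) := by nlinarith
  have hb2 : (S + R + 2 * L (k+d))^2 ≤ (√k + L k * (√d + 2))^2 := by
    have := hL0 (k+d)
    gcongr
  have e1 : (√(k:ℝ) * L k)^2 ≤ 24 * ((n:ℝ) + 1) := by rw [mul_pow, hsk]; exact hx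
  have e2 : 2 * (√(k:ℝ) * L k) * (√d + 2) ≤ 8 * (√(k:ℝ) * L k)^2 + (√d+2)^2/8 := by
    nlinarith [sq_nonneg (8 * (√(k:ℝ) * L k) - (√d + 2))]
  have e3 : (√(d:ℝ)+2)^2 ≤ 2 * d + 8 := by nlinarith [sq_nonneg (√(d:ℝ) - 2)]
  have e4 : L k ^2 * (√(d:ℝ)+2)^2 ≤ 1/8 * (√(d:ℝ)+2)^2 := by gcongr
  push_cast at hk2
  have e5 : (√(k:ℝ) + L k * (√d + 2))^2
      = √(k:ℝ)^2 + 2 * (√(k:ℝ) * L k) * (√d + 2) + L k ^2 * (√(d:ℝ)+2)^2 := by ring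
  have : (d:ℝ) ≤ 390 * ((n:ℝ) + 1) := by
    rw [hsk] at e5
    linarith
  exact_mod_cast this

lemma disc_count (F : ℕ → ℝ) (n : ℕ)
    (h : ∀ k d : ℕ, F k ≤ n → F (k + d) ≤ n → 192 * (n + 1) ≤ k → d ≤ 390 * (n + 1)) :
    {k | F k ≤ n}.encard ≤ (600 * (n + 1) : ℕ) := by
  classical
  set M := 192 * (n + 1) with hM
  by_cases hex : ∃ k, M ≤ k ∧ F k ≤ n
  · set k0 := Nat.find hex
    have hk0 := Nat.find_spec hex
    have hsub : {k | F k ≤ n} ⊆ ((Finset.range M ∪ Finset.Icc k0 (k0 + 390 * (n+1)) : Finset ℕ) : Set ℕ) := by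
      intro k hk
      simp only [Finset.coe_union, Set.mem_union, Finset.coe_range, Set.mem_Iio, Finset.coe_Icc, Set.mem_Icc]
      by_cases hkM : k < M
      · exact Or.inl hkM
      · right
        have h1 : k0 ≤ k := Nat.find_min' hex ⟨not_lt.mp hkM, hk⟩
        refine ⟨h1, ?_⟩
        obtain ⟨d, rfl⟩ := Nat.exists_eq_add_of_le h1
        have := h k0 d hk0.2 hk hk0.1
        omega
    refine (Set.encard_le_encard hsub).trans ?_
    rw [Set.encard_coe_eq_coe_finsetCard]
    norm_cast
    refine (Finset.card_union_le _ _).trans ?_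
    simp only [Finset.card_range, Nat.card_Icc]
    omega
  · push Not at hex
    have hsub : {k | F k ≤ n} ⊆ ((Finset.range M : Finset ℕ) : Set ℕ) := by
      intro k hk
      simp only [Finset.coe_range, Set.mem_Iio]
      by_contra hc
      exact absurd hk (not_le.mpr (hex k (not_lt.mp hc)))
    refine (Set.encard_le_encard hsub).trans ?_
    rw [Set.encard_coe_eq_coe_finsetCard]
    norm_cast
    simp only [Finset.card_range]
    omega

lemma disc_main : ∃ C : ℝ, 0 < C ∧ ∀ (a L : ℕ → ℝ), (∀ k, 0 ≤ L k) → (∀ k, 0 ≤ a k) →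
    (∀ k, L k ^ 2 = L (k+1) ^ 2 + a k ^ 2) → L 0 ≤ 1 → 
    ∑' k : ℕ, ENNReal.ofReal (Real.exp ((∑ j ∈ Finset.range k, a j + 2 * L k) ^ 2 - k)) ≤ ENNReal.ofReal C := by
  have hsum : Summable (fun n : ℕ => Real.exp (12 - n) * (600 * (n + 1) : ℕ)) := by
    have h1 := Real.summable_pow_mul_exp_neg_nat_mul 1 (r := 1) one_pos
    have h0 := Real.summable_pow_mul_exp_neg_nat_mul 0 (r := 1) one_pos
    refine ((h1.add h0).mul_left (Real.exp 12 * 600)).congr (fun n => ?_)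
    push_cast
    rw [sub_eq_add_neg, Real.exp_add]
    ring_nf
  refine ⟨(∑' n : ℕ, Real.exp (12 - n) * (600 * (n + 1) : ℕ)) + 1, ?_, ?_⟩
  · have : 0 ≤ (∑' n : ℕ, Real.exp (12 - n) * ((600 * (n + 1) : ℕ):ℝ)) := tsum_nonneg (fun n => by positivity)
    linarith
  intro a L hL0 ha hL h1
  set F : ℕ → ℝ := fun k => (k:ℝ) - (∑ j ∈ Finset.range k, a j + 2 * L k) ^ 2 with hF
  have hFlow : ∀ k, -12 ≤ F k := by
    intro k
    have := disc_step1 a L hL0 hL h1 k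
    have h2 : 0 ≤ k * L k ^ 2 := by positivity
    simp only [hF]; linarith
  have hcount : ∀ n : ℕ, {k | F k ≤ n}.encard ≤ (600 * (n + 1) : ℕ) := fun n =>
    disc_count F n (fun k d h2 h3 h4 => disc_step2 a L hL0 ha hL h1 n k d h2 h3 h4)
  calc ∑' k : ℕ, ENNReal.ofReal (Real.exp ((∑ j ∈ Finset.range k, a j + 2 * L k) ^ 2 - k))
      ≤ ∑' k : ℕ, ∑' n : ℕ, ENNReal.ofReal (Real.exp (12 - n)) * {k | F k ≤ n}.indicator 1 k := by
        refine ENNReal.tsum_le_tsum (fun k => ?_)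
        refine le_trans ?_ (ENNReal.le_tsum ⌈F k⌉₊)
        rw [Set.indicator_of_mem (show k ∈ {j | F j ≤ ((⌈F k⌉₊ : ℕ) : ℝ)} from Nat.le_ceil (F k))]
        simp only [Pi.one_apply, mul_one]
        apply ENNReal.ofReal_le_ofReal
        apply Real.exp_le_exp.mpr
        have e : (∑ j ∈ Finset.range k, a j + 2 * L k) ^ 2 - k = - F k := by simp [hF]
        rw [e]
        rcases le_or_gt (F k) 0 with h | h
        · rw [Nat.ceil_eq_zero.mpr h]; have := hFlow k; simp; linarith
        · have := Nat.ceil_lt_add_one h.le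
          linarith
    _ = ∑' n : ℕ, ∑' k : ℕ, ENNReal.ofReal (Real.exp (12 - n)) * {k | F k ≤ n}.indicator 1 k := ENNReal.tsum_comm
    _ ≤ ∑' n : ℕ, ENNReal.ofReal (Real.exp (12 - n) * (600 * (n + 1) : ℕ)) := by
        refine ENNReal.tsum_le_tsum (fun n => ?_)
        rw [ENNReal.tsum_mul_left, ENNReal.ofReal_mul (Real.exp_pos _).le]
        gcongr
        rw [← tsum_subtype {k | F k ≤ n} (1 : ℕ → ENNReal)]
        simp only [Pi.one_apply, ENNReal.tsum_set_one]
        rw [ENNReal.ofReal_natCast]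
        have := hcount n
        exact_mod_cast this
    _ = ENNReal.ofReal (∑' n : ℕ, Real.exp (12 - n) * (600 * (n + 1) : ℕ)) := by
        rw [ENNReal.ofReal_tsum_of_nonneg (fun n => by positivity) hsum]
    _ ≤ _ := ENNReal.ofReal_le_ofReal (by linarith)

lemma vol_ball4 : volume.real (Metric.ball (0 : E4) 1) = π ^ 2 / 2 := by
  rw [Measure.real, InnerProductSpace.volume_ball_of_dim_even (k := 2) (by simp) 0]
  norm_num
  positivity

lemma kernel_1d : IntegrableOn (fun r : ℝ => r ^ 3 • (8 / (r ^ 2 + 1) ^ 3)) (Set.Ioi 0) ∧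
    ∫ r in Set.Ioi (0:ℝ), r ^ 3 • (8 / (r ^ 2 + 1) ^ 3) = 2 := by
  have hd : ∀ r ∈ Set.Ici (0:ℝ), HasDerivAt (fun r : ℝ => 2 * (1 - (r ^ 2 + 1)⁻¹) ^ 2) (r ^ 3 • (8 / (r ^ 2 + 1) ^ 3)) r := by
    intro r _
    have hp : r ^ 2 + 1 ≠ 0 := by positivity
    have h1 : HasDerivAt (fun r : ℝ => r ^ 2 + 1) (2 * r) r := by
      simpa using (hasDerivAt_pow 2 r).add_const 1
    have h2 := (((h1.inv hp).const_sub 1).pow 2).const_mul 2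
    convert! h2 using 1
    simp only [smul_eq_mul, Pi.inv_apply]
    norm_num
    field_simp
    ring
  have hpos : ∀ r ∈ Set.Ioi (0:ℝ), 0 ≤ r ^ 3 • (8 / (r ^ 2 + 1) ^ 3) := by
    intro r hr
    have : (0:ℝ) < r := hr
    rw [smul_eq_mul]; positivity
  have hlim : Filter.Tendsto (fun r : ℝ => 2 * (1 - (r ^ 2 + 1)⁻¹) ^ 2) Filter.atTop (nhds 2) := by
    have h1 : Filter.Tendsto (fun r : ℝ => (r ^ 2 + 1)⁻¹) Filter.atTop (nhds 0) := by
      apply Filter.Tendsto.inv_tendsto_atTop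
      apply Filter.tendsto_atTop_add_const_right
      exact Filter.tendsto_pow_atTop two_ne_zero
    simpa using ((h1.const_sub 1).pow 2).const_mul 2
  refine ⟨integrableOn_Ioi_deriv_of_nonneg' hd hpos hlim, ?_⟩
  rw [integral_Ioi_of_hasDerivAt_of_nonneg' hd hpos hlim]
  norm_num

lemma kernel_4d : Integrable (fun z : E4 => 8 / (‖z‖ ^ 2 + 1) ^ 3) ∧
    ∫ z : E4, 8 / (‖z‖ ^ 2 + 1) ^ 3 = 4 * π ^ 2 := by
  have hdim : Module.finrank ℝ E4 = 4 := by simp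
  constructor
  · apply (integrable_fun_norm_addHaar (volume : Measure E4) (f := fun r => 8 / (r ^ 2 + 1) ^ 3)).mpr
    rw [hdim]
    exact kernel_1d.1
  · have := integral_fun_norm_addHaar (volume : Measure E4) (fun r => 8 / (r ^ 2 + 1) ^ 3)
    rw [this, hdim, vol_ball4, kernel_1d.2]
    simp only [nsmul_eq_mul, smul_eq_mul]
    push_cast; ring

lemma ibp (f f' g g' : E4 → ℝ) (v : E4) (hf : Continuous f) (hf' : Continuous f')
    (hg : Continuous g) (hg' : Continuous g') (hgc : HasCompactSupport g) (hgc' : HasCompactSupport g')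
    (h1 : ∀ x, HasLineDerivAt ℝ f (f' x) x v) (h2 : ∀ x, HasLineDerivAt ℝ g (g' x) x v) :
    ∫ x, f x * g' x = - ∫ x, f' x * g x := by
  have := integral_bilinear_hasLineDerivAt_right_eq_neg_left_of_integrable (μ := (volume : Measure E4))
    (B := ContinuousLinearMap.mul ℝ ℝ) (f := f) (f' := f') (g := g) (g' := g') (v := v)
    ((hf'.mul hg).integrable_of_hasCompactSupport hgc.mul_left)
    ((hf.mul hg').integrable_of_hasCompactSupport hgc'.mul_left)
    ((hf.mul hg).integrable_of_hasCompactSupport hgc.mul_left) (fun x _ => h1 x) (fun x _ => h2 x)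
  simpa using this

lemma norm_line (x y : E4) (i : Fin 4) (t : ℝ) :
    ‖y + t • EuclideanSpace.single i (1:ℝ) - x‖ ^ 2 = ‖y - x‖ ^ 2 + 2 * t * (y - x) i + t ^ 2 := by
  rw [add_sub_right_comm, norm_add_sq_real, inner_smul_right, EuclideanSpace.inner_single_right, norm_smul]
  simp
  ring

lemma line1 (x y : E4) (i : Fin 4) (ε : ℝ) (hε : 0 < ε) :
    HasLineDerivAt ℝ (fun y : E4 => (‖y - x‖ ^ 2 + ε)⁻¹) (-2 * (y - x) i / (‖y - x‖ ^ 2 + ε) ^ 2) y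
      (EuclideanSpace.single i (1:ℝ)) := by
  unfold HasLineDerivAt
  simp_rw [norm_line]
  have h1 : HasDerivAt (fun t : ℝ => ‖y - x‖ ^ 2 + 2 * t * (y - x) i + t ^ 2 + ε) (2 * (y - x) i) 0 := by
    have := ((((hasDerivAt_id (0:ℝ)).const_mul 2).mul_const ((y-x) i)).const_add (‖y - x‖ ^ 2)).add
      (hasDerivAt_pow 2 (0:ℝ)) |>.add_const ε
    simpa using this
  have hp : ‖y - x‖ ^ 2 + 2 * 0 * (y - x) i + 0 ^ 2 + ε ≠ 0 := by
    have : 0 < ‖y - x‖ ^ 2 + ε := by positivity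
    simpa using this.ne'
  have h2 := h1.inv hp
  convert! h2 using 1
  simp

lemma line2 (x y : E4) (i : Fin 4) (ε : ℝ) (hε : 0 < ε) :
    HasLineDerivAt ℝ (fun y : E4 => -2 * (y - x) i / (‖y - x‖ ^ 2 + ε) ^ 2)
      (-2 / (‖y - x‖ ^ 2 + ε) ^ 2 + 8 * ((y - x) i) ^ 2 / (‖y - x‖ ^ 2 + ε) ^ 3) y
      (EuclideanSpace.single i (1:ℝ)) := by
  unfold HasLineDerivAt
  simp_rw [norm_line]
  have h1 : HasDerivAt (fun t : ℝ => ‖y - x‖ ^ 2 + 2 * t * (y - x) i + t ^ 2 + ε) (2 * (y - x) i) 0 := by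
    have := ((((hasDerivAt_id (0:ℝ)).const_mul 2).mul_const ((y-x) i)).const_add (‖y - x‖ ^ 2)).add
      (hasDerivAt_pow 2 (0:ℝ)) |>.add_const ε
    simpa using this
  have hp0 : 0 < ‖y - x‖ ^ 2 + ε := by positivity
  have hp : (‖y - x‖ ^ 2 + 2 * 0 * (y - x) i + 0 ^ 2 + ε) ^ 2 ≠ 0 := by
    simpa using hp0.ne'
  have h3 : HasDerivAt (fun t : ℝ => -2 * (y + t • EuclideanSpace.single i (1:ℝ) - x) i) (-2) 0 := by
    have := (((hasDerivAt_id (0:ℝ)).add_const (y i - x i)).const_mul (-2))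
    convert! this using 1
    · ext t; simp; ring
    · simp
  have h2 := h3.div (h1.pow 2) hp
  convert! h2 using 1
  simp
  field_simp
  ring

lemma lap_eq (u : E4 → ℝ) (y : E4) : lap u y = ∑ i, fderiv ℝ (fderiv ℝ u) y (EuclideanSpace.single i 1) (EuclideanSpace.single i 1) := by
  unfold lap
  simp [iteratedFDeriv_two_apply]

lemma rep (u : E4 → ℝ) (hu : ContDiff ℝ (⊤ : ℕ∞) u) (hc : HasCompactSupport u) (x : E4) (ε : ℝ) (hε : 0 < ε) :
    ∫ y, (‖y - x‖ ^ 2 + ε)⁻¹ * lap u y = - ∫ y, 8 * ε / (‖y - x‖ ^ 2 + ε) ^ 3 * u y := by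
  have hpos : ∀ y : E4, ‖y - x‖ ^ 2 + ε ≠ 0 := fun y => by positivity
  have hcK : Continuous (fun y : E4 => (‖y - x‖ ^ 2 + ε)⁻¹) := by
    apply Continuous.inv₀ (by fun_prop) hpos
  have hcP : ∀ i, Continuous (fun y : E4 => -2 * (y - x) i / (‖y - x‖ ^ 2 + ε) ^ 2) := fun i => by
    apply Continuous.div₀ (by fun_prop) (by fun_prop) (fun y => pow_ne_zero _ (hpos y))
  have hcQ : ∀ i, Continuous (fun y : E4 => (-2 / (‖y - x‖ ^ 2 + ε) ^ 2 + 8 * ((y - x) i) ^ 2 / (‖y - x‖ ^ 2 + ε) ^ 3)) := fun i => by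
    apply Continuous.add
    · apply Continuous.div₀ (by fun_prop) (by fun_prop) (fun y => pow_ne_zero _ (hpos y))
    · apply Continuous.div₀ (by fun_prop) (by fun_prop) (fun y => pow_ne_zero _ (hpos y))
  have hu1 : ContDiff ℝ (⊤ : ℕ∞) (fderiv ℝ u) := hu.fderiv_right (by simp)
  have hu2 : ContDiff ℝ (⊤ : ℕ∞) (fderiv ℝ (fderiv ℝ u)) := hu1.fderiv_right (by simp)
  have hc1 : HasCompactSupport (fderiv ℝ u) := hc.fderiv ℝ
  have hc2 : HasCompactSupport (fderiv ℝ (fderiv ℝ u)) := hc1.fderiv ℝ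
  have hcu : Continuous u := hu.continuous
  have hcu1 := hu1.continuous
  have hcu2 := hu2.continuous
  have hcu1' : ∀ i : Fin 4, Continuous (fun y => fderiv ℝ u y (EuclideanSpace.single i 1)) := fun i => by fun_prop
  have hcu2' : ∀ i : Fin 4, Continuous (fun y => fderiv ℝ (fderiv ℝ u) y (EuclideanSpace.single i 1) (EuclideanSpace.single i 1)) := fun i => by fun_prop
  have hs1 : ∀ i : Fin 4, HasCompactSupport (fun y => fderiv ℝ u y (EuclideanSpace.single i 1)) := fun i =>
    hc1.comp_left (g := fun A : E4 →L[ℝ] ℝ => A (EuclideanSpace.single i 1)) (by simp)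
  have hs2 : ∀ i : Fin 4, HasCompactSupport (fun y => fderiv ℝ (fderiv ℝ u) y (EuclideanSpace.single i 1) (EuclideanSpace.single i 1)) := fun i =>
    hc2.comp_left (g := fun A : E4 →L[ℝ] E4 →L[ℝ] ℝ => A (EuclideanSpace.single i 1) (EuclideanSpace.single i 1)) (by simp)
  have hd1 : ∀ (i : Fin 4) y, HasLineDerivAt ℝ u (fderiv ℝ u y (EuclideanSpace.single i 1)) y (EuclideanSpace.single i 1) := fun i y =>
    ((hu.differentiable (by simp)) y).hasFDerivAt.hasLineDerivAt _
  have hd2 : ∀ (i : Fin 4) y, HasLineDerivAt ℝ (fun y => fderiv ℝ u y (EuclideanSpace.single i 1)) (fderiv ℝ (fderiv ℝ u) y (EuclideanSpace.single i 1) (EuclideanSpace.single i 1)) y (EuclideanSpace.single i 1) := fun i y => by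
    have h := ((hu1.differentiable (by simp)) y).hasFDerivAt
    have h2 := h.clm_apply (hasFDerivAt_const (EuclideanSpace.single i (1:ℝ)) y)
    have h3 := h2.hasLineDerivAt (EuclideanSpace.single i (1:ℝ))
    simpa using h3
  have key : ∀ i : Fin 4, ∫ y, (‖y - x‖ ^ 2 + ε)⁻¹ * fderiv ℝ (fderiv ℝ u) y (EuclideanSpace.single i 1) (EuclideanSpace.single i 1)
      = ∫ y, (-2 / (‖y - x‖ ^ 2 + ε) ^ 2 + 8 * ((y - x) i) ^ 2 / (‖y - x‖ ^ 2 + ε) ^ 3) * u y := by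
    intro i
    rw [ibp _ _ _ _ _ hcK (hcP i) (hcu1' i) (hcu2' i) (hs1 i) (hs2 i) (fun y => line1 x y i ε hε) (hd2 i),
      ibp _ _ _ _ _ (hcP i) (hcQ i) hcu (hcu1' i) hc (hs1 i) (fun y => line2 x y i ε hε) (hd1 i), neg_neg]
  simp_rw [lap_eq, Finset.mul_sum]
  have hI1 : ∀ i : Fin 4, Integrable (fun y : E4 => (‖y - x‖ ^ 2 + ε)⁻¹ * fderiv ℝ (fderiv ℝ u) y (EuclideanSpace.single i 1) (EuclideanSpace.single i 1)) := fun i =>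
    (hcK.mul (hcu2' i)).integrable_of_hasCompactSupport (hs2 i).mul_left
  have hI2 : ∀ i : Fin 4, Integrable (fun y : E4 => (-2 / (‖y - x‖ ^ 2 + ε) ^ 2 + 8 * ((y - x) i) ^ 2 / (‖y - x‖ ^ 2 + ε) ^ 3) * u y) := fun i =>
    ((hcQ i).mul hcu).integrable_of_hasCompactSupport hc.mul_left
  rw [integral_finsetSum _ (fun i _ => hI1 i)]
  simp_rw [key]
  rw [← integral_finsetSum _ (fun i _ => hI2 i), ← integral_neg]
  congr 1
  ext y
  rw [← Finset.sum_mul, ← neg_mul]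
  congr 1
  have hp := hpos y
  have hn : ‖y - x‖ ^ 2 = (y - x) 0 ^ 2 + (y - x) 1 ^ 2 + (y - x) 2 ^ 2 + (y - x) 3 ^ 2 := by
    rw [EuclideanSpace.norm_sq_eq]; simp [Fin.sum_univ_four]
  rw [Fin.sum_univ_four]
  set q := ‖y - x‖ ^ 2 + ε with hq
  have : ε = q - ((y - x) 0 ^ 2 + (y - x) 1 ^ 2 + (y - x) 2 ^ 2 + (y - x) 3 ^ 2) := by rw [hq, hn]; ring
  rw [this]
  field_simp
  ring

lemma rep_scaled (u : E4 → ℝ) (hu : ContDiff ℝ (⊤ : ℕ∞) u) (hc : HasCompactSupport u) (x : E4) (δ : ℝ) (hδ : 0 < δ) :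
    ∫ y, (‖y - x‖ ^ 2 + δ ^ 2)⁻¹ * lap u y = - ∫ z : E4, 8 / (‖z‖ ^ 2 + 1) ^ 3 * u (x + δ • z) := by
  rw [rep u hu hc x _ (by positivity)]
  congr 1
  rw [← integral_add_left_eq_self (μ := (volume : Measure E4)) _ x]
  have h := Measure.integral_comp_smul (volume : Measure E4) (fun z : E4 => 8 * δ ^ 2 / (‖x + z - x‖ ^ 2 + δ ^ 2) ^ 3 * u (x + z)) δ
  have hdim : Module.finrank ℝ E4 = 4 := by simp
  rw [hdim, abs_of_pos (by positivity), smul_eq_mul] at h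
  have h' : ∫ z : E4, 8 * δ ^ 2 / (‖x + z - x‖ ^ 2 + δ ^ 2) ^ 3 * u (x + z)
      = δ ^ 4 * ∫ z : E4, 8 * δ ^ 2 / (‖x + δ • z - x‖ ^ 2 + δ ^ 2) ^ 3 * u (x + δ • z) := by
    rw [h]; field_simp
  rw [h', ← integral_const_mul]
  congr 1
  ext z
  rw [← mul_assoc]
  congr 1
  rw [add_sub_cancel_left, norm_smul, Real.norm_of_nonneg hδ.le]
  have : (δ * ‖z‖) ^ 2 + δ ^ 2 = δ ^ 2 * (‖z‖ ^ 2 + 1) := by ring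
  rw [this]
  have h2 : ‖z‖ ^ 2 + 1 ≠ 0 := by positivity
  field_simp

lemma rep_limit (u : E4 → ℝ) (hu : ContDiff ℝ (⊤ : ℕ∞) u) (hc : HasCompactSupport u) (x : E4) :
    Filter.Tendsto (fun δ : ℝ => ∫ z : E4, 8 / (‖z‖ ^ 2 + 1) ^ 3 * u (x + δ • z)) (nhdsWithin 0 (Set.Ioi 0))
      (nhds (4 * π ^ 2 * u x)) := by
  rw [← kernel_4d.2, ← integral_mul_const]
  obtain ⟨M, hM⟩ := hc.exists_bound_of_continuous hu.continuous
  have hcu := hu.continuous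
  have hcont : Continuous (fun z : E4 => 8 / (‖z‖ ^ 2 + 1) ^ 3) := by
    apply Continuous.div₀ (by fun_prop) (by fun_prop) (fun y => by positivity)
  apply tendsto_integral_filter_of_dominated_convergence (fun z : E4 => 8 / (‖z‖ ^ 2 + 1) ^ 3 * M)
  · filter_upwards with δ
    exact (hcont.mul (by fun_prop)).aestronglyMeasurable
  · filter_upwards with δ
    filter_upwards with z
    rw [norm_mul, Real.norm_of_nonneg (by positivity)]
    gcongr
    exact hM _
  · exact kernel_4d.1.mul_const M
  · filter_upwards with z
    apply Filter.Tendsto.const_mul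
    have : Continuous (fun δ : ℝ => u (x + δ • z)) := by fun_prop
    have h := this.tendsto 0
    simp only [zero_smul, add_zero] at h
    exact h.mono_left nhdsWithin_le_nhds

lemma lap_cont (u : E4 → ℝ) (hu : ContDiff ℝ (⊤ : ℕ∞) u) : Continuous (lap u) := by
  have hu1 : ContDiff ℝ (⊤ : ℕ∞) (fderiv ℝ u) := hu.fderiv_right (by simp)
  have hu2 : ContDiff ℝ (⊤ : ℕ∞) (fderiv ℝ (fderiv ℝ u)) := hu1.fderiv_right (by simp)
  have hcu2 := hu2.continuous
  have : lap u = fun y => ∑ i, fderiv ℝ (fderiv ℝ u) y (EuclideanSpace.single i 1) (EuclideanSpace.single i 1) := by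
    ext y; exact lap_eq u y
  rw [this]
  fun_prop

lemma pot (u : E4 → ℝ) (hu : ContDiff ℝ (⊤ : ℕ∞) u) (hc : HasCompactSupport u) (x : E4) :
    ENNReal.ofReal (4 * π ^ 2 * |u x|) ≤ ∫⁻ y, ENNReal.ofReal ((‖y - x‖ ^ 2)⁻¹) * ENNReal.ofReal |lap u y| := by
  have hlim := (rep_limit u hu hc x).norm
  rw [Real.norm_eq_abs, abs_mul, abs_of_pos (by positivity : 0 < 4 * π ^ 2)] at hlim
  have hlim2 := (ENNReal.continuous_ofReal.tendsto _).comp hlim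
  refine le_of_tendsto hlim2 ?_
  filter_upwards [self_mem_nhdsWithin] with δ hδ
  have hδ : 0 < δ := hδ
  have h := rep_scaled u hu hc x δ hδ
  simp only [Function.comp_apply]
  rw [← norm_neg, ← h, ofReal_norm]
  refine (enorm_integral_le_lintegral_enorm _).trans ?_
  apply lintegral_mono_ae
  have hae : ∀ᵐ y : E4, y ≠ x := by
    rw [ae_iff]; simp
  filter_upwards [hae] with y hy
  rw [enorm_mul]
  have hp : 0 < ‖y - x‖ := norm_pos_iff.mpr (sub_ne_zero.mpr hy)
  rw [← ofReal_norm, ← ofReal_norm, Real.norm_of_nonneg (by positivity), Real.norm_eq_abs]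
  gcongr
  nlinarith

lemma trunc_1d (R : ℝ) (hR : 0 < R) : IntegrableOn (fun r : ℝ => r ^ 3 • max ((r ^ 2)⁻¹ - (R ^ 2)⁻¹) 0) (Set.Ioi 0) ∧
    ∫ r in Set.Ioi (0:ℝ), r ^ 3 • max ((r ^ 2)⁻¹ - (R ^ 2)⁻¹) 0 = R ^ 2 / 4 := by
  have heq : Set.EqOn (fun r : ℝ => r ^ 3 • max ((r ^ 2)⁻¹ - (R ^ 2)⁻¹) 0)
      ((Set.Ioc 0 R).indicator (fun r => r - r ^ 3 / R ^ 2)) (Set.Ioi 0) := by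
    intro r hr
    have hr : 0 < r := hr
    by_cases h : r ≤ R
    · rw [Set.indicator_of_mem (show r ∈ Set.Ioc 0 R from ⟨hr, h⟩)]
      have : (R ^ 2)⁻¹ ≤ (r ^ 2)⁻¹ := by gcongr
      simp only [smul_eq_mul]
      rw [max_eq_left (by linarith)]
      field_simp
    · rw [Set.indicator_of_notMem (fun h2 => h h2.2)]
      push Not at h
      have : (r ^ 2)⁻¹ ≤ (R ^ 2)⁻¹ := by gcongr
      simp only [smul_eq_mul]
      rw [max_eq_right (by linarith), mul_zero]
  have hcont : Continuous (fun r : ℝ => r - r ^ 3 / R ^ 2) := by fun_prop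
  have hI : IntegrableOn (fun r : ℝ => r - r ^ 3 / R ^ 2) (Set.Ioc 0 R) := 
    (hcont.integrableOn_Icc).mono_set Set.Ioc_subset_Icc_self
  constructor
  · rw [integrableOn_congr_fun heq measurableSet_Ioi]
    exact ((integrable_indicator_iff measurableSet_Ioc).mpr hI).integrableOn
  · rw [setIntegral_congr_fun measurableSet_Ioi heq, setIntegral_indicator measurableSet_Ioc,
      Set.inter_eq_right.mpr Set.Ioc_subset_Ioi_self, ← intervalIntegral.integral_of_le hR.le,
      intervalIntegral.integral_sub (by simp) (by apply Continuous.intervalIntegrable; fun_prop)]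
    simp [intervalIntegral.integral_div]
    field_simp
    norm_num

lemma trunc_4d (x : E4) (R : ℝ) (hR : 0 < R) :
    ∫⁻ y : E4, ENNReal.ofReal (max ((‖y - x‖ ^ 2)⁻¹ - (R ^ 2)⁻¹) 0) = ENNReal.ofReal (π ^ 2 * R ^ 2 / 2) := by
  rw [lintegral_sub_right_eq_self (fun y : E4 => ENNReal.ofReal (max ((‖y‖ ^ 2)⁻¹ - (R ^ 2)⁻¹) 0)) x]
  have hdim : Module.finrank ℝ E4 = 4 := by simp
  have hi : Integrable (fun y : E4 => max ((‖y‖ ^ 2)⁻¹ - (R ^ 2)⁻¹) 0) := by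
    apply (integrable_fun_norm_addHaar (volume : Measure E4) (f := fun r => max ((r ^ 2)⁻¹ - (R ^ 2)⁻¹) 0)).mpr
    rw [hdim]
    exact (trunc_1d R hR).1
  rw [← ofReal_integral_eq_lintegral_ofReal hi (Filter.Eventually.of_forall (fun y => le_max_right _ _))]
  have := integral_fun_norm_addHaar (volume : Measure E4) (fun r => max ((r ^ 2)⁻¹ - (R ^ 2)⁻¹) 0)
  rw [this, hdim, vol_ball4, (trunc_1d R hR).2]
  congr 1
  simp only [nsmul_eq_mul, smul_eq_mul]
  push_cast; ring

lemma bathtub (x : E4) (F : Set E4) (m : ℝ) (hm : 0 ≤ m) (hF : volume F = ENNReal.ofReal m) :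
    ∫⁻ y in F, ENNReal.ofReal ((‖y - x‖ ^ 2)⁻¹) ≤ ENNReal.ofReal (π * √2 * √m) := by
  rcases hm.eq_or_lt with rfl | hm
  · rw [Measure.restrict_eq_zero.mpr (by simpa using hF)]; simp
  have hs : 0 < √(2 * m) := Real.sqrt_pos.mpr (by positivity)
  set R := √(√(2 * m) / π) with hRdef
  have hR : 0 < R := Real.sqrt_pos.mpr (by positivity)
  have hR2 : R ^ 2 = √(2 * m) / π := Real.sq_sqrt (by positivity)
  calc ∫⁻ y in F, ENNReal.ofReal ((‖y - x‖ ^ 2)⁻¹)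
      ≤ ∫⁻ y in F, (ENNReal.ofReal (max ((‖y - x‖ ^ 2)⁻¹ - (R ^ 2)⁻¹) 0) + ENNReal.ofReal ((R ^ 2)⁻¹)) := by
        apply lintegral_mono
        intro y
        dsimp only
        rw [← ENNReal.ofReal_add (le_max_right _ _) (by positivity)]
        apply ENNReal.ofReal_le_ofReal
        linarith [le_max_left ((‖y - x‖ ^ 2)⁻¹ - (R ^ 2)⁻¹) 0]
    _ = (∫⁻ y in F, ENNReal.ofReal (max ((‖y - x‖ ^ 2)⁻¹ - (R ^ 2)⁻¹) 0)) + ENNReal.ofReal ((R ^ 2)⁻¹) * volume F := by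
        rw [lintegral_add_right _ measurable_const, setLIntegral_const]
    _ ≤ ENNReal.ofReal (π ^ 2 * R ^ 2 / 2) + ENNReal.ofReal ((R ^ 2)⁻¹) * ENNReal.ofReal m := by
        rw [hF, ← trunc_4d x R hR]
        gcongr
        exact Measure.restrict_le_self
    _ = ENNReal.ofReal (π * √2 * √m) := by
        rw [← ENNReal.ofReal_mul (by positivity), ← ENNReal.ofReal_add (by positivity) (by positivity)]
        congr 1
        rw [hR2, mul_assoc, ← Real.sqrt_mul (by norm_num)]
        have : √(2 * m) ^ 2 = 2 * m := Real.sq_sqrt (by positivity)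
        field_simp
        rw [this]; ring

/-- distribution function -/
noncomputable def distF (G : E4 → ℝ) (l : ℝ) : ENNReal := volume {y : E4 | l < G y}

/-- decreasing rearrangement -/
noncomputable def rearr (G : E4 → ℝ) (s : ℝ) : ENNReal :=
  volume (Set.Ioi (0:ℝ) ∩ {l | ENNReal.ofReal s < distF G l})

lemma distF_antitone (G : E4 → ℝ) : Antitone (distF G) := by
  intro a b h
  apply measure_mono
  intro y hy
  exact lt_of_le_of_lt h hy

lemma kernel_meas : Measurable (fun p : E4 × E4 => ENNReal.ofReal ((‖p.2 - p.1‖ ^ 2)⁻¹)) := by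
  fun_prop

lemma double_bound (E F : Set E4) (t m T : ℝ) (hT : 0 < T) (htT : T ≤ t)
    (hm : 0 ≤ m) (hE : volume E = ENNReal.ofReal t) (hF : volume F = ENNReal.ofReal m) :
    ∫⁻ x in E, ∫⁻ y in F, ENNReal.ofReal ((‖y - x‖ ^ 2)⁻¹) ≤
      ENNReal.ofReal (π * √2 * t) * ENNReal.ofReal (min (√m) (m / √T)) := by
  have ht : 0 < t := hT.trans_le htT
  have b1 : ∫⁻ x in E, ∫⁻ y in F, ENNReal.ofReal ((‖y - x‖ ^ 2)⁻¹) ≤ ENNReal.ofReal (π * √2 * √m * t) := by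
    calc _ ≤ ∫⁻ x in E, ENNReal.ofReal (π * √2 * √m) := lintegral_mono (fun x => bathtub x F m hm hF)
      _ = _ := by rw [setLIntegral_const, hE, ← ENNReal.ofReal_mul (by positivity)]
  have b2 : ∫⁻ x in E, ∫⁻ y in F, ENNReal.ofReal ((‖y - x‖ ^ 2)⁻¹) ≤ ENNReal.ofReal (π * √2 * √t * m) := by
    rw [lintegral_lintegral_swap (by exact kernel_meas.aemeasurable)]
    calc _ ≤ ∫⁻ x in F, ENNReal.ofReal (π * √2 * √t) := lintegral_mono (fun y => by
            have := bathtub y E t ht.le hE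
            simp_rw [norm_sub_rev _ y] at this
            exact this)
      _ = _ := by rw [setLIntegral_const, hF, ← ENNReal.ofReal_mul (by positivity)]
  rw [← ENNReal.ofReal_mul (by positivity)]
  rcases le_total (√m) (m / √T) with h | h
  · rw [min_eq_left h]; refine b1.trans (ENNReal.ofReal_le_ofReal (le_of_eq (by ring)))
  · rw [min_eq_right h]; refine b2.trans (ENNReal.ofReal_le_ofReal ?_)
    have hTt : √T ≤ √t := Real.sqrt_le_sqrt htT
    have hTp : 0 < √T := Real.sqrt_pos.mpr hT
    have htt : √t * √t = t := Real.mul_self_sqrt ht.le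
    have : √t * m ≤ t * (m / √T) := by
      rw [mul_div_assoc', le_div_iff₀ hTp]
      calc √t * m * √T ≤ √t * m * √t := by gcongr
        _ = (√t * √t) * m := by ring
        _ = t * m := by rw [htt]
    calc π * √2 * √t * m = π * √2 * (√t * m) := by ring
      _ ≤ π * √2 * (t * (m / √T)) := by gcongr
      _ = _ := by ring

lemma layer_id (G : E4 → ℝ) (y : E4) :
    ENNReal.ofReal (G y) = ∫⁻ l in Set.Ioi (0:ℝ), {p : E4 × ℝ | p.2 < G p.1}.indicator 1 (y, l) := by
  have : (fun l : ℝ => ({p : E4 × ℝ | p.2 < G p.1}.indicator 1 (y, l) : ENNReal)) = (Set.Iio (G y)).indicator 1 := by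
    ext l; simp [Set.indicator]
  rw [this, lintegral_indicator_one measurableSet_Iio, Measure.restrict_apply measurableSet_Iio,
    Set.inter_comm, Set.Ioi_inter_Iio, Real.volume_Ioo, sub_zero]

lemma stepA (G : E4 → ℝ) (hG : Continuous G) (E : Set E4) (t T V : ℝ) (hT : 0 < T) (htT : T ≤ t)
    (hE : volume E = ENNReal.ofReal t) (hV : ∀ l, 0 ≤ l → distF G l ≤ ENNReal.ofReal V) :
    ∫⁻ x in E, ∫⁻ y, ENNReal.ofReal ((‖y - x‖ ^ 2)⁻¹) * ENNReal.ofReal (G y) ≤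
    ENNReal.ofReal (π * √2 * t) *
      ∫⁻ l in Set.Ioi (0:ℝ), ENNReal.ofReal (min (√(distF G l).toReal) ((distF G l).toReal / √T)) := by
  have hset : MeasurableSet {p : E4 × ℝ | p.2 < G p.1} := measurableSet_lt (by fun_prop) (by fun_prop)
  have hind : Measurable ({p : E4 × ℝ | p.2 < G p.1}.indicator (1 : E4 × ℝ → ENNReal)) :=
    measurable_one.indicator hset
  have h3 : Measurable (fun q : (E4 × ℝ) × E4 => ENNReal.ofReal ((‖q.2 - q.1.1‖ ^ 2)⁻¹) *
      {p : E4 × ℝ | p.2 < G p.1}.indicator 1 (q.2, q.1.2)) := by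
    apply Measurable.mul (by fun_prop)
    exact hind.comp (by fun_prop : Measurable (fun q : (E4 × ℝ) × E4 => (q.2, q.1.2)))
  have hin : ∀ y, Measurable (fun l : ℝ => ({p : E4 × ℝ | p.2 < G p.1}.indicator 1 (y, l) : ENNReal)) := fun y =>
    hind.comp (by fun_prop : Measurable (fun l : ℝ => (y, l)))
  calc ∫⁻ x in E, ∫⁻ y, ENNReal.ofReal ((‖y - x‖ ^ 2)⁻¹) * ENNReal.ofReal (G y)
      = ∫⁻ x in E, ∫⁻ y, ∫⁻ l in Set.Ioi (0:ℝ), ENNReal.ofReal ((‖y - x‖ ^ 2)⁻¹) * {p : E4 × ℝ | p.2 < G p.1}.indicator 1 (y, l) := by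
        congr 1; ext x; congr 1; ext y
        rw [layer_id, lintegral_const_mul _ (hin y)]
    _ = ∫⁻ x in E, ∫⁻ l in Set.Ioi (0:ℝ), ∫⁻ y, ENNReal.ofReal ((‖y - x‖ ^ 2)⁻¹) * {p : E4 × ℝ | p.2 < G p.1}.indicator 1 (y, l) := by
        congr 1; ext x
        rw [lintegral_lintegral_swap]
        exact (h3.comp (by fun_prop : Measurable (fun q : E4 × ℝ => ((x, q.2), q.1)))).aemeasurable
    _ = ∫⁻ l in Set.Ioi (0:ℝ), ∫⁻ x in E, ∫⁻ y, ENNReal.ofReal ((‖y - x‖ ^ 2)⁻¹) * {p : E4 × ℝ | p.2 < G p.1}.indicator 1 (y, l) := by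
        rw [lintegral_lintegral_swap]
        exact (Measurable.lintegral_prod_right' h3).aemeasurable
    _ ≤ ∫⁻ l in Set.Ioi (0:ℝ), ENNReal.ofReal (π * √2 * t) * ENNReal.ofReal (min (√(distF G l).toReal) ((distF G l).toReal / √T)) := by
        apply setLIntegral_mono' measurableSet_Ioi
        intro l hl
        have hl : 0 < l := hl
        have hfin : distF G l ≠ ⊤ := ((hV l hl.le).trans_lt ENNReal.ofReal_lt_top).ne
        have hms : MeasurableSet {y : E4 | l < G y} := measurableSet_lt (by fun_prop) (by fun_prop)
        have heq : ∀ x : E4, ∫⁻ y, ENNReal.ofReal ((‖y - x‖ ^ 2)⁻¹) * {p : E4 × ℝ | p.2 < G p.1}.indicator 1 (y, l)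
            = ∫⁻ y in {y : E4 | l < G y}, ENNReal.ofReal ((‖y - x‖ ^ 2)⁻¹) := by
          intro x
          rw [← lintegral_indicator hms]
          congr 1; ext y
          by_cases h : l < G y <;> simp [h]
        simp_rw [heq]
        exact double_bound E _ t _ T hT htT ENNReal.toReal_nonneg hE (ENNReal.ofReal_toReal hfin).symm
    _ = _ := by
        rw [lintegral_const_mul]
        have : Measurable (distF G) := (distF_antitone G).measurable
        fun_prop

/-- weight -/
noncomputable def wgt (T s : ℝ) : ℝ := if s ≤ T then 1 / √T else 1 / (2 * √s)

lemma wgt_meas (T : ℝ) : Measurable (wgt T) := by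
  unfold wgt
  exact Measurable.ite measurableSet_Iic (by fun_prop) (by fun_prop)

lemma stepB (T m : ℝ) (hT : 0 < T) (_hm : 0 ≤ m) :
    ENNReal.ofReal (min (√m) (m / √T)) ≤ ∫⁻ s in Set.Ioo 0 m, ENNReal.ofReal (wgt T s) := by
  rcases le_or_gt m T with h | h
  · have : ∫⁻ s in Set.Ioo 0 m, ENNReal.ofReal (wgt T s) = ∫⁻ s in Set.Ioo 0 m, ENNReal.ofReal (1 / √T) := by
      apply setLIntegral_congr_fun measurableSet_Ioo
      intro s hs
      simp [wgt, (hs.2.trans_le h).le]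
    rw [this, setLIntegral_const, Real.volume_Ioo, ← ENNReal.ofReal_mul (by positivity)]
    apply ENNReal.ofReal_le_ofReal
    refine (min_le_right _ _).trans (le_of_eq ?_)
    ring
  · have e1 : ∫⁻ s in Set.Ioc 0 T, ENNReal.ofReal (wgt T s) = ENNReal.ofReal (√T) := by
      have : ∫⁻ s in Set.Ioc 0 T, ENNReal.ofReal (wgt T s) = ∫⁻ s in Set.Ioc 0 T, ENNReal.ofReal (1 / √T) := by
        apply setLIntegral_congr_fun measurableSet_Ioc
        intro s hs
        simp [wgt, hs.2]
      rw [this, setLIntegral_const, Real.volume_Ioc, ← ENNReal.ofReal_mul (by positivity)]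
      congr 1
      rw [sub_zero, div_mul_eq_mul_div, one_mul, Real.div_sqrt]
    have e2 : ∫⁻ s in Set.Ioo T m, ENNReal.ofReal (wgt T s) = ENNReal.ofReal (√m - √T) := by
      have : ∫⁻ s in Set.Ioo T m, ENNReal.ofReal (wgt T s) = ∫⁻ s in Set.Ioc T m, ENNReal.ofReal (1 / (2 * √s)) := by
        rw [restrict_Ioo_eq_restrict_Ioc]
        apply setLIntegral_congr_fun measurableSet_Ioc
        intro s hs
        simp [wgt, not_le.mpr hs.1]
      have hcont : ContinuousOn (fun s : ℝ => 1 / (2 * √s)) (Set.Icc T m) := by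
        apply ContinuousOn.div₀ (by fun_prop) (by fun_prop)
        intro s hs
        have : 0 < √s := Real.sqrt_pos.mpr (hT.trans_le hs.1)
        positivity
      have hi : IntegrableOn (fun s : ℝ => 1 / (2 * √s)) (Set.Ioc T m) :=
        (hcont.integrableOn_Icc).mono_set Set.Ioc_subset_Icc_self
      rw [this, ← ofReal_integral_eq_lintegral_ofReal hi (Filter.Eventually.of_forall (fun s => by positivity)),
        ← intervalIntegral.integral_of_le h.le]
      congr 1
      apply intervalIntegral.integral_eq_sub_of_hasDerivAt
      · intro s hs
        rw [Set.uIcc_of_le h.le] at hs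
        exact Real.hasDerivAt_sqrt (hT.trans_le hs.1).ne'
      · rw [intervalIntegrable_iff_integrableOn_Ioc_of_le h.le]; exact hi
    have hu : Set.Ioo 0 m = Set.Ioc 0 T ∪ Set.Ioo T m := (Set.Ioc_union_Ioo_eq_Ioo hT.le h).symm
    rw [hu, lintegral_union measurableSet_Ioo, e1, e2, ← ENNReal.ofReal_add (by positivity) (sub_nonneg.mpr (Real.sqrt_le_sqrt h.le))]
    · apply ENNReal.ofReal_le_ofReal
      refine (min_le_left _ _).trans (le_of_eq (by ring))
    · rw [Set.disjoint_left]
      intro s hs hs2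
      exact absurd hs.2 (not_le.mpr hs2.1)

lemma rearr_set_meas (G : E4 → ℝ) : MeasurableSet {p : ℝ × ℝ | ENNReal.ofReal p.1 < distF G p.2} := by
  have : Measurable (distF G) := (distF_antitone G).measurable
  exact measurableSet_lt (by fun_prop) (by fun_prop)

lemma rearr_eq (G : E4 → ℝ) (s : ℝ) : 
    rearr G s = ∫⁻ l in Set.Ioi (0:ℝ), {p : ℝ × ℝ | ENNReal.ofReal p.1 < distF G p.2}.indicator 1 (s, l) := by
  have h : (fun l : ℝ => ({p : ℝ × ℝ | ENNReal.ofReal p.1 < distF G p.2}.indicator 1 (s, l) : ENNReal)) 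
     = {l | ENNReal.ofReal s < distF G l}.indicator 1 := by
    ext l; simp [Set.indicator]
  have hm : MeasurableSet {l | ENNReal.ofReal s < distF G l} := by
    have : Measurable (distF G) := (distF_antitone G).measurable
    exact measurableSet_lt (by fun_prop) (by fun_prop)
  rw [h, lintegral_indicator_one hm, Measure.restrict_apply hm, Set.inter_comm, rearr]

lemma rearr_meas (G : E4 → ℝ) : Measurable (rearr G) := by
  have : rearr G = fun s => ∫⁻ l in Set.Ioi (0:ℝ), {p : ℝ × ℝ | ENNReal.ofReal p.1 < distF G p.2}.indicator 1 (s, l) := by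
    ext s; exact rearr_eq G s
  rw [this]
  exact (measurable_one.indicator (rearr_set_meas G)).lintegral_prod_right'

lemma stepC (G : E4 → ℝ) (T V : ℝ) (hT : 0 < T)
    (hV : ∀ l, 0 ≤ l → distF G l ≤ ENNReal.ofReal V) :
    ∫⁻ l in Set.Ioi (0:ℝ), ENNReal.ofReal (min (√(distF G l).toReal) ((distF G l).toReal / √T)) ≤
      ∫⁻ s in Set.Ioc 0 V, ENNReal.ofReal (wgt T s) * rearr G s := by
  have hw := wgt_meas T
  have hind : Measurable ({p : ℝ × ℝ | ENNReal.ofReal p.1 < distF G p.2}.indicator (1 : ℝ × ℝ → ENNReal)) :=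
    measurable_one.indicator (rearr_set_meas G)
  calc ∫⁻ l in Set.Ioi (0:ℝ), ENNReal.ofReal (min (√(distF G l).toReal) ((distF G l).toReal / √T))
      ≤ ∫⁻ l in Set.Ioi (0:ℝ), ∫⁻ s in Set.Ioc 0 V, ENNReal.ofReal (wgt T s) *
          {p : ℝ × ℝ | ENNReal.ofReal p.1 < distF G p.2}.indicator 1 (s, l) := by
        apply setLIntegral_mono' measurableSet_Ioi
        intro l hl
        have hl : 0 < l := hl
        refine (stepB T _ hT ENNReal.toReal_nonneg).trans ?_
        rw [← lintegral_indicator measurableSet_Ioo, ← lintegral_indicator measurableSet_Ioc]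
        apply lintegral_mono
        intro s
        by_cases hs : s ∈ Set.Ioo 0 (distF G l).toReal
        · have hfin : distF G l ≠ ⊤ := ((hV l hl.le).trans_lt ENNReal.ofReal_lt_top).ne
          have h1 : ENNReal.ofReal s < distF G l := (ENNReal.ofReal_lt_iff_lt_toReal hs.1.le hfin).mpr hs.2
          have h2 : s ∈ Set.Ioc 0 V := by
            refine ⟨hs.1, ?_⟩
            have h3 := h1.trans_le (hV l hl.le)
            exact ((ENNReal.ofReal_lt_ofReal_iff_of_nonneg hs.1.le).mp h3).le
          simp [hs, h2, h1]
        · simp [hs]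
    _ = ∫⁻ s in Set.Ioc 0 V, ∫⁻ l in Set.Ioi (0:ℝ), ENNReal.ofReal (wgt T s) *
          {p : ℝ × ℝ | ENNReal.ofReal p.1 < distF G p.2}.indicator 1 (s, l) := by
        rw [lintegral_lintegral_swap]
        apply Measurable.aemeasurable
        apply Measurable.mul (by fun_prop)
        exact hind.comp (by fun_prop : Measurable (fun q : ℝ × ℝ => (q.2, q.1)))
    _ = ∫⁻ s in Set.Ioc 0 V, ENNReal.ofReal (wgt T s) * rearr G s := by
        congr 1; ext s
        rw [rearr_eq, lintegral_const_mul]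
        exact hind.comp (by fun_prop : Measurable (fun l : ℝ => (s, l)))

lemma rearr_le (G : E4 → ℝ) (M : ℝ) (hM : ∀ y, G y ≤ M) (s : ℝ) : rearr G s ≤ ENNReal.ofReal M := by
  have : Set.Ioi (0:ℝ) ∩ {l | ENNReal.ofReal s < distF G l} ⊆ Set.Ioo 0 M := by
    rintro l ⟨h0, hl⟩
    refine ⟨h0, ?_⟩
    by_contra hc
    push Not at hc
    have : {y : E4 | l < G y} = ∅ := by
      ext y; simp only [Set.mem_ofPred_eq, Set.mem_empty_iff_false, iff_false, not_lt]
      exact (hM y).trans hc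
    simp [distF, this] at hl
  refine (measure_mono this).trans ?_
  simp

lemma stepD (G : E4 → ℝ) (hG : Continuous G) (hG0 : ∀ y, 0 ≤ G y) (M : ℝ) (hM : ∀ y, G y ≤ M) (V : ℝ) :
    ∫⁻ s in Set.Ioc 0 V, rearr G s ^ 2 ≤ ∫⁻ y, ENNReal.ofReal (G y ^ 2) := by
  have hfin : ∀ s, rearr G s ≠ ⊤ := fun s => ((rearr_le G M hM s).trans_lt ENNReal.ofReal_lt_top).ne
  have hrm := rearr_meas G
  have e1 : ∀ s, rearr G s ^ 2 = ENNReal.ofReal ((rearr G s).toReal ^ (2:ℝ)) := by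
    intro s
    rw [Real.rpow_two, ENNReal.ofReal_pow ENNReal.toReal_nonneg, ENNReal.ofReal_toReal (hfin s)]
  have e2 : ∀ y, ENNReal.ofReal (G y ^ 2) = ENNReal.ofReal (G y ^ (2:ℝ)) := by
    intro y; rw [Real.rpow_two]
  simp_rw [e1, e2]
  rw [lintegral_rpow_eq_lintegral_meas_lt_mul _ (Filter.Eventually.of_forall (fun s => ENNReal.toReal_nonneg)) (by fun_prop) two_pos,
    lintegral_rpow_eq_lintegral_meas_lt_mul _ (Filter.Eventually.of_forall hG0) (by fun_prop) two_pos]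
  refine mul_le_mul' le_rfl ?_
  apply setLIntegral_mono' measurableSet_Ioi
  intro l hl
  have hl : 0 < l := hl
  refine mul_le_mul' ?_ le_rfl
  have hms : MeasurableSet {a | l < (rearr G a).toReal} := measurableSet_lt (by fun_prop) (by fun_prop)
  rw [Measure.restrict_apply hms]
  change _ ≤ distF G l
  by_cases htop : distF G l = ⊤
  · rw [htop]; exact le_top
  have hsub : {a | l < (rearr G a).toReal} ∩ Set.Ioc 0 V ⊆ Set.Ioo 0 (distF G l).toReal := by
    rintro s ⟨hs, hs2⟩
    refine ⟨hs2.1, ?_⟩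
    by_contra hc
    push Not at hc
    have hd : distF G l ≤ ENNReal.ofReal s := by
      rw [← ENNReal.ofReal_toReal htop]; exact ENNReal.ofReal_le_ofReal hc
    have : Set.Ioi (0:ℝ) ∩ {l | ENNReal.ofReal s < distF G l} ⊆ Set.Ioo 0 l := by
      rintro l' ⟨h0, hl'⟩
      refine ⟨h0, ?_⟩
      by_contra hc2
      push Not at hc2
      exact absurd (lt_of_lt_of_le hl' ((distF_antitone G hc2).trans hd)) (lt_irrefl _)
    have h5 : rearr G s ≤ ENNReal.ofReal l := by
      refine (measure_mono this).trans ?_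
      simp
    have h6 : (rearr G s).toReal ≤ l := ENNReal.toReal_le_of_le_ofReal hl.le h5
    exact absurd hs (not_lt.mpr h6)
  refine (measure_mono hsub).trans ?_
  rw [Real.volume_Ioo, sub_zero, ENNReal.ofReal_toReal htop]

lemma cs_piece (G : E4 → ℝ) (A : Set ℝ) (w : ℝ → ℝ) (hw : Measurable w) (c : ℝ) (hc : 0 ≤ c)
    (h : ∫⁻ s in A, ENNReal.ofReal (w s) ^ 2 ≤ ENNReal.ofReal (c ^ 2))
    (hJ : ∫⁻ s in A, rearr G s ^ 2 ≠ ⊤) :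
    ∫⁻ s in A, ENNReal.ofReal (w s) * rearr G s ≤ ENNReal.ofReal (c * √(∫⁻ s in A, rearr G s ^ 2).toReal) := by
  have hrm := rearr_meas G
  have := ENNReal.lintegral_mul_le_Lp_mul_Lq (volume.restrict A) Real.HolderConjugate.two_two
    (f := fun s => ENNReal.ofReal (w s)) (g := rearr G) (by fun_prop) (by fun_prop)
  simp only [Pi.mul_apply, ENNReal.rpow_two] at this
  refine this.trans ?_
  rw [ENNReal.ofReal_mul hc]
  gcongr ?_ * ?_
  · calc _ ≤ (ENNReal.ofReal (c ^ 2)) ^ (1 / 2 : ℝ) := by gcongr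
      _ = ENNReal.ofReal c := by
        rw [ENNReal.ofReal_rpow_of_nonneg (by positivity) (by norm_num), ← Real.sqrt_eq_rpow, Real.sqrt_sq hc]
  · rw [Real.sqrt_eq_rpow, ← ENNReal.ofReal_rpow_of_nonneg ENNReal.toReal_nonneg (by norm_num), ENNReal.ofReal_toReal hJ]

/-- geometric scale -/
noncomputable def scl (V : ℝ) (k : ℕ) : ℝ := V * Real.exp (-k)

/-- block norm -/
noncomputable def aSeq (G : E4 → ℝ) (V : ℝ) (k : ℕ) : ℝ :=
  √(∫⁻ s in Set.Ioc (scl V (k+1)) (scl V k), rearr G s ^ 2).toReal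

/-- tail norm -/
noncomputable def LSeq (G : E4 → ℝ) (V : ℝ) (k : ℕ) : ℝ :=
  √(∫⁻ s in Set.Ioc 0 (scl V k), rearr G s ^ 2).toReal

lemma scl_pos (V : ℝ) (hV : 0 < V) (k : ℕ) : 0 < scl V k := by unfold scl; positivity

lemma scl_succ_le (V : ℝ) (hV : 0 < V) (k : ℕ) : scl V (k+1) ≤ scl V k := by
  unfold scl
  gcongr
  simp

lemma scl_le (V : ℝ) (hV : 0 < V) (k : ℕ) : scl V k ≤ V := by
  unfold scl
  have : Real.exp (-k) ≤ 1 := by simp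
  nlinarith

lemma scl_zero (V : ℝ) : scl V 0 = V := by simp [scl]

lemma stepE_L (G : E4 → ℝ) (V : ℝ) (hV : 0 < V) (hJ : ∫⁻ s in Set.Ioc 0 V, rearr G s ^ 2 ≤ 1) (k : ℕ) :
    LSeq G V k ^ 2 = LSeq G V (k+1) ^ 2 + aSeq G V k ^ 2 := by
  unfold LSeq aSeq
  have h0 := scl_pos V hV (k+1)
  have h1 := scl_succ_le V hV k
  have h2 := scl_le V hV k
  have f1 : ∫⁻ s in Set.Ioc 0 (scl V (k+1)), rearr G s ^ 2 ≠ ⊤ :=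
    (((lintegral_mono_set (Set.Ioc_subset_Ioc_right (h1.trans h2))).trans hJ).trans_lt ENNReal.one_lt_top).ne
  have f2 : ∫⁻ s in Set.Ioc (scl V (k+1)) (scl V k), rearr G s ^ 2 ≠ ⊤ :=
    (((lintegral_mono_set (Set.Ioc_subset_Ioc h0.le h2)).trans hJ).trans_lt ENNReal.one_lt_top).ne
  rw [Real.sq_sqrt ENNReal.toReal_nonneg, Real.sq_sqrt ENNReal.toReal_nonneg, Real.sq_sqrt ENNReal.toReal_nonneg,
    ← ENNReal.toReal_add f1 f2, ← lintegral_union measurableSet_Ioc (Set.Ioc_disjoint_Ioc_of_le le_rfl), Set.Ioc_union_Ioc_eq_Ioc h0.le h1]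

lemma tail_sum (G : E4 → ℝ) (V : ℝ) (hV : 0 < V) (hJ : ∫⁻ s in Set.Ioc 0 V, rearr G s ^ 2 ≤ 1) (k : ℕ) :
    ∫⁻ s in Set.Ioc (scl V k) V, ENNReal.ofReal (1 / (2 * √s)) * rearr G s ≤
      ENNReal.ofReal (1 / 2 * ∑ j ∈ Finset.range k, aSeq G V j) := by
  induction k with
  | zero => simp [scl_zero]
  | succ k ih =>
    have h0 := scl_pos V hV (k+1)
    have h1 := scl_succ_le V hV k
    have h2 := scl_le V hV k
    have ha : 0 ≤ aSeq G V k := Real.sqrt_nonneg _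
    have hs : 0 ≤ ∑ j ∈ Finset.range k, aSeq G V j := Finset.sum_nonneg (fun i _ => Real.sqrt_nonneg _)
    rw [← Set.Ioc_union_Ioc_eq_Ioc h1 h2, lintegral_union measurableSet_Ioc (Set.Ioc_disjoint_Ioc_of_le le_rfl),
      Finset.sum_range_succ, mul_add,
      ENNReal.ofReal_add (mul_nonneg (by norm_num) hs) (mul_nonneg (by norm_num) ha),
      add_comm (ENNReal.ofReal (1 / 2 * ∑ j ∈ Finset.range k, aSeq G V j))]
    refine add_le_add ?_ ih
    apply cs_piece G _ _ (by fun_prop) _ (by norm_num)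
    · have hcont : ContinuousOn (fun s : ℝ => (1/4) * s⁻¹) (Set.Icc (scl V (k+1)) (scl V k)) := by
        apply ContinuousOn.mul (by fun_prop)
        apply ContinuousOn.inv₀ (by fun_prop)
        intro s hs
        exact (h0.trans_le hs.1).ne'
      have hi : IntegrableOn (fun s : ℝ => (1/4) * s⁻¹) (Set.Ioc (scl V (k+1)) (scl V k)) :=
        (hcont.integrableOn_Icc).mono_set Set.Ioc_subset_Icc_self
      have he : ∫⁻ s in Set.Ioc (scl V (k+1)) (scl V k), ENNReal.ofReal (1 / (2 * √s)) ^ 2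
          = ∫⁻ s in Set.Ioc (scl V (k+1)) (scl V k), ENNReal.ofReal ((1/4) * s⁻¹) := by
        apply setLIntegral_congr_fun measurableSet_Ioc
        intro s hs
        have hs0 : 0 < s := h0.trans hs.1
        simp only
        rw [← ENNReal.ofReal_pow (by positivity)]
        congr 1
        rw [div_pow, mul_pow, Real.sq_sqrt hs0.le]
        field_simp
        norm_num
      rw [he, ← ofReal_integral_eq_lintegral_ofReal hi, ← intervalIntegral.integral_of_le h1,
        intervalIntegral.integral_const_mul, integral_inv_of_pos h0 (scl_pos V hV k)]
      · apply ENNReal.ofReal_le_ofReal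
        have : scl V k / scl V (k+1) = Real.exp 1 := by
          unfold scl
          rw [mul_div_mul_left _ _ hV.ne', ← Real.exp_sub]
          congr 1; push_cast; ring
        rw [this, Real.log_exp]; norm_num
      · filter_upwards [ae_restrict_mem measurableSet_Ioc] with s hs
        have hs0 : 0 < s := h0.trans hs.1
        simp only [Pi.zero_apply]
        positivity
    · exact (((lintegral_mono_set (Set.Ioc_subset_Ioc h0.le h2)).trans hJ).trans_lt ENNReal.one_lt_top).ne

lemma stepE (G : E4 → ℝ) (V : ℝ) (hV : 0 < V) (hJ : ∫⁻ s in Set.Ioc 0 V, rearr G s ^ 2 ≤ 1) (k : ℕ) :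
    ∫⁻ s in Set.Ioc 0 V, ENNReal.ofReal (wgt (scl V k) s) * rearr G s ≤
      ENNReal.ofReal (LSeq G V k + 1 / 2 * ∑ j ∈ Finset.range k, aSeq G V j) := by
  have h0 := scl_pos V hV k
  have h2 := scl_le V hV k
  have ha : 0 ≤ LSeq G V k := Real.sqrt_nonneg _
  have hs : 0 ≤ ∑ j ∈ Finset.range k, aSeq G V j := Finset.sum_nonneg (fun i _ => Real.sqrt_nonneg _)
  rw [← Set.Ioc_union_Ioc_eq_Ioc h0.le h2, lintegral_union measurableSet_Ioc (Set.Ioc_disjoint_Ioc_of_le le_rfl),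
    ENNReal.ofReal_add (by positivity) (by positivity)]
  gcongr ?_ + ?_
  · rw [← one_mul (LSeq G V k)]
    apply cs_piece G _ _ (wgt_meas _) _ (by norm_num)
    · have : ∫⁻ s in Set.Ioc 0 (scl V k), ENNReal.ofReal (wgt (scl V k) s) ^ 2 = ∫⁻ s in Set.Ioc 0 (scl V k), ENNReal.ofReal ((scl V k)⁻¹) := by
        apply setLIntegral_congr_fun measurableSet_Ioc
        intro s hs
        simp only [wgt, hs.2, if_true]
        rw [← ENNReal.ofReal_pow (by positivity), div_pow, Real.sq_sqrt h0.le]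
        simp
      rw [this, setLIntegral_const, Real.volume_Ioc, ← ENNReal.ofReal_mul (by positivity), sub_zero, inv_mul_cancel₀ h0.ne']
      norm_num
    · exact (((lintegral_mono_set (Set.Ioc_subset_Ioc_right h2)).trans hJ).trans_lt ENNReal.one_lt_top).ne
  · refine le_trans (le_of_eq ?_) (tail_sum G V hV hJ k)
    apply setLIntegral_congr_fun measurableSet_Ioc
    intro s hs
    simp [wgt, not_le.mpr hs.1]

lemma lap_zero (u : E4 → ℝ) (y : E4) (hy : y ∉ tsupport u) : lap u y = 0 := by
  have : iteratedFDeriv ℝ 2 u y = 0 := by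
    by_contra h
    exact hy (support_iteratedFDeriv_subset 2 h)
  simp [lap, this]

lemma level_bound (Ω : Set E4) (u : E4 → ℝ) (hu : ContDiff ℝ (⊤ : ℕ∞) u)
    (hc : HasCompactSupport u) (hsub : tsupport u ⊆ Ω) (V : ℝ) (hV : 0 < V) (hΩ : volume Ω = ENNReal.ofReal V)
    (hJ : ∫⁻ s in Set.Ioc 0 V, rearr (fun y => |lap u y|) s ^ 2 ≤ 1) (k : ℕ) :
    volume {x : E4 | π * √2 / 2 * (∑ j ∈ Finset.range k, aSeq (fun y => |lap u y|) V j + 2 * LSeq (fun y => |lap u y|) V k)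
      < 4 * π ^ 2 * |u x|} ≤ ENNReal.ofReal (scl V k) := by
  set G : E4 → ℝ := fun y => |lap u y| with hGdef
  have hG : Continuous G := (lap_cont u hu).abs
  set S := ∑ j ∈ Finset.range k, aSeq G V j
  set L := LSeq G V k
  have hL : 0 ≤ L := Real.sqrt_nonneg _
  have hS : 0 ≤ S := Finset.sum_nonneg (fun i _ => Real.sqrt_nonneg _)
  set E := {x : E4 | π * √2 / 2 * (S + 2 * L) < 4 * π ^ 2 * |u x|} with hE
  have hcu := hu.continuous
  by_contra hcon
  push Not at hcon
  have hEΩ : E ⊆ Ω := by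
    intro x hx
    apply hsub
    by_contra hxs
    have h0 : u x = 0 := image_eq_zero_of_notMem_tsupport hxs
    have hx' : π * √2 / 2 * (S + 2 * L) < 4 * π ^ 2 * |u x| := hx
    rw [h0] at hx'
    simp only [abs_zero, mul_zero] at hx'
    have : 0 ≤ π * √2 / 2 * (S + 2 * L) := by positivity
    linarith
  have hEfin : volume E ≠ ⊤ := ((measure_mono hEΩ).trans_lt (hΩ ▸ ENNReal.ofReal_lt_top)).ne
  have hE0 : volume E ≠ 0 := ((zero_le).trans_lt hcon).ne'
  have hT := scl_pos V hV k
  have htT : scl V k ≤ (volume E).toReal := ((ENNReal.ofReal_lt_iff_lt_toReal hT.le hEfin).mp hcon).le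
  have hdist : ∀ l, 0 ≤ l → distF G l ≤ ENNReal.ofReal V := by
    intro l hl
    rw [← hΩ]
    apply measure_mono
    intro y hy
    apply hsub
    by_contra hys
    have hy' : l < |lap u y| := hy
    rw [lap_zero u y hys, abs_zero] at hy'
    linarith
  have hint : ∫⁻ x in E, ENNReal.ofReal (4 * π ^ 2 * |u x|) ≤ ENNReal.ofReal (π * √2 / 2 * (S + 2 * L)) * volume E := by
    calc ∫⁻ x in E, ENNReal.ofReal (4 * π ^ 2 * |u x|)
        ≤ ∫⁻ x in E, ∫⁻ y, ENNReal.ofReal ((‖y - x‖ ^ 2)⁻¹) * ENNReal.ofReal (G y) :=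
          lintegral_mono (fun x => pot u hu hc x)
      _ ≤ _ := stepA G hG E _ (scl V k) V hT htT (ENNReal.ofReal_toReal hEfin).symm hdist
      _ ≤ ENNReal.ofReal (π * √2 * (volume E).toReal) * ENNReal.ofReal (L + 1 / 2 * S) :=
          mul_le_mul' le_rfl ((stepC G (scl V k) V hT hdist).trans (stepE G V hV hJ k))
      _ = ENNReal.ofReal (π * √2 / 2 * (S + 2 * L)) * ENNReal.ofReal (volume E).toReal := by
          rw [← ENNReal.ofReal_mul (by positivity), ← ENNReal.ofReal_mul (by positivity)]
          congr 1; ring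
      _ = _ := by rw [ENNReal.ofReal_toReal hEfin]
  obtain ⟨x, hxE, hx⟩ := exists_le_setLAverage hE0 hEfin
    (f := fun x => ENNReal.ofReal (4 * π ^ 2 * |u x|)) (by fun_prop)
  rw [setLAverage_eq] at hx
  have h2 := hx.trans (ENNReal.div_le_of_le_mul hint)
  have h3 := (ENNReal.ofReal_le_ofReal_iff (by positivity)).mp h2
  exact absurd hxE (not_lt.mpr h3)

lemma final_lint (Ω : Set E4) (hΩo : IsOpen Ω) (u : E4 → ℝ) (hu : ContDiff ℝ (⊤ : ℕ∞) u)
    (P : ℕ → ℝ) (hP : ∀ k, 0 ≤ P k) (V : ℝ) (hV : 0 < V) (hΩ : volume Ω = ENNReal.ofReal V)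
    (hlev : ∀ k, volume {x : E4 | π * √2 / 2 * P k < 4 * π ^ 2 * |u x|} ≤ ENNReal.ofReal (scl V k)) :
    ∫⁻ x in Ω, ENNReal.ofReal (Real.exp (32 * π ^ 2 * (u x) ^ 2)) ≤
      ENNReal.ofReal (V * Real.exp 1) * ∑' k : ℕ, ENNReal.ofReal (Real.exp (P k ^ 2 - k)) := by
  classical
  have hcu := hu.continuous
  set E : ℕ → Set E4 := fun k => {x : E4 | π * √2 / 2 * P k < 4 * π ^ 2 * |u x|} with hE
  have hEm : ∀ k, MeasurableSet (E k) := fun k => measurableSet_lt (by fun_prop) (by fun_prop)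
  set A : ℕ → Set E4 := fun k => Nat.casesOn k Ω E with hA
  have hA0 : A 0 = Ω := rfl
  have hA1 : ∀ k, A (k+1) = E k := fun k => rfl
  have hAm : ∀ k, MeasurableSet (A k) := by
    intro k
    cases k with
    | zero => exact hΩo.measurableSet
    | succ k => exact hEm k
  have hAv : ∀ k, volume (A k) ≤ ENNReal.ofReal (V * Real.exp 1 * Real.exp (-k)) := by
    intro k
    cases k with
    | zero =>
      rw [hA0, hΩ]
      apply ENNReal.ofReal_le_ofReal
      have : 1 ≤ Real.exp 1 := Real.one_le_exp (by norm_num)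
      simp
      nlinarith
    | succ k =>
      rw [hA1]
      refine (hlev k).trans (ENNReal.ofReal_le_ofReal (le_of_eq ?_))
      rw [scl, mul_assoc, ← Real.exp_add]
      congr 2; push_cast; ring
  have hnull : volume (⋂ k, E k) = 0 := by
    have hl : Filter.Tendsto (fun k : ℕ => ENNReal.ofReal (scl V k)) Filter.atTop (nhds 0) := by
      rw [← ENNReal.ofReal_zero]
      apply ENNReal.tendsto_ofReal
      have h1 : Filter.Tendsto (fun k : ℕ => Real.exp (-(k:ℝ))) Filter.atTop (nhds 0) :=
        Real.tendsto_exp_neg_atTop_nhds_zero.comp tendsto_natCast_atTop_atTop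
      have h2 := h1.const_mul V
      rw [mul_zero] at h2
      exact h2
    refine le_antisymm (ge_of_tendsto' hl (fun k => ?_)) (zero_le)
    exact (measure_mono (Set.iInter_subset E k)).trans (hlev k)
  have hae : ∀ᵐ x : E4, x ∉ ⋂ k, E k := measure_eq_zero_iff_ae_notMem.mp hnull
  calc ∫⁻ x in Ω, ENNReal.ofReal (Real.exp (32 * π ^ 2 * (u x) ^ 2))
      ≤ ∫⁻ x in Ω, ∑' k : ℕ, ENNReal.ofReal (Real.exp (P k ^ 2)) * (A k).indicator 1 x := by
        apply lintegral_mono_ae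
        filter_upwards [ae_restrict_of_ae hae, ae_restrict_mem hΩo.measurableSet] with x hx hxΩ
        have hex : ∃ k, x ∉ E k := by simpa using hx
        have hk := Nat.find_spec hex
        set k := Nat.find hex with hkdef
        refine le_trans ?_ (ENNReal.le_tsum k)
        have hxA : x ∈ A k := by
          rcases hkk : k with _ | j
          · exact hxΩ
          · rw [hA1]
            by_contra hcc
            have := Nat.find_min' hex hcc
            omega
        rw [Set.indicator_of_mem hxA]
        simp only [Pi.one_apply, mul_one]
        apply ENNReal.ofReal_le_ofReal
        apply Real.exp_le_exp.mpr
        have h1 : 4 * π ^ 2 * |u x| ≤ π * √2 / 2 * P k := not_lt.mp hk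
        have h2 : (4 * π ^ 2 * |u x|) ^ 2 ≤ (π * √2 / 2 * P k) ^ 2 := by gcongr
        have h3 : √2 ^ 2 = (2:ℝ) := Real.sq_sqrt (by norm_num)
        have h4 : (π * √2 / 2 * P k) ^ 2 = π ^ 2 / 2 * P k ^ 2 := by
          rw [mul_pow, div_pow, mul_pow, h3]; ring
        have h5 : (4 * π ^ 2 * |u x|) ^ 2 = π ^ 2 / 2 * (32 * π ^ 2 * u x ^ 2) := by
          rw [mul_pow, sq_abs]; ring
        rw [h4, h5] at h2
        exact le_of_mul_le_mul_left h2 (by positivity)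
    _ = ∑' k : ℕ, ∫⁻ x in Ω, ENNReal.ofReal (Real.exp (P k ^ 2)) * (A k).indicator 1 x := by
        rw [lintegral_tsum]
        intro k
        exact ((measurable_one.indicator (hAm k)).const_mul _).aemeasurable
    _ ≤ ∑' k : ℕ, ENNReal.ofReal (V * Real.exp 1) * ENNReal.ofReal (Real.exp (P k ^ 2 - k)) := by
        apply ENNReal.tsum_le_tsum
        intro k
        rw [lintegral_const_mul _ (measurable_one.indicator (hAm k)), lintegral_indicator_one (hAm k)]
        calc _ ≤ ENNReal.ofReal (Real.exp (P k ^ 2)) * ENNReal.ofReal (V * Real.exp 1 * Real.exp (-k)) :=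
              mul_le_mul' le_rfl ((Measure.restrict_apply_le _ _).trans (hAv k))
          _ = _ := by
            rw [← ENNReal.ofReal_mul (by positivity), ← ENNReal.ofReal_mul (by positivity), sub_eq_add_neg, Real.exp_add]
            congr 1; ring
    _ = _ := ENNReal.tsum_mul_left

lemma lap_lint (Ω : Set E4) (u : E4 → ℝ) (hu : ContDiff ℝ (⊤ : ℕ∞) u)
    (hc : HasCompactSupport u) (hsub : tsupport u ⊆ Ω) (hint : (∫ x in Ω, (lap u x) ^ 2) ≤ 1) :
    ∫⁻ y, ENNReal.ofReal (|lap u y| ^ 2) ≤ 1 := by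
  have hlc := lap_cont u hu
  have hlcs : HasCompactSupport (lap u) := HasCompactSupport.intro hc (fun y hy => lap_zero u y hy)
  have hcs2 : HasCompactSupport (fun y => lap u y ^ 2) :=
    HasCompactSupport.intro hc (fun y hy => by simp only [lap_zero u y hy]; norm_num)
  have hi : Integrable (fun y => lap u y ^ 2) :=
    Continuous.integrable_of_hasCompactSupport (hlc.pow 2) hcs2
  have hset : ∫ x in Ω, lap u x ^ 2 = ∫ x, lap u x ^ 2 := by
    apply setIntegral_eq_integral_of_forall_compl_eq_zero
    intro y hy
    rw [lap_zero u y (fun h => hy (hsub h))]; norm_num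
  have e : ∀ y, |lap u y| ^ 2 = lap u y ^ 2 := fun y => sq_abs _
  have e2 : ∫⁻ y, ENNReal.ofReal (|lap u y| ^ 2) = ∫⁻ y, ENNReal.ofReal (lap u y ^ 2) :=
    lintegral_congr (fun y => by rw [e])
  have e3 := ofReal_integral_eq_lintegral_ofReal hi (Filter.Eventually.of_forall (fun y => sq_nonneg _))
  rw [e2, ← e3, ← hset]
  exact ENNReal.ofReal_le_one.mpr hint

/-- Adams' inequality in dimension 4: there is `C > 0` such that for every
bounded open `Ω ⊆ ℝ⁴` and every smooth `u` compactly supported in `Ω` with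
`∫_Ω (Δu)² dx ≤ 1`, one has `∫_Ω e^{32π² u²} dx ≤ C · vol(Ω)`. -/
theorem adams_inequality :
    ∃ C > 0, ∀ (Ω : Set (EuclideanSpace ℝ (Fin 4))), IsOpen Ω → Bornology.IsBounded Ω →
      ∀ u : EuclideanSpace ℝ (Fin 4) → ℝ, ContDiff ℝ (⊤ : ℕ∞) u → HasCompactSupport u →
        tsupport u ⊆ Ω →
        (∫ x in Ω, (lap u x) ^ 2) ≤ 1 →
        (∫ x in Ω, Real.exp (32 * π ^ 2 * (u x) ^ 2)) ≤ C * (volume Ω).toReal := by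
  obtain ⟨C, hC, hdisc⟩ := disc_main
  refine ⟨Real.exp 1 * C, by positivity, ?_⟩
  intro Ω hΩo hΩb u hu hc hsub hint
  have hfin : volume Ω ≠ ⊤ := hΩb.measure_lt_top.ne
  rcases eq_or_ne (volume Ω) 0 with h0 | h0
  · rw [Measure.restrict_eq_zero.mpr h0]; simp [h0]
  set V := (volume Ω).toReal with hVdef
  have hV : 0 < V := ENNReal.toReal_pos h0 hfin
  have hΩV : volume Ω = ENNReal.ofReal V := (ENNReal.ofReal_toReal hfin).symm
  set G : E4 → ℝ := fun y => |lap u y| with hGdef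
  have hlc := lap_cont u hu
  have hlcs : HasCompactSupport (lap u) := HasCompactSupport.intro hc (fun y hy => lap_zero u y hy)
  obtain ⟨M, hM⟩ := hlcs.exists_bound_of_continuous hlc
  have hGint : ∫⁻ y, ENNReal.ofReal (G y ^ 2) ≤ 1 := lap_lint Ω u hu hc hsub hint
  have hJ : ∫⁻ s in Set.Ioc 0 V, rearr G s ^ 2 ≤ 1 :=
    (stepD G hlc.abs (fun y => abs_nonneg _) M hM V).trans hGint
  have hLle : LSeq G V 0 ≤ 1 := by
    unfold LSeq
    rw [scl_zero, Real.sqrt_le_iff, one_pow]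
    refine ⟨zero_le_one, ?_⟩
    exact ENNReal.toReal_le_of_le_ofReal zero_le_one (by simpa using hJ)
  have hd := hdisc (aSeq G V) (LSeq G V) (fun k => Real.sqrt_nonneg _) (fun k => Real.sqrt_nonneg _)
    (stepE_L G V hV hJ) hLle
  have hf := final_lint Ω hΩo u hu (fun k => ∑ j ∈ Finset.range k, aSeq G V j + 2 * LSeq G V k)
    (fun k => add_nonneg (Finset.sum_nonneg (fun i _ => Real.sqrt_nonneg _)) (mul_nonneg zero_le_two (Real.sqrt_nonneg _)))
    V hV hΩV (fun k => level_bound Ω u hu hc hsub V hV hΩV hJ k)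
  have hcu := hu.continuous
  rw [integral_eq_lintegral_of_nonneg_ae (Filter.Eventually.of_forall (fun x => (Real.exp_pos _).le))
    (Continuous.aestronglyMeasurable (by fun_prop))]
  apply ENNReal.toReal_le_of_le_ofReal (by positivity)
  refine (hf.trans (mul_le_mul' le_rfl hd)).trans (le_of_eq ?_)
  rw [← ENNReal.ofReal_mul (by positivity)]
  congr 1; ring

end
end
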